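/- arXiv:2105.08983 — 3 statements merged into one kernel-verified Lean document; each statement's English description precedes it below -/
import Mathlib

section
/- Let F₁ be a bounded viscosity subsolution and F₂ a bounded viscosity supersolution of ∂ₜF + (∂ₓF)₊ H̃[F] = 0 on (0,∞) × ℝ. If F₁(0,·) ≤ F₂(0,·) on ℝ, then F₁ ≤ F₂ on [0,∞) × ℝ. -/
open Filter Set MeasureTheory Topology

/-- The principal value `H̃[φ](x) = pv ∫ (φ(x) - φ(y))/(x-y)² dy` converges to `L`. -/
def HTildeTendsto (φ : ℝ → ℝ) (x L : ℝ) : Prop :=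
  Tendsto (fun ε : ℝ => ∫ y in {y : ℝ | ε ≤ |x - y|}, (φ x - φ y) / (x - y) ^ 2)
    (𝓝[>] 0) (𝓝 L)

/-- The value of the principal value `H̃[φ](x)` (junk value if the limit does not exist). -/
noncomputable def HTilde (φ : ℝ → ℝ) (x : ℝ) : ℝ :=
  limUnder (𝓝[>] (0 : ℝ))
    (fun ε : ℝ => ∫ y in {y : ℝ | ε ≤ |x - y|}, (φ x - φ y) / (x - y) ^ 2)

/-- Test functions: continuously differentiable in time and, for each time, bounded in
space, twice differentiable in space with bounded second spatial derivative. -/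
def TestFun (φ : ℝ → ℝ → ℝ) : Prop :=
  (∀ x, ContDiff ℝ 1 fun t => φ t x) ∧
  ∀ t : ℝ,
    (∃ M, ∀ x, |φ t x| ≤ M) ∧
    (∀ x, DifferentiableAt ℝ (φ t) x) ∧
    (∀ x, DifferentiableAt ℝ (deriv (φ t)) x) ∧
    (∃ M, ∀ x, |deriv (deriv (φ t)) x| ≤ M)

/-- Viscosity subsolution of `∂ₜF + (∂ₓF)₊ Op[F] = 0` on `(0,∞) × ℝ`. -/
def IsSubsolution (Op : (ℝ → ℝ) → ℝ → ℝ) (F : ℝ → ℝ → ℝ) : Prop :=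
  UpperSemicontinuousOn (fun p : ℝ × ℝ => F p.1 p.2) (Set.Ici 0 ×ˢ Set.univ) ∧
  ∀ φ : ℝ → ℝ → ℝ, TestFun φ → ∀ t₀ x₀ : ℝ, 0 < t₀ →
    (∀ t x : ℝ, 0 ≤ t → (t, x) ≠ (t₀, x₀) → F t x - φ t x < F t₀ x₀ - φ t₀ x₀) →
    deriv (fun t => φ t x₀) t₀ + max (deriv (φ t₀) x₀) 0 * Op (φ t₀) x₀ ≤ 0

/-- Viscosity supersolution of `∂ₜF + (∂ₓF)₊ Op[F] = 0` on `(0,∞) × ℝ`. -/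
def IsSupersolution (Op : (ℝ → ℝ) → ℝ → ℝ) (F : ℝ → ℝ → ℝ) : Prop :=
  LowerSemicontinuousOn (fun p : ℝ × ℝ => F p.1 p.2) (Set.Ici 0 ×ˢ Set.univ) ∧
  ∀ φ : ℝ → ℝ → ℝ, TestFun φ → ∀ t₀ x₀ : ℝ, 0 < t₀ →
    (∀ t x : ℝ, 0 ≤ t → (t, x) ≠ (t₀, x₀) → F t₀ x₀ - φ t₀ x₀ < F t x - φ t x) →
    0 ≤ deriv (fun t => φ t x₀) t₀ + max (deriv (φ t₀) x₀) 0 * Op (φ t₀) x₀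

/-- Lower semicontinuous envelope `F₋(t,x) = liminf_{0 ≤ s → t, y → x} F(s,y)`. -/
noncomputable def lscEnv (F : ℝ → ℝ → ℝ) (t x : ℝ) : ℝ :=
  liminf (fun p : ℝ × ℝ => F p.1 p.2) (𝓝[Set.Ici 0 ×ˢ Set.univ] (t, x))

/-- Viscosity solution: an usc subsolution whose lsc envelope is a supersolution. -/
def IsSolution (Op : (ℝ → ℝ) → ℝ → ℝ) (F : ℝ → ℝ → ℝ) : Prop :=
  IsSubsolution Op F ∧ IsSupersolution Op (fun t x => lscEnv F t x)

theorem measurableSet_le_abs (r : ℝ) : MeasurableSet {z : ℝ | r ≤ |z|} :=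
  measurableSet_le measurable_const measurable_norm

theorem integrableOn_inv_sq {r : ℝ} (hr : 0 < r) :
    IntegrableOn (fun z : ℝ => 1 / z ^ 2) {z | r ≤ |z|} ∧
      ∫ z in {z : ℝ | r ≤ |z|}, 1 / z ^ 2 = 2 / r := by
  have hset : {z : ℝ | r ≤ |z|} = Iic (-r) ∪ Ici r := by
    ext z; simp only [mem_ofPred_eq, le_abs, mem_union, mem_Iic, mem_Ici]
    constructor <;> (rintro (h | h)) <;> first | (left; linarith) | (right; linarith)
  have heq : ∀ z ∈ Ioi r, z ^ (-2 : ℝ) = 1 / z ^ 2 := by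
    intro z hz
    have hz0 : 0 < z := hr.trans hz
    rw [Real.rpow_neg hz0.le, one_div]; norm_num
  have h1 : IntegrableOn (fun z : ℝ => 1 / z ^ 2) (Ioi r) :=
    (integrableOn_Ioi_rpow_of_lt (by norm_num : (-2 : ℝ) < -1) hr).congr_fun heq measurableSet_Ioi
  have h1v : ∫ z in Ioi r, 1 / z ^ 2 = 1 / r := by
    rw [← setIntegral_congr_fun measurableSet_Ioi heq,
      integral_Ioi_rpow_of_lt (by norm_num : (-2 : ℝ) < -1) hr]
    have : r ^ (-2 + 1 : ℝ) = r⁻¹ := by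
      rw [show (-2 + 1 : ℝ) = -1 by norm_num, Real.rpow_neg_one]
    rw [this]; field_simp; norm_num
  have h1' : IntegrableOn (fun z : ℝ => 1 / z ^ 2) (Ici r) := (integrableOn_Ici_iff_integrableOn_Ioi (by finiteness)).2 h1
  have h1v' : ∫ z in Ici r, 1 / z ^ 2 = 1 / r := by rw [integral_Ici_eq_integral_Ioi, h1v]
  have h2 : IntegrableOn (fun z : ℝ => 1 / z ^ 2) (Iic (-r)) := by
    have := h1'.comp_neg
    simpa using this
  have h2v : ∫ z in Iic (-r), 1 / z ^ 2 = 1 / r := by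
    have := integral_comp_neg_Iic (-r) (fun z : ℝ => 1 / z ^ 2)
    simp only [neg_neg, even_two, Even.neg_pow] at this
    rw [this, h1v]
  have hd : Disjoint (Iic (-r)) (Ici r) := by
    rw [Set.disjoint_left]; intro z hz hz'; simp at hz hz'; linarith
  rw [hset]
  refine ⟨h2.union h1', ?_⟩
  rw [setIntegral_union hd measurableSet_Ici h2 h1', h2v, h1v']; ring

/-- The truncated integral defining `H̃`, written in the shifted variable `z = y - x`. -/
noncomputable def tail (f : ℝ → ℝ) (x r : ℝ) : ℝ :=
  ∫ z in {z : ℝ | r ≤ |z|}, (f x - f (x + z)) / z ^ 2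

theorem integrableOn_div_sq {f : ℝ → ℝ} {C r : ℝ} (hr : 0 < r) (hf : Measurable f)
    (hb : ∀ z, r ≤ |z| → |f z| ≤ C) : IntegrableOn (fun z => f z / z ^ 2) {z | r ≤ |z|} := by
  refine Integrable.mono' ((integrableOn_inv_sq hr).1.const_mul C)
    (Measurable.aestronglyMeasurable (hf.div (by fun_prop))) ?_
  filter_upwards [ae_restrict_mem (measurableSet_le_abs r)] with z hz
  rw [norm_div, norm_pow, Real.norm_eq_abs, Real.norm_eq_abs, sq_abs, mul_one_div]
  gcongr
  exact hb z hz

theorem truncated_eq_tail (f : ℝ → ℝ) (x ε : ℝ) :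
    (∫ y in {y : ℝ | ε ≤ |x - y|}, (f x - f y) / (x - y) ^ 2) = tail f x ε := by
  unfold tail
  rw [← integral_indicator (measurableSet_le_abs ε), ← integral_indicator
    (measurableSet_le measurable_const (by fun_prop)),
    ← integral_add_left_eq_self _ x]
  congr 1; ext z
  simp [indicator]

theorem setIntegral_odd {f : ℝ → ℝ} (hf : ∀ z, f (-z) = - f z) (r : ℝ) :
    ∫ z in {z : ℝ | r ≤ |z|}, f z = 0 := by
  rw [← integral_indicator (measurableSet_le_abs r)]
  have h := integral_neg_eq_self (({z : ℝ | r ≤ |z|}).indicator f) volume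
  have : ∀ z, ({z : ℝ | r ≤ |z|}).indicator f (-z) = - ({z : ℝ | r ≤ |z|}).indicator f z := by
    intro z; simp only [indicator, mem_ofPred_eq, abs_neg, hf]; split_ifs <;> simp
  simp only [this, integral_neg] at h
  linarith

theorem aecover_le_abs : AECover (volume : Measure ℝ) (𝓝[>] (0 : ℝ)) fun ε => {z : ℝ | ε ≤ |z|} where
  ae_eventually_mem := by
    have : ∀ᵐ z : ℝ, z ≠ 0 := by simp [ae_iff]
    filter_upwards [this] with z hz
    have : Iio |z| ∈ 𝓝[>] (0 : ℝ) := mem_nhdsWithin_of_mem_nhds (Iio_mem_nhds (abs_pos.2 hz))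
    filter_upwards [this] with ε hε using le_of_lt hε
  measurableSet := measurableSet_le_abs

/-- The truncated integrals with the odd first order part removed. -/
theorem tail_eq_regularised {f : ℝ → ℝ} {M x r p δ : ℝ} (hr : 0 < r) (hf : Measurable f)
    (hb : ∀ y, |f y| ≤ M) (hδ : 0 < δ) :
    tail f x r = ∫ z in {z : ℝ | r ≤ |z|},
      (f x - f (x + z) + (if |z| < δ then p * z else 0)) / z ^ 2 := by
  have hm : Measurable fun z : ℝ => if |z| < δ then p * z else 0 :=
    Measurable.ite (measurableSet_lt measurable_norm measurable_const) (by fun_prop) (by fun_prop)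
  have h0 : ∫ z in {z : ℝ | r ≤ |z|}, (if |z| < δ then p * z else 0) / z ^ 2 = 0 := by
    apply setIntegral_odd
    intro z; simp only [abs_neg]; split_ifs <;> simp [neg_div]
  have i1 : IntegrableOn (fun z => (f x - f (x + z)) / z ^ 2) {z | r ≤ |z|} :=
    integrableOn_div_sq (C := 2 * M) hr (by fun_prop) fun z _ => by
      have := hb x; have := hb (x + z); rw [abs_le] at *; constructor <;> linarith
  have i2 : IntegrableOn (fun z => (if |z| < δ then p * z else 0) / z ^ 2) {z | r ≤ |z|} :=
    integrableOn_div_sq (C := |p| * δ) hr hm fun z _ => by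
      split_ifs with h
      · rw [abs_mul]; gcongr
      · simp; positivity
  have h := integral_add i1 i2
  rw [h0, add_zero] at h
  rw [tail, ← h]
  congr 1; ext z; rw [add_div]

theorem exists_tendsto_tail {f : ℝ → ℝ} {M C x p : ℝ} (hf : Measurable f)
    (hb : ∀ y, |f y| ≤ M) (hq : ∀ z, |z| ≤ 1 → |f (x + z) - f x - p * z| ≤ C * z ^ 2) :
    ∃ L, Tendsto (tail f x) (𝓝[>] 0) (𝓝 L) := by
  set R : ℝ → ℝ := fun z => (f x - f (x + z) + (if |z| < 1 then p * z else 0)) / z ^ 2 with hR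
  have hm : Measurable fun z : ℝ => if |z| < 1 then p * z else 0 :=
    Measurable.ite (measurableSet_lt measurable_norm measurable_const) (by fun_prop) (by fun_prop)
  have hRm : Measurable R := by
    have : Measurable fun z => f (x + z) := by fun_prop
    exact ((measurable_const.sub this).add hm).div (by fun_prop)
  have hM : 0 ≤ M := (abs_nonneg _).trans (hb 0)
  have iR : Integrable R := by
    have i1 : IntegrableOn R {z | 1 ≤ |z|} := by
      refine integrableOn_div_sq (C := 2 * M + |p|) one_pos (by fun_prop) fun z hz => ?_
      have h1 := hb x
      have h2 := hb (x + z)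
      have h3 : |(if |z| < 1 then p * z else 0)| ≤ |p| := by
        split_ifs with h
        · rw [abs_mul]; exact mul_le_of_le_one_right (abs_nonneg _) h.le
        · simp
      rw [abs_le] at *; constructor <;> linarith
    have i2 : IntegrableOn R (Ioo (-1) 1) := by
      have : IntegrableOn (fun _ : ℝ => |C|) (Ioo (-1 : ℝ) 1) := by
        rw [integrableOn_const_iff]; right; simp
      refine Integrable.mono' this hRm.aestronglyMeasurable ?_
      filter_upwards [ae_restrict_mem measurableSet_Ioo] with z hz
      have hz1 : |z| < 1 := abs_lt.2 hz
      have := hq z hz1.le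
      simp only [hR, hz1, if_true, norm_div, Real.norm_eq_abs, abs_pow, sq_abs]
      rw [show f x - f (x + z) + p * z = -(f (x + z) - f x - p * z) by ring, abs_neg]
      apply div_le_of_le_mul₀ (sq_nonneg z) (abs_nonneg C)
      exact this.trans (by gcongr; exact le_abs_self C)
    have hu : {z : ℝ | 1 ≤ |z|} ∪ Ioo (-1) 1 = univ := by
      ext z; simp only [mem_union, mem_ofPred_eq, mem_univ, iff_true]
      rcases le_or_gt 1 |z| with h | h
      · exact Or.inl h
      · exact Or.inr (abs_lt.1 h)
    rw [← integrableOn_univ, ← hu]; exact i1.union i2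
  refine ⟨∫ z, R z, ?_⟩
  refine (aecover_le_abs.integral_tendsto_of_countably_generated iR).congr' ?_
  filter_upwards [self_mem_nhdsWithin] with ε hε
  exact (tail_eq_regularised hε hf hb one_pos).symm

theorem tendsto_tail_HTilde {f : ℝ → ℝ} {M C x p : ℝ} (hf : Measurable f)
    (hb : ∀ y, |f y| ≤ M) (hq : ∀ z, |z| ≤ 1 → |f (x + z) - f x - p * z| ≤ C * z ^ 2) :
    Tendsto (tail f x) (𝓝[>] 0) (𝓝 (HTilde f x)) := by
  obtain ⟨L, hL⟩ := exists_tendsto_tail hf hb hq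
  have : HTilde f x = L := by
    unfold HTilde
    simp only [truncated_eq_tail]
    exact hL.limUnder_eq
  rwa [this]

/-- Second order Taylor bound from a local bound on the second derivative. -/
theorem taylor_two_bound_of_le {f : ℝ → ℝ} {C x ρ : ℝ} (h1 : ∀ y, DifferentiableAt ℝ f y)
    (h2 : ∀ y, DifferentiableAt ℝ (deriv f) y)
    (hC : ∀ y, |y - x| ≤ ρ → |deriv (deriv f) y| ≤ C) {z : ℝ} (hz : |z| ≤ ρ) :
    |f (x + z) - f x - deriv f x * z| ≤ C * z ^ 2 := by
  have hρ : 0 ≤ ρ := (abs_nonneg z).trans hz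
  have hC0 : 0 ≤ C := (abs_nonneg _).trans (hC x (by simpa))
  have hlip : ∀ y, |y - x| ≤ ρ → |deriv f y - deriv f x| ≤ C * |y - x| := fun y hy => by
    have := Convex.norm_image_sub_le_of_norm_deriv_le (f := deriv f) (C := C)
      (s := Metric.closedBall x ρ)
      (fun y _ => h2 y) (fun y hy => hC y (by simpa [Real.dist_eq] using hy))
      (convex_closedBall _ _) (x := x) (y := y) (by simpa) (by simpa [Real.dist_eq] using hy)
    simpa [Real.norm_eq_abs] using this
  have hg : ∀ y, HasDerivAt (fun y => f y - deriv f x * (y - x)) (deriv f y - deriv f x) y := by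
    intro y
    have := (h1 y).hasDerivAt.sub (((hasDerivAt_id y).sub_const x).const_mul (deriv f x))
    simpa [Pi.sub_def] using this
  have := Convex.norm_image_sub_le_of_norm_hasDerivWithin_le (C := C * |z|)
    (s := Metric.closedBall x |z|) (f := fun y => f y - deriv f x * (y - x))
    (x := x) (y := x + z)
    (fun y _ => (hg y).hasDerivWithinAt) (fun y hy => by
      have hy' : |y - x| ≤ |z| := by simpa [Real.dist_eq] using hy
      exact (hlip y (hy'.trans hz)).trans (mul_le_mul_of_nonneg_left hy' hC0))
    (convex_closedBall _ _) (by simp) (by simp)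
  simp only [Real.norm_eq_abs, add_sub_cancel_left, sub_self, mul_zero, sub_zero] at this
  calc _ = |f (x + z) - deriv f x * z - f x| := by congr 1; ring
    _ ≤ _ := this
    _ = C * z ^ 2 := by rw [mul_assoc, ← sq, sq_abs]

theorem TestFun.tendsto_tail {φ : ℝ → ℝ → ℝ} (h : TestFun φ) (t x : ℝ) :
    Tendsto (tail (φ t) x) (𝓝[>] 0) (𝓝 (HTilde (φ t) x)) := by
  obtain ⟨⟨M, hM⟩, h1, h2, ⟨C, hC⟩⟩ := h.2 t
  exact tendsto_tail_HTilde (Continuous.measurable (continuous_iff_continuousAt.2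
    fun x => (h1 x).continuousAt)) hM (fun z _ => taylor_two_bound_of_le h1 h2 (fun y _ => hC y) le_rfl)

theorem tail_reflect (f : ℝ → ℝ) (x r : ℝ) :
    tail (fun v => - f (-v)) x r = - tail f (-x) r := by
  unfold tail
  rw [← integral_indicator (measurableSet_le_abs r), ← integral_indicator (measurableSet_le_abs r),
    ← integral_neg_eq_self, ← integral_neg]
  congr 1; ext z
  simp only [indicator, mem_ofPred_eq, abs_neg]
  split_ifs
  · rw [show -(x + -z) = -x + z by ring]; simp only [even_two, Even.neg_pow]; ring
  · simp

/-- Reflection turns supersolutions into subsolutions. -/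
theorem IsSupersolution.reflect {F : ℝ → ℝ → ℝ} (h : IsSupersolution HTilde F) :
    IsSubsolution HTilde (fun t v => - F t (-v)) := by
  constructor
  · have hc : ContinuousOn (fun p : ℝ × ℝ => (p.1, -p.2)) (Ici 0 ×ˢ univ) := by fun_prop
    have hm : MapsTo (fun p : ℝ × ℝ => (p.1, -p.2)) (Ici 0 ×ˢ univ) (Ici 0 ×ˢ univ) := by
      intro p hp; simpa using hp
    have h2 := h.1.comp hc hm
    intro p hp c hc'
    have := h2 p hp (-c) (by simp only [Function.comp] at *; linarith)
    filter_upwards [this] with q hq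
    simp only [Function.comp] at hq
    linarith
  · intro φ hφ t₀ x₀ ht₀ hmax
    set ψ : ℝ → ℝ → ℝ := fun t x => - φ t (-x) with hψ
    have hd : ∀ t x, deriv (ψ t) x = deriv (φ t) (-x) := by
      intro t x
      have := ((((hφ.2 t).2.1 (-x)).hasDerivAt).comp x (hasDerivAt_neg x)).neg
      simpa [hψ, Function.comp_def] using this.deriv
    have hd' : ∀ t, deriv (ψ t) = fun x => deriv (φ t) (-x) := fun t => funext (hd t)
    have hψT : TestFun ψ := by
      refine ⟨fun x => (hφ.1 (-x)).neg, fun t => ?_⟩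
      obtain ⟨⟨M, hM⟩, h1, h2, ⟨C, hC⟩⟩ := hφ.2 t
      have hdd : ∀ x, HasDerivAt (deriv (ψ t)) (- deriv (deriv (φ t)) (-x)) x := by
        intro x
        rw [hd']
        simpa [Function.comp_def] using ((h2 (-x)).hasDerivAt).comp x (hasDerivAt_neg x)
      refine ⟨⟨M, fun x => by simpa [hψ] using hM (-x)⟩, fun x => ?_,
        fun x => (hdd x).differentiableAt, ⟨C, fun x => by rw [(hdd x).deriv, abs_neg]; exact hC _⟩⟩
      exact (((h1 (-x)).comp x differentiableAt_id.neg)).neg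
    have key := h.2 ψ hψT t₀ (-x₀) ht₀ (by
      intro t x ht hne
      have := hmax t (-x) ht (by
        intro he; apply hne; simp only [Prod.mk.injEq] at he ⊢; exact ⟨he.1, by linarith [he.2]⟩)
      simp only [hψ, neg_neg] at this ⊢
      linarith)
    have ht1 : HTilde (ψ t₀) (-x₀) = - HTilde (φ t₀) x₀ := by
      have l1 := hψT.tendsto_tail t₀ (-x₀)
      have l2 := (hφ.tendsto_tail t₀ x₀).neg
      have : tail (ψ t₀) (-x₀) = fun r => - tail (φ t₀) x₀ r := by
        funext r; rw [hψ]; simp only [tail_reflect, neg_neg]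
      rw [this] at l1
      exact tendsto_nhds_unique l1 l2
    have ht2 : deriv (fun t => ψ t (-x₀)) t₀ = - deriv (fun t => φ t x₀) t₀ := by
      simp only [hψ, neg_neg]; exact deriv.fun_neg
    rw [ht1, ht2, hd, neg_neg] at key
    linarith

/-- A bounded usc function is approximated from above by lsc functions, in the weighted `L¹`
sense relevant for truncated integrals. -/
theorem exists_lsc_gt_integral_le {f : ℝ → ℝ} {M r δ : ℝ} (x₀ : ℝ) (hf : UpperSemicontinuous f)
    (hb : ∀ x, |f x| ≤ M) (hr : 0 < r) (hδ : 0 < δ) :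
    ∃ u : ℝ → ℝ, LowerSemicontinuous u ∧ (∀ x, f x < u x) ∧ (∀ x, u x ≤ M + 1) ∧
      ∫ z in {z : ℝ | r ≤ |z|}, (u (x₀ + z) - f (x₀ + z)) / z ^ 2 ≤ δ := by
  have hfm : Measurable f := hf.measurable
  have hM : 0 ≤ M := (abs_nonneg _).trans (hb 0)
  set k : ℝ → NNReal := fun z => (max (z ^ 2) (r ^ 2)).toNNReal⁻¹ with hk
  have hkm : Measurable k := by fun_prop
  have hpos : ∀ z : ℝ, 0 < max (z ^ 2) (r ^ 2) := fun z => lt_max_of_lt_right (by positivity)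
  have hkv : ∀ z, (k z : ℝ) = (max (z ^ 2) (r ^ 2))⁻¹ := fun z => by
    simp [hk, Real.coe_toNNReal _ (hpos z).le]
  have hkr : ∀ z, r ≤ |z| → (k z : ℝ) = 1 / z ^ 2 := fun z hz => by
    rw [hkv, one_div, max_eq_left]; rw [← sq_abs z]; gcongr
  have hki : Integrable (fun z => (k z : ℝ)) := by
    have hu : {z : ℝ | r ≤ |z|} ∪ Icc (-r) r = univ := by
      ext z; simp only [mem_union, mem_ofPred_eq, mem_univ, iff_true]
      rcases le_total r |z| with h | h
      · exact Or.inl h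
      · exact Or.inr (abs_le.1 h)
    rw [← integrableOn_univ, ← hu]
    refine IntegrableOn.union ((integrableOn_inv_sq hr).1.congr_fun (fun z hz => (hkr z hz).symm)
      (measurableSet_le_abs r)) ?_
    have : IntegrableOn (fun _ : ℝ => (r ^ 2)⁻¹) (Icc (-r) r) := by
      rw [integrableOn_const_iff]; right; simp
    refine Integrable.mono' this hkm.coe_nnreal_real.aestronglyMeasurable (ae_of_all _ fun z => ?_)
    rw [NNReal.norm_eq, hkv]
    gcongr; exact le_max_right _ _
  have hfin : IsFiniteMeasure (volume.withDensity fun z => (k z : ENNReal)) := by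
    apply isFiniteMeasure_withDensity
    have := hki.2
    rw [hasFiniteIntegral_iff_enorm] at this
    simpa using this.ne
  set μ := volume.withDensity fun z => (k z : ENNReal) with hμ
  have hfi : Integrable (fun z => f (x₀ + z)) μ := by
    refine Integrable.mono' (integrable_const M)
      (hfm.comp (measurable_const_add x₀)).aestronglyMeasurable (ae_of_all _ fun z => hb _)
  obtain ⟨g, g1, g2, g3, g4, g5⟩ := exists_lt_lowerSemicontinuous_integral_lt _ hfi hδ
  set u : ℝ → ℝ := fun x => (min (g (x - x₀)) ((M + 1 : ℝ) : EReal)).toReal with hu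
  have hfM : ∀ x, f x < M + 1 := fun x => by linarith [(abs_le.1 (hb x)).2]
  have g1' : ∀ x, (f x : EReal) < g (x - x₀) := fun x => by simpa using g1 (x - x₀)
  have hlt : ∀ x, (f x : EReal) < min (g (x - x₀)) ((M + 1 : ℝ) : EReal) := fun x =>
    lt_min (g1' x) (EReal.coe_lt_coe_iff.2 (hfM x))
  have hcoe : ∀ x, (u x : EReal) = min (g (x - x₀)) ((M + 1 : ℝ) : EReal) := fun x => by
    apply EReal.coe_toReal
    · exact ((min_le_right _ _).trans_lt (EReal.coe_lt_top _)).ne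
    · exact ((EReal.bot_lt_coe _).trans (hlt x)).ne'
  have hu1 : LowerSemicontinuous u := by
    intro x c hc
    have h1 : (c : EReal) < g (x - x₀) ∧ (c : EReal) < ((M + 1 : ℝ) : EReal) := by
      rw [← lt_min_iff, ← hcoe]; exact EReal.coe_lt_coe_iff.2 hc
    have h2 : Tendsto (fun y => y - x₀) (𝓝 x) (𝓝 (x - x₀)) := by
      exact (continuous_id.sub continuous_const).tendsto x
    filter_upwards [h2.eventually (g2 (x - x₀) _ h1.1)] with y hy
    rw [gt_iff_lt, ← EReal.coe_lt_coe_iff, hcoe]; exact lt_min hy h1.2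
  have hu2 : ∀ x, f x < u x := fun x => by rw [← EReal.coe_lt_coe_iff, hcoe]; exact hlt x
  have hu3 : ∀ x, u x ≤ M + 1 := fun x => by
    rw [← EReal.coe_le_coe_iff, hcoe]; exact min_le_right _ _
  refine ⟨u, hu1, hu2, hu3, ?_⟩
  have hum : Measurable u := hu1.measurable
  have hui : Integrable (fun z => u (x₀ + z)) μ := by
    refine Integrable.mono' (integrable_const (M + 1))
      (hum.comp (measurable_const_add x₀)).aestronglyMeasurable (ae_of_all _ fun z => ?_)
    rw [Real.norm_eq_abs, abs_le]
    exact ⟨by linarith [(abs_le.1 (hb (x₀ + z))).1, hu2 (x₀ + z)], hu3 _⟩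
  have hle : ∫ z, u (x₀ + z) - f (x₀ + z) ∂μ ≤ δ := by
    rw [integral_sub hui hfi]
    have : ∫ z, u (x₀ + z) ∂μ ≤ ∫ z, (g z).toReal ∂μ := by
      apply integral_mono_ae hui g3
      filter_upwards [g4] with z hz
      have hb' : g z ≠ ⊥ := ((EReal.bot_lt_coe _).trans (g1 z)).ne'
      rw [← EReal.coe_le_coe_iff, hcoe, EReal.coe_toReal hz.ne hb']
      simp
    linarith
  rw [hμ, integral_withDensity_eq_integral_smul hkm] at hle
  refine le_trans ?_ hle
  have hi : Integrable (fun z => k z • (u (x₀ + z) - f (x₀ + z))) := by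
    rw [← integrable_withDensity_iff_integrable_smul hkm]; exact hui.sub hfi
  rw [setIntegral_congr_fun (g := fun z => k z • (u (x₀ + z) - f (x₀ + z)))
    (measurableSet_le_abs r) (fun z hz => by
      simp only [NNReal.smul_def, hkr z hz, smul_eq_mul]; ring)]
  apply setIntegral_le_integral hi (ae_of_all _ fun z => ?_)
  simp only [NNReal.smul_def, smul_eq_mul]
  exact mul_nonneg (k z).2 (sub_nonneg.2 (hu2 _).le)

/-- A jointly smooth function which is constant for large `|x|` is a test function. -/
theorem testFun_of_contDiff {φ : ℝ → ℝ → ℝ} {c x₀ R : ℝ}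
    (h : ContDiff ℝ 2 fun q : ℝ × ℝ => φ q.1 q.2) (hR : ∀ t x, R ≤ |x - x₀| → φ t x = c) :
    TestFun φ := by
  refine ⟨fun x => ?_, fun t => ?_⟩
  · have : ContDiff ℝ 2 fun t : ℝ => φ t x := h.comp (contDiff_id.prodMk contDiff_const)
    exact this.of_le (by norm_num)
  have h2 : ContDiff ℝ 2 (φ t) := h.comp (contDiff_const.prodMk contDiff_id)
  have h1 : ContDiff ℝ 1 (deriv (φ t)) := by
    have := (contDiff_succ_iff_deriv (n := 1) (f := φ t)).1 (by rw [one_add_one_eq_two]; exact h2)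
    exact this.2.2
  have h0 : Continuous (deriv (deriv (φ t))) := h1.continuous_deriv le_rfl
  have key : ∀ (f : ℝ → ℝ) (c : ℝ), Continuous f → (∀ x, R < |x - x₀| → f x = c) →
      ∃ M, ∀ x, |f x| ≤ M := by
    intro f c hf hc
    obtain ⟨M, hM⟩ := (isCompact_closedBall x₀ R).exists_bound_of_continuousOn hf.continuousOn
    refine ⟨max M |c|, fun x => ?_⟩
    rcases le_or_gt |x - x₀| R with hx | hx
    · exact (hM x (by simpa [Real.dist_eq] using hx)).trans (le_max_left _ _)
    · rw [hc x hx]; exact le_max_right _ _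
  have loc : ∀ (f : ℝ → ℝ) (c : ℝ), (∀ x, R < |x - x₀| → f x = c) →
      ∀ x, R < |x - x₀| → deriv f x = 0 := by
    intro f c hc x hx
    have : f =ᶠ[𝓝 x] fun _ => c := by
      have ho : IsOpen {y : ℝ | R < |y - x₀|} := isOpen_lt continuous_const (by fun_prop)
      filter_upwards [ho.mem_nhds hx] with y hy using hc y hy
    rw [this.deriv_eq, deriv_const]
  have c0 : ∀ x, R < |x - x₀| → φ t x = c := fun x hx => hR t x hx.le
  refine ⟨key _ c h2.continuous c0, fun x => (h2.differentiable (by norm_num)) x,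
    fun x => (h1.differentiable (by norm_num)) x, key _ 0 h0 (loc _ 0 (loc _ c c0))⟩

section

open scoped Manifold ContDiff

theorem exists_contDiff_touching {F : ℝ → ℝ → ℝ} {M : ℝ} {Q₁ : ℝ × ℝ → ℝ} {u : ℝ → ℝ}
    {q₀ : ℝ × ℝ} {r R : ℝ}
    (hF : UpperSemicontinuousOn (fun p : ℝ × ℝ => F p.1 p.2) (Set.Ici 0 ×ˢ Set.univ))
    (hb : ∀ t x, 0 ≤ t → |F t x| ≤ M) (hr : 0 < r) (hR : 2 * r ≤ R) (hQ : ContDiff ℝ 2 Q₁)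
    (hFQ : ∀ q : ℝ × ℝ, 0 ≤ q.1 → q ≠ q₀ → dist q q₀ < 2 * r → F q.1 q.2 < Q₁ q)
    (ht₀ : 0 < q₀.1) (hu : LowerSemicontinuous u) (hFu : ∀ x, F q₀.1 x < u x)
    (huM : ∀ x, u x ≤ M + 1) :
    ∃ φ : ℝ × ℝ → ℝ, ContDiff ℝ 2 φ ∧ (∀ q : ℝ × ℝ, 0 ≤ q.1 → q ≠ q₀ → F q.1 q.2 < φ q) ∧
      (∀ q, dist q q₀ < r → φ q = Q₁ q) ∧
      (∀ x, φ (q₀.1, x) ≤ if |x - q₀.2| < 2 * r then max (Q₁ (q₀.1, x)) (u x) else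
        if |x - q₀.2| ≤ R then u x else M + 1) ∧
      (∀ q, R + 1 ≤ |q.2 - q₀.2| → φ q = M + 1) := by
  set U : ℝ → ℝ := fun x => if |x - q₀.2| < 2 * r then max (Q₁ (q₀.1, x)) (u x) else
        if |x - q₀.2| ≤ R then u x else M + 1 with hU
  have huU : ∀ x, u x ≤ U x := fun x => by
    simp only [hU]; split_ifs
    · exact le_max_right _ _
    · exact le_rfl
    · exact huM x
  have hFM : ∀ q : ℝ × ℝ, 0 ≤ q.1 → F q.1 q.2 < M + 1 := fun q hq => by
    linarith [(abs_le.1 (hb q.1 q.2 hq)).2]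
  set S : ℝ × ℝ → Set ℝ := fun q => {c | (0 ≤ q.1 → q ≠ q₀ → F q.1 q.2 < c) ∧
    (dist q q₀ < r → c = Q₁ q) ∧ (q.1 = q₀.1 → c ≤ U q.2) ∧
    (R + 1 ≤ |q.2 - q₀.2| → c = M + 1)} with hS
  have hconv : ∀ q, Convex ℝ (S q) := by
    intro q
    apply OrdConnected.convex
    refine ⟨fun a ha b hb c hc => ⟨fun h1 h2 => (ha.1 h1 h2).trans_le hc.1, fun h => ?_,
      fun h => hc.2.trans (hb.2.2.1 h), fun h => ?_⟩⟩
    · have h1 := ha.2.1 h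
      have h2 := hb.2.1 h
      exact le_antisymm (h2 ▸ hc.2) (h1 ▸ hc.1)
    · have h1 := ha.2.2.2 h
      have h2 := hb.2.2.2 h
      exact le_antisymm (h2 ▸ hc.2) (h1 ▸ hc.1)
  have hloc : ∀ q : ℝ × ℝ, ∃ V ∈ 𝓝 q, ∃ g : ℝ × ℝ → ℝ,
      ContMDiffOn 𝓘(ℝ, ℝ × ℝ) 𝓘(ℝ, ℝ) 2 g V ∧ ∀ y ∈ V, g y ∈ S y := by
    intro q
    have dist2 : ∀ y : ℝ × ℝ, |y.2 - q₀.2| ≤ dist y q₀ := fun y => by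
      rw [Prod.dist_eq, ← Real.dist_eq]; exact le_max_right _ _
    rcases lt_or_ge (dist q q₀) (2 * r) with hq | hq
    · refine ⟨Metric.ball q₀ (2 * r), Metric.isOpen_ball.mem_nhds hq, Q₁,
        hQ.contMDiff.contMDiffOn, fun y hy => ?_⟩
      have hy' : dist y q₀ < 2 * r := hy
      have hy2 : |y.2 - q₀.2| < 2 * r := (dist2 y).trans_lt hy'
      refine ⟨fun h1 h2 => hFQ y h1 h2 hy', fun _ => rfl, fun h => ?_, fun h => ?_⟩
      · simp only [hU, if_pos hy2]
        rw [← h]; exact le_max_left _ _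
      · linarith
    · have hfar : ∀ᶠ y in 𝓝 q, r < dist y q₀ :=
        (isOpen_lt continuous_const (by fun_prop)).mem_nhds (by simp only [mem_ofPred_eq]; linarith)
      rcases lt_or_ge R |q.2 - q₀.2| with hq2 | hq2
      · have h2 : ∀ᶠ y : ℝ × ℝ in 𝓝 q, R < |y.2 - q₀.2| :=
          (isOpen_lt continuous_const (by fun_prop)).mem_nhds hq2
        refine ⟨_, hfar.and h2, fun _ => M + 1, contMDiffOn_const, fun y hy => ?_⟩
        refine ⟨fun h1 _ => hFM y h1, fun h => absurd h hy.1.not_gt, fun _ => ?_, fun _ => rfl⟩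
        simp only [hU]
        rw [if_neg (by linarith [hy.2]), if_neg (by linarith [hy.2])]
      · have h2 : ∀ᶠ y : ℝ × ℝ in 𝓝 q, |y.2 - q₀.2| < R + 1 :=
          (isOpen_lt (by fun_prop) continuous_const).mem_nhds
            (by simp only [mem_ofPred_eq]; linarith)
        by_cases hq1 : q.1 = q₀.1
        · have hlt : F q.1 q.2 < u q.2 := by rw [hq1]; exact hFu _
          obtain ⟨c, hc1, hc2⟩ := exists_between hlt
          have h3 : ∀ᶠ y : ℝ × ℝ in 𝓝 q, c < u y.2 :=
            (continuous_snd.tendsto q).eventually (hu q.2 c hc2)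
          have h4 : ∀ᶠ y : ℝ × ℝ in 𝓝 q, F y.1 y.2 < c := by
            have hmem : Ici (0 : ℝ) ×ˢ (univ : Set ℝ) ∈ 𝓝 q := by
              rw [← mem_interior_iff_mem_nhds, interior_prod_eq]
              simp [hq1, ht₀]
            have := hF q (by simp [hq1, ht₀.le]) c hc1
            rwa [nhdsWithin_eq_nhds.2 hmem] at this
          refine ⟨_, hfar.and (h2.and (h3.and h4)), fun _ => c, contMDiffOn_const, fun y hy => ?_⟩
          obtain ⟨y1, y2, y3, y4⟩ := hy
          exact ⟨fun _ _ => y4, fun h => absurd h y1.not_gt, fun _ => y3.le.trans (huU _),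
            fun h => absurd y2 h.not_gt⟩
        · have h3 : ∀ᶠ y : ℝ × ℝ in 𝓝 q, y.1 ≠ q₀.1 :=
            (isOpen_ne_fun continuous_fst continuous_const).mem_nhds hq1
          refine ⟨_, hfar.and (h2.and h3), fun _ => M + 1, contMDiffOn_const, fun y hy => ?_⟩
          obtain ⟨y1, y2, y3⟩ := hy
          exact ⟨fun h _ => hFM y h, fun h => absurd h y1.not_gt, fun h => absurd h y3,
            fun _ => rfl⟩
  obtain ⟨φ, hφ⟩ := exists_contMDiffMap_forall_mem_convex_of_local 𝓘(ℝ, ℝ × ℝ) (n := 2) hconv hloc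
  refine ⟨φ, φ.contMDiff.contDiff, fun q => (hφ q).1, fun q => (hφ q).2.1,
    fun x => (hφ (q₀.1, x)).2.2.1 rfl, fun q => (hφ q).2.2.2⟩

end

/-- Subsolution inequality tested with smooth functions touching locally from above, the
nonlocal term being evaluated on `F` itself. -/
def LocSub (F : ℝ → ℝ → ℝ) : Prop :=
  ∀ (t₀ x₀ : ℝ) (Q : ℝ × ℝ → ℝ) (a p : ℝ), 0 < t₀ → ContDiff ℝ 2 Q → Q (t₀, x₀) = F t₀ x₀ →
    (∀ᶠ q : ℝ × ℝ in 𝓝 (t₀, x₀), F q.1 q.2 ≤ Q q) →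
    HasDerivAt (fun t => Q (t, x₀)) a t₀ → HasDerivAt (fun x => Q (t₀, x)) p x₀ →
    ∀ ε > 0, ∀ᶠ r in 𝓝[>] (0 : ℝ), a + max p 0 * tail (F t₀) x₀ r ≤ ε

theorem UpperSemicontinuousOn.slice {F : ℝ → ℝ → ℝ}
    (hF : UpperSemicontinuousOn (fun p : ℝ × ℝ => F p.1 p.2) (Set.Ici 0 ×ˢ Set.univ))
    {t : ℝ} (ht : 0 ≤ t) : UpperSemicontinuous (F t) := by
  intro x c hc
  have hx : ((t, x) : ℝ × ℝ) ∈ Ici (0 : ℝ) ×ˢ (univ : Set ℝ) := ⟨ht, trivial⟩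
  have h1 := hF (t, x) hx c hc
  have h2 : Tendsto (fun y : ℝ => (t, y)) (𝓝 x) (𝓝[Ici (0 : ℝ) ×ˢ (univ : Set ℝ)] (t, x)) :=
    tendsto_nhdsWithin_iff.2 ⟨(Continuous.prodMk_right t).tendsto x,
      Eventually.of_forall fun y => ⟨ht, trivial⟩⟩
  exact h2.eventually h1

theorem setIntegral_indicator_le_abs {ε ρ : ℝ} (h : ε ≤ ρ) (f : ℝ → ℝ) :
    ∫ z in {z : ℝ | ε ≤ |z|}, ({z : ℝ | ρ ≤ |z|}.indicator f) z
      = ∫ z in {z : ℝ | ρ ≤ |z|}, f z := by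
  rw [setIntegral_indicator (measurableSet_le_abs ρ)]
  congr 2
  ext z; simp only [mem_inter_iff, mem_ofPred_eq]; constructor
  · exact fun h => h.2
  · exact fun h' => ⟨h.trans h', h'⟩

theorem tail_lower_bound {f φ u : ℝ → ℝ} {M M' x r ε p K R : ℝ} (hfm : Measurable f)
    (hφm : Measurable φ) (hum : Measurable u)
    (hf : ∀ y, |f y| ≤ M) (hφ : ∀ y, |φ y| ≤ M') (hu : ∀ y, |u y| ≤ M + 1) (hfu : ∀ y, f y ≤ u y)
    (hε : 0 < ε) (hεr : ε ≤ r) (hR : 2 * r ≤ R) (hK : 0 ≤ K) (hx : φ x = f x)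
    (h1 : ∀ z, |z| < r → φ (x + z) ≤ f x + p * z + K * z ^ 2)
    (h2 : ∀ z, r ≤ |z| → |z| < 2 * r → φ (x + z) ≤ f x + p * z + K * z ^ 2 + (u (x + z) - f (x + z)))
    (h3 : ∀ z, 2 * r ≤ |z| → |z| ≤ R → φ (x + z) ≤ u (x + z))
    (h4 : ∀ z, R < |z| → φ (x + z) ≤ M + 1) :
    tail f x (2 * r) - (∫ z in {z : ℝ | r ≤ |z|}, (u (x + z) - f (x + z)) / z ^ 2)
      - (2 * M + 1) * (2 / R) - K * (4 * r) ≤ tail φ x ε := by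
  have hr : 0 < r := hε.trans_le hεr
  have hM : 0 ≤ M := (abs_nonneg _).trans (hf 0)
  rw [tail_eq_regularised (p := p) (δ := 2 * r) hε hφm hφ (by linarith)]
  have hbs : MeasurableSet {z : ℝ | |z| < 2 * r} := measurableSet_lt measurable_norm measurable_const
  set g1 : ℝ → ℝ := fun z => (f x - f (x + z)) / z ^ 2
  set g2 : ℝ → ℝ := fun z => (u (x + z) - f (x + z)) / z ^ 2
  set g3 : ℝ → ℝ := fun z => (2 * M + 1) * (1 / z ^ 2)
  have i1 : IntegrableOn g1 {z | 2 * r ≤ |z|} := integrableOn_div_sq (C := 2 * M) (by linarith)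
    (by fun_prop) fun z _ => by
      have := hf x; have := hf (x + z); rw [abs_le] at *; constructor <;> linarith
  have i2 : IntegrableOn g2 {z | r ≤ |z|} := integrableOn_div_sq (C := 2 * M + 1) (by linarith)
    (by fun_prop) fun z _ => by
      have := hu (x + z); have := hf (x + z); rw [abs_le] at *; constructor <;> linarith
  have i3 : IntegrableOn g3 {z | R ≤ |z|} := (integrableOn_inv_sq (by linarith)).1.const_mul _
  have i1' : Integrable ({z : ℝ | 2 * r ≤ |z|}.indicator g1) := i1.integrable_indicator (measurableSet_le_abs _)
  have i2' : Integrable ({z : ℝ | r ≤ |z|}.indicator g2) := i2.integrable_indicator (measurableSet_le_abs _)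
  have i3' : Integrable ({z : ℝ | R ≤ |z|}.indicator g3) := i3.integrable_indicator (measurableSet_le_abs _)
  have hvol : volume {z : ℝ | |z| < 2 * r} = ENNReal.ofReal (4 * r) := by
    have : {z : ℝ | |z| < 2 * r} = Ioo (-(2 * r)) (2 * r) := by ext z; simp [abs_lt]
    rw [this, Real.volume_Ioo]; congr 1; ring
  have i4' : Integrable ({z : ℝ | |z| < 2 * r}.indicator fun _ => K) := by
    rw [integrable_indicator_iff hbs, integrableOn_const_iff]; right; rw [hvol]; exact ENNReal.ofReal_lt_top
  have iφ : IntegrableOn (fun z => (φ x - φ (x + z) + (if |z| < 2 * r then p * z else 0)) / z ^ 2)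
      {z | ε ≤ |z|} := by
    have hm : Measurable fun z : ℝ => if |z| < 2 * r then p * z else 0 :=
      Measurable.ite hbs (by fun_prop) (by fun_prop)
    refine integrableOn_div_sq (C := 2 * M' + |p| * (2 * r)) hε (by fun_prop) fun z _ => ?_
    have e1 := hφ x
    have e2 := hφ (x + z)
    have e3 : |(if |z| < 2 * r then p * z else 0)| ≤ |p| * (2 * r) := by
      split_ifs with h
      · rw [abs_mul]; gcongr
      · simp; positivity
    rw [abs_le] at *; constructor <;> linarith
  have key : ∫ z in {z : ℝ | ε ≤ |z|}, ({z : ℝ | 2 * r ≤ |z|}.indicator g1 z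
      - {z : ℝ | r ≤ |z|}.indicator g2 z - {z : ℝ | R ≤ |z|}.indicator g3 z
      - {z : ℝ | |z| < 2 * r}.indicator (fun _ => K) z) ≤
      ∫ z in {z : ℝ | ε ≤ |z|},
        (φ x - φ (x + z) + (if |z| < 2 * r then p * z else 0)) / z ^ 2 := by
    refine setIntegral_mono_on (((i1'.sub i2').sub i3').sub i4').integrableOn iφ
      (measurableSet_le_abs ε) fun z hz => ?_
    have hz0 : 0 < z ^ 2 := by
      rw [← sq_abs]; have : 0 < |z| := hε.trans_le hz
      positivity
    have hz00 : z ≠ 0 := by rintro rfl; simp at hz0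
    rw [le_div_iff₀ hz0]
    simp only [indicator, mem_ofPred_eq, g1, g2, g3, hx]
    have hfu' := hfu (x + z)
    rcases lt_or_ge |z| (2 * r) with hz2 | hz2
    · have n1 : ¬ 2 * r ≤ |z| := not_le.2 hz2
      have n3 : ¬ R ≤ |z| := by intro h; linarith
      simp only [if_neg n1, if_neg n3, if_pos hz2]
      rcases lt_or_ge |z| r with hz1 | hz1
      · rw [if_neg (not_le.2 hz1)]; have := h1 z hz1; linarith
      · rw [if_pos hz1]; have := h2 z hz1 hz2
        have e : (0 - (u (x + z) - f (x + z)) / z ^ 2 - 0 - K) * z ^ 2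
          = - (u (x + z) - f (x + z)) - K * z ^ 2 := by field_simp; ring
        rw [e]; linarith
    · have n1 : r ≤ |z| := by linarith
      simp only [if_pos hz2, if_pos n1, if_neg (not_lt.2 hz2)]
      rcases le_or_gt |z| R with hz3 | hz3
      · have := h3 z hz2 hz3
        have e : ∀ c, ((f x - f (x + z)) / z ^ 2 - (u (x + z) - f (x + z)) / z ^ 2 - c - 0) * z ^ 2
          = f x - u (x + z) - c * z ^ 2 := by intro c; field_simp; ring
        rw [e]
        have : 0 ≤ (if R ≤ |z| then (2 * M + 1) * (1 / z ^ 2) else 0) * z ^ 2 := by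
          split_ifs <;> positivity
        linarith
      · rw [if_pos hz3.le]
        have := h4 z hz3
        have e : ((f x - f (x + z)) / z ^ 2 - (u (x + z) - f (x + z)) / z ^ 2
            - (2 * M + 1) * (1 / z ^ 2) - 0) * z ^ 2
          = f x - u (x + z) - (2 * M + 1) := by field_simp; ring
        rw [e]
        have := (abs_le.1 (hf (x + z))).1
        linarith
  refine le_trans ?_ key
  have s1 : IntegrableOn (fun z => {z : ℝ | 2 * r ≤ |z|}.indicator g1 z
      - {z : ℝ | r ≤ |z|}.indicator g2 z) {z | ε ≤ |z|} := (i1'.sub i2').integrableOn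
  have s2 : IntegrableOn (fun z => {z : ℝ | 2 * r ≤ |z|}.indicator g1 z
      - {z : ℝ | r ≤ |z|}.indicator g2 z - {z : ℝ | R ≤ |z|}.indicator g3 z) {z | ε ≤ |z|} :=
    ((i1'.sub i2').sub i3').integrableOn
  rw [integral_sub s2 i4'.integrableOn, integral_sub s1 i3'.integrableOn,
    integral_sub i1'.integrableOn i2'.integrableOn,
    setIntegral_indicator_le_abs (by linarith), setIntegral_indicator_le_abs hεr,
    setIntegral_indicator_le_abs (by linarith)]
  have e3 : ∫ z in {z : ℝ | R ≤ |z|}, g3 z = (2 * M + 1) * (2 / R) := by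
    simp only [g3]; rw [integral_const_mul, (integrableOn_inv_sq (by linarith)).2]
  have e4 : ∫ z in {z : ℝ | ε ≤ |z|}, {z : ℝ | |z| < 2 * r}.indicator (fun _ => K) z
      ≤ K * (4 * r) := by
    refine (setIntegral_le_integral i4' (ae_of_all _ fun z =>
      indicator_nonneg (fun _ _ => hK) z)).trans ?_
    rw [integral_indicator hbs, setIntegral_const, measureReal_def, hvol,
      ENNReal.toReal_ofReal (by linarith), smul_eq_mul, mul_comm]
  rw [e3]
  unfold tail
  simp only [g1, g2] at *
  linarith

theorem exists_taylor_bound {f : ℝ → ℝ} (hf : ContDiff ℝ 2 f) (x : ℝ) :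
    ∃ K, 0 ≤ K ∧ ∀ z, |z| ≤ 1 → |f (x + z) - f x - deriv f x * z| ≤ K * z ^ 2 := by
  have h1 : ContDiff ℝ 1 (deriv f) := by
    have := (contDiff_succ_iff_deriv (n := 1) (f := f)).1 (by rw [one_add_one_eq_two]; exact hf)
    exact this.2.2
  have h0 : Continuous (deriv (deriv f)) := h1.continuous_deriv le_rfl
  obtain ⟨K, hK⟩ := (isCompact_closedBall x 1).exists_bound_of_continuousOn h0.continuousOn
  refine ⟨K, (norm_nonneg _).trans (hK x (by simp)), fun z hz => ?_⟩
  exact taylor_two_bound_of_le (fun y => hf.differentiable (by norm_num) y)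
    (fun y => h1.differentiable (by norm_num) y)
    (fun y hy => hK y (by simpa [Real.dist_eq] using hy)) hz

theorem IsSubsolution.locSub {F : ℝ → ℝ → ℝ} {M : ℝ} (h : IsSubsolution HTilde F)
    (hb : ∀ t x, 0 ≤ t → |F t x| ≤ M) : LocSub F := by
  intro t₀ x₀ Q a p ht₀ hQ hQ0 hFQ ha hp ε hε
  have hM : 0 ≤ M := (abs_nonneg _).trans (hb 0 0 le_rfl)
  have hf := h.1.slice ht₀.le
  set f := F t₀ with hfdef
  have hfb : ∀ y, |f y| ≤ M := fun y => hb t₀ y ht₀.le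
  have hQs : ContDiff ℝ 2 (fun x => Q (t₀, x)) := hQ.comp (contDiff_const.prodMk contDiff_id)
  obtain ⟨K, hK0, hK⟩ := exists_taylor_bound hQs x₀
  rw [hp.deriv] at hK
  obtain ⟨ρ, hρ, hball⟩ := Metric.eventually_nhds_iff.1 hFQ
  set P := max p 0 with hP
  have hP0 : 0 ≤ P := le_max_right _ _
  have hr0 : 0 < min (min ρ 1) (ε / (P * (6 + 4 * K) + 1)) := by positivity
  filter_upwards [self_mem_nhdsWithin, mem_nhdsWithin_of_mem_nhds (Iio_mem_nhds hr0)] with r' hr' hr'1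
  have hr'0 : 0 < r' := hr'
  have hr'1 : r' < min (min ρ 1) (ε / (P * (6 + 4 * K) + 1)) := hr'1
  obtain ⟨r, rfl⟩ : ∃ r, r' = 2 * r := ⟨r' / 2, by ring⟩
  have hr : 0 < r := by linarith
  have hr1 : 2 * r < ρ := hr'1.trans_le ((min_le_left _ _).trans (min_le_left _ _))
  have hr2 : 2 * r < 1 := hr'1.trans_le ((min_le_left _ _).trans (min_le_right _ _))
  have hr3 : 2 * r * (P * (6 + 4 * K) + 1) < ε := by
    have := hr'1.trans_le (min_le_right _ _)
    rwa [lt_div_iff₀ (by positivity)] at this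
  obtain ⟨u, hu1, hu2, hu3, hu4⟩ := exists_lsc_gt_integral_le x₀ hf hfb hr hr
  set Q₁ : ℝ × ℝ → ℝ := fun q => Q q + ((q.1 - t₀) ^ 2 + (q.2 - x₀) ^ 2) with hQ₁
  have hQ₁c : ContDiff ℝ 2 Q₁ := by
    refine hQ.add (ContDiff.add ?_ ?_)
    · exact (contDiff_fst.sub contDiff_const).pow 2
    · exact (contDiff_snd.sub contDiff_const).pow 2
  set R := max (2 * r) (2 * (2 * M + 1) / r) with hR
  have hR0 : 0 < R := lt_max_of_lt_left (by linarith)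
  have hRr : (2 * M + 1) * (2 / R) ≤ r := by
    have : 2 * (2 * M + 1) / r ≤ R := le_max_right _ _
    rw [div_le_iff₀ hr] at this
    rw [mul_div_assoc', div_le_iff₀ hR0]; linarith
  obtain ⟨φ, hφ1, hφ2, hφ3, hφ4, hφ5⟩ := exists_contDiff_touching (Q₁ := Q₁) (q₀ := (t₀, x₀))
    (R := R) h.1 hb hr (le_max_left _ _) hQ₁c (by
      intro q hq hne hd
      have h1 : F q.1 q.2 ≤ Q q := hball (hd.trans hr1)
      have h2 : 0 < (q.1 - t₀) ^ 2 + (q.2 - x₀) ^ 2 := by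
        rcases eq_or_ne q.1 t₀ with e | e
        · have : q.2 ≠ x₀ := fun e' => hne (Prod.ext e e')
          have : q.2 - x₀ ≠ 0 := sub_ne_zero.2 this
          positivity
        · have : q.1 - t₀ ≠ 0 := sub_ne_zero.2 e
          positivity
      simp only [hQ₁]; linarith) ht₀ hu1 hu2 hu3
  set ψ : ℝ → ℝ → ℝ := fun t x => φ (t, x) with hψ
  have hT : TestFun ψ := testFun_of_contDiff (c := M + 1) (x₀ := x₀) (R := R + 1) hφ1
    (fun t x hx => hφ5 (t, x) hx)
  have hφ0 : φ (t₀, x₀) = F t₀ x₀ := by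
    rw [hφ3 _ (by simpa using hr)]; simp [hQ₁, hQ0, hfdef]
  have hψx : ∀ z, |z| < r → ψ t₀ (x₀ + z) = Q₁ (t₀, x₀ + z) := fun z hz => by
    apply hφ3; simpa [Prod.dist_eq, hr] using hz
  have hQ₁b : ∀ z, |z| ≤ 1 → Q₁ (t₀, x₀ + z) ≤ f x₀ + p * z + (K + 1) * z ^ 2 := fun z hz => by
    have := (abs_le.1 (hK z hz)).2
    simp only [hQ0] at this
    simp only [hQ₁, add_sub_cancel_left, sub_self]
    nlinarith
  have hdp : deriv (ψ t₀) x₀ = p := by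
    have h1 : HasDerivAt (fun x => Q₁ (t₀, x)) p x₀ := by
      have e := ((hasDerivAt_id x₀).sub_const x₀).pow 2
      have := hp.add (e.const_add ((t₀ - t₀) ^ 2))
      simpa [hQ₁, Pi.add_def] using this
    have h2 : ψ t₀ =ᶠ[𝓝 x₀] fun x => Q₁ (t₀, x) := by
      filter_upwards [Metric.ball_mem_nhds x₀ hr] with x hx
      have := hψx (x - x₀) (by simpa [Real.dist_eq] using hx)
      simpa using this
    rw [h2.deriv_eq, h1.deriv]
  have hda : deriv (fun t => ψ t x₀) t₀ = a := by
    have h1 : HasDerivAt (fun t => Q₁ (t, x₀)) a t₀ := by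
      have e := ((hasDerivAt_id t₀).sub_const t₀).pow 2
      have := ha.add (e.add_const ((x₀ - x₀) ^ 2))
      simpa [hQ₁, Pi.add_def] using this
    have h2 : (fun t => ψ t x₀) =ᶠ[𝓝 t₀] fun t => Q₁ (t, x₀) := by
      filter_upwards [Metric.ball_mem_nhds t₀ hr] with t ht
      apply hφ3; simpa [Prod.dist_eq, hr, Real.dist_eq] using ht
    rw [h2.deriv_eq, h1.deriv]
  have hsub := h.2 ψ hT t₀ x₀ ht₀ (by
    intro t x ht hne
    have := hφ2 (t, x) ht hne
    simp only [hψ, hφ0]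
    simp only at this
    linarith)
  rw [hda, hdp] at hsub
  obtain ⟨M', hM'⟩ := (hT.2 t₀).1
  have hψm : Measurable (ψ t₀) :=
    (hφ1.continuous.comp (Continuous.prodMk_right t₀)).measurable
  have hlow : ∀ e, 0 < e → e ≤ r → tail f x₀ (2 * r) - (6 + 4 * K) * r ≤ tail (ψ t₀) x₀ e := by
    intro e he her
    have h4 : ∀ z, ψ t₀ (x₀ + z) ≤ if |z| < 2 * r then max (Q₁ (t₀, x₀ + z)) (u (x₀ + z)) else
        if |z| ≤ R then u (x₀ + z) else M + 1 := fun z => by simpa using hφ4 (x₀ + z)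
    have := tail_lower_bound (f := f) (φ := ψ t₀) (u := u) (M := M) (M' := M') (x := x₀) (r := r)
      (ε := e) (p := p) (K := K + 1) (R := R) hf.measurable hψm hu1.measurable hfb hM'
      (fun y => abs_le.2 ⟨by linarith [(abs_le.1 (hfb y)).1, hu2 y], hu3 y⟩)
      (fun y => (hu2 y).le) he her (le_max_left _ _) (by linarith) hφ0
      (fun z hz => by rw [hψx z hz]; exact hQ₁b z (by linarith))
      (fun z hz1 hz2 => by
        have h5 := h4 z
        rw [if_pos hz2] at h5
        have h6 := hQ₁b z (by linarith)
        have h7 := hu2 (x₀ + z)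
        rcases le_max_iff.1 h5 with h8 | h8
        · linarith
        · have h9 : f (x₀ + z) ≤ Q (t₀, x₀ + z) :=
            hball (y := (t₀, x₀ + z)) (by simpa [Prod.dist_eq, hρ] using hz2.trans hr1)
          have h10 : Q (t₀, x₀ + z) ≤ Q₁ (t₀, x₀ + z) := by
            simp only [hQ₁]; nlinarith [sq_nonneg z]
          linarith)
      (fun z hz1 hz2 => by
        have h5 := h4 z
        rwa [if_neg (not_lt.2 hz1), if_pos hz2] at h5)
      (fun z hz => by
        have h5 := h4 z
        rwa [if_neg (by have : 2 * r ≤ R := le_max_left _ _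
                        linarith), if_neg (not_le.2 hz)] at h5)
    linarith
  have hH : tail f x₀ (2 * r) - (6 + 4 * K) * r ≤ HTilde (ψ t₀) x₀ := by
    refine ge_of_tendsto (hT.tendsto_tail t₀ x₀) ?_
    filter_upwards [self_mem_nhdsWithin, mem_nhdsWithin_of_mem_nhds (Iio_mem_nhds hr)] with e he he'
    exact hlow e he (le_of_lt he')
  have := mul_le_mul_of_nonneg_left hH hP0
  nlinarith [mul_nonneg hP0 hK0]

theorem tail_comp_affine (f : ℝ → ℝ) {s : ℝ} (hs : 0 < s) (c x r : ℝ) :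
    tail f (x / s + c) r = s * tail (fun y => f (y / s + c)) x (s * r) := by
  unfold tail
  rw [← integral_indicator (measurableSet_le_abs r), ← integral_indicator (measurableSet_le_abs _)]
  have := Measure.integral_comp_div ({z : ℝ | r ≤ |z|}.indicator fun z =>
    (f (x / s + c) - f (x / s + c + z)) / z ^ 2) s
  rw [abs_of_pos hs, smul_eq_mul] at this
  rw [← mul_right_inj' hs.ne', ← this, ← mul_assoc, ← integral_const_mul]
  congr 1; ext z
  have h1 : r ≤ |z / s| ↔ s * r ≤ |z| := by
    rw [abs_div, abs_of_pos hs, le_div_iff₀ hs, mul_comm]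
  simp only [indicator, mem_ofPred_eq, h1]
  split_ifs
  · rw [show x / s + c + z / s = (x + z) / s + c by ring, div_pow, div_div_eq_mul_div]; ring
  · simp

theorem LocSub.comp_affine {F : ℝ → ℝ → ℝ} (hF : LocSub F) {t₁ s : ℝ} (ht₁ : 0 ≤ t₁) (hs : 0 < s)
    (c : ℝ) : LocSub (fun t x => F (t₁ + t / s ^ 2) (x / s + c)) := by
  intro t₀ x₀ Q a p ht₀ hQ hQ0 hFQ ha hp ε hε
  have hs2 : 0 < s ^ 2 := by positivity
  set Q' : ℝ × ℝ → ℝ := fun q => Q (s ^ 2 * (q.1 - t₁), s * (q.2 - c)) with hQ'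
  have e1 : s ^ 2 * (t₁ + t₀ / s ^ 2 - t₁) = t₀ := by field_simp; ring
  have e2 : s * (x₀ / s + c - c) = x₀ := by field_simp; ring
  have hcont : Continuous fun q : ℝ × ℝ => (s ^ 2 * (q.1 - t₁), s * (q.2 - c)) := by fun_prop
  have hQ'c : ContDiff ℝ 2 Q' := by
    refine hQ.comp (ContDiff.prodMk ?_ ?_)
    · exact contDiff_const.mul (contDiff_fst.sub contDiff_const)
    · exact contDiff_const.mul (contDiff_snd.sub contDiff_const)
  have key := hF (t₁ + t₀ / s ^ 2) (x₀ / s + c) Q' (s ^ 2 * a) (s * p) (by positivity) hQ'c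
    (by simp only [hQ', e1, e2, hQ0]) (by
      have h1 := hcont.tendsto (t₁ + t₀ / s ^ 2, x₀ / s + c)
      simp only [e1, e2] at h1
      filter_upwards [h1.eventually hFQ] with q hq
      convert hq using 2
      · field_simp; ring
      · field_simp; ring) (by
      have h2 : HasDerivAt (fun t => s ^ 2 * (t - t₁)) (s ^ 2) (t₁ + t₀ / s ^ 2) := by
        simpa using ((hasDerivAt_id (t₁ + t₀ / s ^ 2)).sub_const t₁).const_mul (s ^ 2)
      have h3 : HasDerivAt (fun t => Q (t, x₀)) a (s ^ 2 * (t₁ + t₀ / s ^ 2 - t₁)) := by rwa [e1]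
      have := HasDerivAt.comp (h₂ := fun t => Q (t, x₀)) (h := fun t => s ^ 2 * (t - t₁)) _ h3 h2
      simp only [hQ', e2]
      rw [mul_comm]; exact this) (by
      have h2 : HasDerivAt (fun x => s * (x - c)) s (x₀ / s + c) := by
        simpa using ((hasDerivAt_id (x₀ / s + c)).sub_const c).const_mul s
      have h3 : HasDerivAt (fun x => Q (t₀, x)) p (s * (x₀ / s + c - c)) := by rwa [e2]
      have := HasDerivAt.comp (h₂ := fun x => Q (t₀, x)) (h := fun x => s * (x - c)) _ h3 h2
      simp only [hQ', e1]
      rw [mul_comm]; exact this) (s ^ 2 * ε) (by positivity)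
  have ht : Tendsto (fun r => r / s) (𝓝[>] (0 : ℝ)) (𝓝[>] 0) := by
    refine tendsto_nhdsWithin_iff.2 ⟨?_, ?_⟩
    · have : Tendsto (fun r : ℝ => r / s) (𝓝 0) (𝓝 (0 / s)) := (continuous_id.div_const s).tendsto 0
      rw [zero_div] at this
      exact this.mono_left nhdsWithin_le_nhds
    · filter_upwards [self_mem_nhdsWithin] with r hr using div_pos hr hs
  filter_upwards [ht.eventually key] with r hr
  rw [tail_comp_affine _ hs, mul_div_cancel₀ _ hs.ne', show max (s * p) 0 = s * max p 0 by
    rw [mul_max_of_nonneg _ _ hs.le, mul_zero]] at hr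
  have : s ^ 2 * (a + max p 0 * tail (fun y => F (t₁ + t₀ / s ^ 2) (y / s + c)) x₀ r) ≤ s ^ 2 * ε := by
    linarith
  exact le_of_mul_le_mul_left this hs2

theorem tail_add_reflect {f g : ℝ → ℝ} {M x v r : ℝ} (hf : Measurable f) (hg : Measurable g)
    (hfb : ∀ y, |f y| ≤ M) (hgb : ∀ y, |g y| ≤ M) (hr : 0 < r) :
    tail (fun z => f (x + z) + g (v - z)) 0 r = tail f x r + tail g v r := by
  have h1 : tail g v r = ∫ z in {z : ℝ | r ≤ |z|}, (g v - g (v - z)) / z ^ 2 := by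
    unfold tail
    rw [← integral_indicator (measurableSet_le_abs r), ← integral_indicator (measurableSet_le_abs r),
      ← integral_neg_eq_self]
    congr 1; ext z
    simp [indicator, sub_eq_add_neg]
  rw [h1]; unfold tail
  rw [← integral_add]
  · congr 1; ext z; simp only [add_zero, sub_zero, zero_add]; ring
  · exact integrableOn_div_sq (C := 2 * M) hr (by fun_prop) fun z _ => by
      have := hfb x; have := hfb (x + z); rw [abs_le] at *; constructor <;> linarith
  · exact integrableOn_div_sq (C := 2 * M) hr (by fun_prop) fun z _ => by
      have := hgb v; have := hgb (v - z); rw [abs_le] at *; constructor <;> linarith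

/-- The nonnegative integrand obtained after adding a quadratic and a far-field correction. -/
theorem tail_eq_of_touching {f : ℝ → ℝ} {M x p c ρ r : ℝ} (hf : Measurable f)
    (hb : ∀ y, |f y| ≤ M) (hc : 0 ≤ c) (hr : 0 < r) (hrρ : r ≤ ρ)
    (hq : ∀ z, |z| ≤ ρ → f (x + z) ≤ f x + p * z + c * z ^ 2) :
    ∃ N : ℝ → ℝ, IntegrableOn N {z | r ≤ |z|} ∧ (∀ z, 0 ≤ N z) ∧
      (∀ z, |z| < ρ → N z = (f x - f (x + z) + p * z + c * z ^ 2) / z ^ 2) ∧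
      (∫ z in {z : ℝ | r ≤ |z|}, N z) - 2 * c * ρ - 4 * M / ρ ≤ tail f x r := by
  have hρ : 0 < ρ := hr.trans_le hrρ
  have hM : 0 ≤ M := (abs_nonneg _).trans (hb 0)
  have hbs : MeasurableSet {z : ℝ | |z| < ρ} := measurableSet_lt measurable_norm measurable_const
  have hm : Measurable fun z : ℝ => if |z| < ρ then p * z else 0 :=
    Measurable.ite hbs (by fun_prop) (by fun_prop)
  have hm2 : Measurable fun z : ℝ => if |z| < ρ then c * z ^ 2 else 2 * M :=
    Measurable.ite hbs (by fun_prop) (by fun_prop)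
  set N : ℝ → ℝ := fun z => (f x - f (x + z) + (if |z| < ρ then p * z else 0)
    + (if |z| < ρ then c * z ^ 2 else 2 * M)) / z ^ 2 with hN
  have i0 : IntegrableOn (fun z => (f x - f (x + z) + (if |z| < ρ then p * z else 0)) / z ^ 2)
      {z | r ≤ |z|} := by
    refine integrableOn_div_sq (C := 2 * M + |p| * ρ) hr (by fun_prop) fun z _ => ?_
    have e1 := hb x
    have e2 := hb (x + z)
    have e3 : |(if |z| < ρ then p * z else 0)| ≤ |p| * ρ := by
      split_ifs with h
      · rw [abs_mul]; gcongr
      · simp; positivity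
    rw [abs_le] at *; constructor <;> linarith
  have i1 : IntegrableOn (fun z => (if |z| < ρ then c * z ^ 2 else 2 * M) / z ^ 2) {z | r ≤ |z|} := by
    refine integrableOn_div_sq (C := 2 * M + c * ρ ^ 2) hr hm2 fun z _ => ?_
    split_ifs with h
    · rw [abs_of_nonneg (by positivity), ← sq_abs z]
      have : |z| ^ 2 ≤ ρ ^ 2 := by gcongr
      nlinarith
    · rw [abs_of_nonneg (by positivity)]; nlinarith [sq_nonneg ρ]
  have hNi : IntegrableOn N {z | r ≤ |z|} := by
    refine (i0.add i1).congr_fun (fun z _ => ?_) (measurableSet_le_abs r)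
    simp only [hN, Pi.add_apply]; rw [← add_div]
  have hvol : volume {z : ℝ | |z| < ρ} = ENNReal.ofReal (2 * ρ) := by
    have : {z : ℝ | |z| < ρ} = Ioo (-ρ) ρ := by ext z; simp [abs_lt]
    rw [this, Real.volume_Ioo]; congr 1; ring
  have j1 : Integrable ({z : ℝ | |z| < ρ}.indicator fun _ => c) := by
    rw [integrable_indicator_iff hbs, integrableOn_const_iff]; right; rw [hvol]; exact ENNReal.ofReal_lt_top
  have j2 : Integrable ({z : ℝ | ρ ≤ |z|}.indicator fun z => 2 * M * (1 / z ^ 2)) :=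
    IntegrableOn.integrable_indicator ((integrableOn_inv_sq hρ).1.const_mul _) (measurableSet_le_abs _)
  have hI1 : ∫ z in {z : ℝ | r ≤ |z|}, (if |z| < ρ then c * z ^ 2 else 2 * M) / z ^ 2
      ≤ 2 * c * ρ + 4 * M / ρ := by
    have e : ∀ z ∈ {z : ℝ | r ≤ |z|}, (if |z| < ρ then c * z ^ 2 else 2 * M) / z ^ 2
        = {z : ℝ | |z| < ρ}.indicator (fun _ => c) z
          + {z : ℝ | ρ ≤ |z|}.indicator (fun z => 2 * M * (1 / z ^ 2)) z := by
      intro z hz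
      have hz0 : z ≠ 0 := by rintro rfl; simp only [mem_ofPred_eq, abs_zero] at hz; linarith
      simp only [indicator, mem_ofPred_eq]
      split_ifs with h1 h2 h2
      · linarith
      · field_simp; ring
      · ring
      · exact absurd (not_lt.1 h1) h2
    rw [setIntegral_congr_fun (measurableSet_le_abs r) e,
      integral_add j1.integrableOn j2.integrableOn, setIntegral_indicator_le_abs hrρ,
      integral_const_mul, (integrableOn_inv_sq hρ).2]
    have : ∫ z in {z : ℝ | r ≤ |z|}, {z : ℝ | |z| < ρ}.indicator (fun _ => c) z ≤ 2 * ρ * c := by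
      refine (setIntegral_le_integral j1 (ae_of_all _ fun z =>
        indicator_nonneg (fun _ _ => hc) z)).trans ?_
      rw [integral_indicator hbs, setIntegral_const, measureReal_def, hvol,
        ENNReal.toReal_ofReal (by linarith), smul_eq_mul]
    have e2 : 2 * M * (2 / ρ) = 4 * M / ρ := by ring
    linarith
  refine ⟨N, hNi, fun z => ?_, fun z hz => by simp only [hN, if_pos hz], ?_⟩
  · simp only [hN]
    apply div_nonneg _ (sq_nonneg z)
    split_ifs with h
    · have := hq z h.le; linarith
    · have := (abs_le.1 (hb x)).1; have := (abs_le.1 (hb (x + z))).2; linarith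
  · rw [tail_eq_regularised (p := p) hr hf hb hρ]
    have := integral_add i0 i1
    simp only [← add_div] at this
    linarith

theorem tail_ge_of_touching {f : ℝ → ℝ} {M x p c ρ r : ℝ} (hf : Measurable f)
    (hb : ∀ y, |f y| ≤ M) (hc : 0 ≤ c) (hr : 0 < r) (hrρ : r ≤ ρ)
    (hq : ∀ z, |z| ≤ ρ → f (x + z) ≤ f x + p * z + c * z ^ 2) :
    - (2 * c * ρ + 4 * M / ρ) ≤ tail f x r := by
  obtain ⟨N, _, hN0, _, hN⟩ := tail_eq_of_touching hf hb hc hr hrρ hq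
  have : 0 ≤ ∫ z in {z : ℝ | r ≤ |z|}, N z := integral_nonneg hN0
  linarith

theorem tail_ge_of_touching_of_gain {f : ℝ → ℝ} {M x p c ρ r L : ℝ} (hf : Measurable f)
    (hb : ∀ y, |f y| ≤ M) (hc : 0 ≤ c) (hr : 0 < r) (hrL : r ≤ L) (hL : L < ρ)
    (hq : ∀ z, |z| ≤ ρ → f (x + z) ≤ f x + p * z + c * z ^ 2) :
    ((∫ z in Ioc 0 L, (f x - f (x + z))) - |p| * L ^ 2 - (2 * M + |p| * L + c * L ^ 2) * r) / L ^ 2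
      - (2 * c * ρ + 4 * M / ρ) ≤ tail f x r := by
  obtain ⟨N, hNi, hN0, hNe, hN⟩ := tail_eq_of_touching hf hb hc hr (hrL.trans hL.le) hq
  have hL0 : 0 < L := hr.trans_le hrL
  have hsub : Ioc r L ⊆ {z : ℝ | r ≤ |z|} := fun z hz => hz.1.le.trans (le_abs_self z)
  have h1 : ∫ z in Ioc r L, N z ≤ ∫ z in {z : ℝ | r ≤ |z|}, N z :=
    setIntegral_mono_set hNi (ae_of_all _ hN0) hsub.eventuallyLE
  set w : ℝ → ℝ := fun z => f x - f (x + z) + p * z + c * z ^ 2 with hw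
  have hfi : IntegrableOn (fun z => f x - f (x + z)) (Ioc 0 L) := by
    refine Integrable.mono' (g := fun _ => 2 * M)
      (continuousOn_const.integrableOn_Icc.mono_set Ioc_subset_Icc_self) (by
      have : Measurable fun z => f x - f (x + z) := by fun_prop
      exact this.aestronglyMeasurable) (ae_of_all _ fun z => ?_)
    have e1 := hb x; have e2 := hb (x + z)
    rw [Real.norm_eq_abs]; rw [abs_le] at *; constructor <;> linarith
  have hpi : IntegrableOn (fun z : ℝ => p * z) (Ioc 0 L) :=
    (Continuous.integrableOn_Icc (by fun_prop)).mono_set Ioc_subset_Icc_self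
  have hci : IntegrableOn (fun z : ℝ => c * z ^ 2) (Ioc 0 L) :=
    (Continuous.integrableOn_Icc (by fun_prop)).mono_set Ioc_subset_Icc_self
  have hwi : IntegrableOn w (Ioc 0 L) := (hfi.add hpi).add hci
  have hsplit : ∫ z in Ioc 0 L, w z = (∫ z in Ioc 0 r, w z) + ∫ z in Ioc r L, w z := by
    rw [← setIntegral_union (by rw [Set.disjoint_left]; intro z h1 h2; exact h1.2.not_gt h2.1)
      measurableSet_Ioc (hwi.mono_set (Ioc_subset_Ioc_right hrL))
      (hwi.mono_set (Ioc_subset_Ioc_left hr.le)), Ioc_union_Ioc_eq_Ioc hr.le hrL]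
  have h2 : (∫ z in Ioc r L, w z) / L ^ 2 ≤ ∫ z in Ioc r L, N z := by
    rw [← integral_div]
    refine setIntegral_mono_on ((hwi.mono_set (Ioc_subset_Ioc_left hr.le)).div_const _)
      (hNi.mono_set hsub) measurableSet_Ioc fun z hz => ?_
    have hz0 : 0 < z := hr.trans hz.1
    have hzρ : |z| < ρ := by rw [abs_of_pos hz0]; exact hz.2.trans_lt hL
    rw [hNe z hzρ]
    have : 0 ≤ w z := by have := hq z hzρ.le; simp only [hw]; linarith
    apply div_le_div_of_nonneg_left this (by positivity)
    exact pow_le_pow_left₀ hz0.le hz.2 2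
  have h3 : ∫ z in Ioc 0 r, w z ≤ (2 * M + |p| * L + c * L ^ 2) * r := by
    have : ∫ z in Ioc 0 r, w z ≤ ∫ z in Ioc 0 r, (2 * M + |p| * L + c * L ^ 2) := by
      refine setIntegral_mono_on (hwi.mono_set (Ioc_subset_Ioc_right hrL))
        (continuousOn_const.integrableOn_Icc.mono_set Ioc_subset_Icc_self)
        measurableSet_Ioc fun z hz => ?_
      have e1 := (abs_le.1 (hb x)).2
      have e2 := (abs_le.1 (hb (x + z))).1
      have hzL : z ≤ L := hz.2.trans hrL
      have e3 : p * z ≤ |p| * L := by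
        calc p * z ≤ |p| * z := by have := le_abs_self p; nlinarith [hz.1]
          _ ≤ _ := by gcongr
      have e4 : c * z ^ 2 ≤ c * L ^ 2 := by have := hz.1; gcongr
      simp only [hw]; linarith
    rw [setIntegral_const, measureReal_def, Real.volume_Ioc, sub_zero,
      ENNReal.toReal_ofReal hr.le, smul_eq_mul] at this
    linarith
  have h4 : (∫ z in Ioc 0 L, (f x - f (x + z))) - |p| * L ^ 2 ≤ ∫ z in Ioc 0 L, w z := by
    have : ∫ z in Ioc 0 L, (f x - f (x + z) - |p| * L) ≤ ∫ z in Ioc 0 L, w z := by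
      refine setIntegral_mono_on (hfi.sub
        (continuousOn_const.integrableOn_Icc.mono_set Ioc_subset_Icc_self)) hwi measurableSet_Ioc fun z hz => ?_
      have e3 : - (|p| * L) ≤ p * z := by
        have h5 : |p * z| ≤ |p| * L := by
          rw [abs_mul, abs_of_pos hz.1]; gcongr; exact hz.2
        exact (abs_le.1 h5).1
      have : 0 ≤ c * z ^ 2 := by positivity
      simp only [hw]; linarith
    rw [integral_sub hfi
      (continuousOn_const.integrableOn_Icc.mono_set Ioc_subset_Icc_self), setIntegral_const, measureReal_def, Real.volume_Ioc, sub_zero,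
      ENNReal.toReal_ofReal hL0.le, smul_eq_mul] at this
    nlinarith
  have h5 : ((∫ z in Ioc 0 L, (f x - f (x + z))) - |p| * L ^ 2 - (2 * M + |p| * L + c * L ^ 2) * r)
      / L ^ 2 ≤ (∫ z in Ioc r L, w z) / L ^ 2 := by
    gcongr; linarith
  linarith

/-- The primitive of the smooth step function. -/
noncomputable def ramp (u : ℝ) : ℝ := ∫ x in (0 : ℝ)..u, Real.smoothTransition x

theorem hasDerivAt_ramp (u : ℝ) : HasDerivAt ramp (Real.smoothTransition u) u := by
  have hc : Continuous Real.smoothTransition := Real.smoothTransition.continuous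
  exact intervalIntegral.integral_hasDerivAt_right (hc.intervalIntegrable _ _)
    hc.stronglyMeasurable.stronglyMeasurableAtFilter hc.continuousAt

theorem deriv_ramp : deriv ramp = Real.smoothTransition := funext fun u => (hasDerivAt_ramp u).deriv

theorem contDiff_ramp : ContDiff ℝ 2 ramp := by
  rw [show (2 : WithTop ℕ∞) = 1 + 1 by norm_num, contDiff_succ_iff_deriv]
  refine ⟨fun u => (hasDerivAt_ramp u).differentiableAt, by simp, ?_⟩
  rw [deriv_ramp]; exact Real.smoothTransition.contDiff

theorem ramp_of_nonpos {u : ℝ} (hu : u ≤ 0) : ramp u = 0 := by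
  unfold ramp
  rw [intervalIntegral.integral_congr (g := fun _ => 0)]
  · simp
  · intro x hx
    rw [uIcc_of_ge hu] at hx
    exact Real.smoothTransition.zero_of_nonpos hx.2

theorem ramp_monotone : Monotone ramp :=
  monotone_of_deriv_nonneg (fun u => (hasDerivAt_ramp u).differentiableAt) fun u => by
    rw [deriv_ramp]; exact Real.smoothTransition.nonneg u

theorem ramp_nonneg (u : ℝ) : 0 ≤ ramp u := by
  rcases le_total u 0 with h | h
  · rw [ramp_of_nonpos h]
  · rw [← ramp_of_nonpos le_rfl]; exact ramp_monotone h

theorem id_sub_ramp_monotone : Monotone fun u => u - ramp u := by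
  refine monotone_of_deriv_nonneg (differentiable_id.sub fun u =>
    (hasDerivAt_ramp u).differentiableAt) fun u => ?_
  have : HasDerivAt (fun u => u - ramp u) (1 - Real.smoothTransition u) u :=
    (hasDerivAt_id u).sub (hasDerivAt_ramp u)
  rw [this.deriv]; linarith [Real.smoothTransition.le_one u]

theorem ramp_of_one_le {u : ℝ} (hu : 1 ≤ u) : ramp u = ramp 1 + (u - 1) := by
  have hc : Continuous Real.smoothTransition := Real.smoothTransition.continuous
  have : ∫ x in (1 : ℝ)..u, Real.smoothTransition x = u - 1 := by
    rw [intervalIntegral.integral_congr (g := fun _ => 1)]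
    · simp
    · intro x hx
      rw [uIcc_of_le hu] at hx
      exact Real.smoothTransition.one_of_one_le hx.1
  unfold ramp
  rw [← this, intervalIntegral.integral_add_adjacent_intervals (hc.intervalIntegrable _ _)
    (hc.intervalIntegrable _ _)]

theorem ramp_one_le : ramp 1 ≤ 1 := by
  have := id_sub_ramp_monotone (zero_le_one (α := ℝ))
  simp only [ramp_of_nonpos le_rfl] at this; linarith

theorem deriv_smoothTransition_of_notMem {u : ℝ} (hu : u ∉ Icc (0 : ℝ) 1) :
    deriv Real.smoothTransition u = 0 := by
  simp only [mem_Icc, not_and_or, not_le] at hu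
  rcases hu with h | h
  · have : Real.smoothTransition =ᶠ[𝓝 u] fun _ => 0 := by
      filter_upwards [Iio_mem_nhds h] with x hx using Real.smoothTransition.zero_of_nonpos hx.le
    rw [this.deriv_eq]; simp
  · have : Real.smoothTransition =ᶠ[𝓝 u] fun _ => 1 := by
      filter_upwards [Ioi_mem_nhds h] with x hx using
        Real.smoothTransition.one_of_one_le (le_of_lt hx)
    rw [this.deriv_eq]; simp

theorem deriv_deriv_smoothTransition_of_notMem {u : ℝ} (hu : u ∉ Icc (0 : ℝ) 1) :
    deriv (deriv Real.smoothTransition) u = 0 := by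
  have : deriv Real.smoothTransition =ᶠ[𝓝 u] fun _ => 0 := by
    filter_upwards [isClosed_Icc.isOpen_compl.mem_nhds hu] with x hx using
      deriv_smoothTransition_of_notMem hx
  rw [this.deriv_eq]; simp

theorem contDiff_deriv_smoothTransition : ContDiff ℝ 1 (deriv Real.smoothTransition) := by
  have h : ContDiff ℝ (1 + 1) Real.smoothTransition := Real.smoothTransition.contDiff
  exact (contDiff_succ_iff_deriv.1 h).2.2

theorem exists_smoothTransition_bound : ∃ C : ℝ, 1 ≤ C ∧ ∀ u,
    |deriv Real.smoothTransition u| ≤ C ∧ |deriv (deriv Real.smoothTransition) u| ≤ C := by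
  have h1 := contDiff_deriv_smoothTransition
  have c1 : Continuous (deriv Real.smoothTransition) := h1.continuous
  have c2 : Continuous (deriv (deriv Real.smoothTransition)) := h1.continuous_deriv le_rfl
  obtain ⟨C1, hC1⟩ := isCompact_Icc.exists_bound_of_continuousOn (s := Icc (0 : ℝ) 1) c1.continuousOn
  obtain ⟨C2, hC2⟩ := isCompact_Icc.exists_bound_of_continuousOn (s := Icc (0 : ℝ) 1) c2.continuousOn
  refine ⟨max 1 (max C1 C2), le_max_left _ _, fun u => ?_⟩
  by_cases hu : u ∈ Icc (0 : ℝ) 1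
  · exact ⟨(hC1 u hu).trans ((le_max_left _ _).trans (le_max_right _ _)),
      (hC2 u hu).trans ((le_max_right _ _).trans (le_max_right _ _))⟩
  · rw [deriv_smoothTransition_of_notMem hu, deriv_deriv_smoothTransition_of_notMem hu, abs_zero]
    have : (0 : ℝ) ≤ max 1 (max C1 C2) := zero_le_one.trans (le_max_left _ _)
    exact ⟨this, this⟩

/-- A smooth nondecreasing map above the identity, equal to it outside `(0, 1)` and constant on
`[1/8, 3/4]`. -/
noncomputable def plateau (u : ℝ) : ℝ :=
  u + Real.smoothTransition (8 * u) *
    (3 / 4 + (1 / 4) * (ramp (4 * u - 3) + 1 - ramp 1) - u)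

theorem contDiff_plateau : ContDiff ℝ 2 plateau := by
  have h1 : ContDiff ℝ 2 fun u : ℝ => Real.smoothTransition (8 * u) :=
    Real.smoothTransition.contDiff.comp (contDiff_const.mul contDiff_id)
  have h2 : ContDiff ℝ 2 fun u : ℝ => ramp (4 * u - 3) :=
    contDiff_ramp.comp ((contDiff_const.mul contDiff_id).sub contDiff_const)
  exact contDiff_id.add (h1.mul ((contDiff_const.add
    (contDiff_const.mul ((h2.add contDiff_const).sub contDiff_const))).sub contDiff_id))

theorem plateau_aux (u : ℝ) : u ≤ 3 / 4 + (1 / 4) * (ramp (4 * u - 3) + 1 - ramp 1) := by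
  rcases le_total (4 * u - 3) 1 with h | h
  · have := id_sub_ramp_monotone h
    simp only at this; linarith
  · rw [ramp_of_one_le h]; linarith

theorem le_plateau (u : ℝ) : u ≤ plateau u := by
  unfold plateau
  nlinarith [plateau_aux u, Real.smoothTransition.nonneg (8 * u)]

theorem plateau_of_nonpos {u : ℝ} (hu : u ≤ 0) : plateau u = u := by
  unfold plateau; rw [Real.smoothTransition.zero_of_nonpos (by linarith)]; ring

theorem plateau_of_one_le {u : ℝ} (hu : 1 ≤ u) : plateau u = u := by
  unfold plateau; rw [ramp_of_one_le (by linarith : 1 ≤ 4 * u - 3)]; ring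

theorem plateau_eq_const {u : ℝ} (h1 : 1 / 8 ≤ u) (h2 : u ≤ 3 / 4) :
    plateau u = 3 / 4 + (1 / 4) * (1 - ramp 1) := by
  unfold plateau
  rw [Real.smoothTransition.one_of_one_le (by linarith), ramp_of_nonpos (by linarith)]; ring

theorem plateau_monotone : Monotone plateau := by
  have h1 : MonotoneOn plateau (Iic (3 / 4)) := by
    intro u hu v hv huv
    rw [mem_Iic] at hu hv
    unfold plateau
    rw [ramp_of_nonpos (by linarith : 4 * u - 3 ≤ 0), ramp_of_nonpos (by linarith : 4 * v - 3 ≤ 0)]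
    have e1 := Real.smoothTransition.monotone (by linarith : 8 * u ≤ 8 * v)
    have e2 := Real.smoothTransition.nonneg (8 * u)
    have e3 := Real.smoothTransition.le_one (8 * v)
    have e4 := ramp_one_le
    nlinarith [mul_nonneg (sub_nonneg.2 e1) (by linarith :
      0 ≤ 3 / 4 + 1 / 4 * (0 + 1 - ramp 1) - u), mul_nonneg (sub_nonneg.2 huv) (sub_nonneg.2 e3)]
  have h2 : MonotoneOn plateau (Ici (3 / 4)) := by
    intro u hu v hv huv
    rw [mem_Ici] at hu hv
    unfold plateau
    rw [Real.smoothTransition.one_of_one_le (by linarith),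
      Real.smoothTransition.one_of_one_le (by linarith)]
    have := ramp_monotone (by linarith : 4 * u - 3 ≤ 4 * v - 3)
    linarith
  exact h1.Iic_union_Ici h2

/-- Points pushed to the right inside the intervals `(j i, j i + κ)`, `i < m`. -/
noncomputable def pushRight (j : ℕ → ℝ) (κ : ℝ) (m : ℕ) (x : ℝ) : ℝ :=
  x + ∑ i ∈ Finset.range m, κ * (plateau ((x - j i) / κ) - (x - j i) / κ)

/-- A staircase climbing by `θ` inside each interval `[j i + κ / 4, j i + κ / 2]`, `i < m`. -/
noncomputable def staircase (j : ℕ → ℝ) (κ θ : ℝ) (m : ℕ) (x : ℝ) : ℝ :=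
  ∑ i ∈ Finset.range m, θ * Real.smoothTransition (4 * ((x - j i) / κ) - 1)

/-- The intervals `[j i, j i + κ]`, `i < m`, are pairwise disjoint. -/
def Separated (j : ℕ → ℝ) (κ : ℝ) (m : ℕ) : Prop :=
  ∀ i < m, ∀ k < m, i ≠ k → κ < |j i - j k|

section

variable {j : ℕ → ℝ} {κ θ : ℝ} {m : ℕ}

theorem Separated.eq (h : Separated j κ m) {i k : ℕ} (hi : i < m) (hk : k < m) {x : ℝ}
    (hxi : x ∈ Icc (j i) (j i + κ)) (hxk : x ∈ Icc (j k) (j k + κ)) : i = k := by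
  by_contra hne
  have h1 := h i hi k hk hne
  have h2 : |j i - j k| ≤ κ := abs_le.2 ⟨by linarith [hxi.2, hxk.1], by linarith [hxi.1, hxk.2]⟩
  linarith

theorem contDiff_pushRight : ContDiff ℝ 2 (pushRight j κ m) := by
  unfold pushRight
  refine contDiff_id.add (ContDiff.sum fun i _ => contDiff_const.mul ?_)
  have h : ContDiff ℝ 2 fun x : ℝ => (x - j i) / κ := (contDiff_id.sub contDiff_const).div_const _
  exact (contDiff_plateau.comp h).sub h

theorem pushRight_cases (hκ : 0 < κ) (h : Separated j κ m) (x : ℝ) :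
    (pushRight j κ m x = x ∧ ∀ i < m, x ∉ Ioo (j i) (j i + κ)) ∨
    ∃ i < m, x ∈ Ioo (j i) (j i + κ) ∧
      pushRight j κ m x = j i + κ * plateau ((x - j i) / κ) := by
  have h0 : ∀ i, x ∉ Ioo (j i) (j i + κ) →
      κ * (plateau ((x - j i) / κ) - (x - j i) / κ) = 0 := by
    intro i hi
    simp only [mem_Ioo, not_and_or, not_lt] at hi
    rcases hi with hi | hi
    · rw [plateau_of_nonpos (div_nonpos_of_nonpos_of_nonneg (by linarith) hκ.le)]; ring
    · rw [plateau_of_one_le (by rw [le_div_iff₀ hκ]; linarith)]; ring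
  by_cases hx : ∃ i < m, x ∈ Ioo (j i) (j i + κ)
  · obtain ⟨i, hi, hxi⟩ := hx
    refine Or.inr ⟨i, hi, hxi, ?_⟩
    unfold pushRight
    rw [Finset.sum_eq_single i]
    · field_simp; ring
    · intro k hk hki
      refine h0 k fun hxk => hki ?_
      exact h.eq (Finset.mem_range.1 hk) hi (Ioo_subset_Icc_self hxk) (Ioo_subset_Icc_self hxi)
    · intro hn; exact absurd (Finset.mem_range.2 hi) hn
  · push Not at hx
    refine Or.inl ⟨?_, hx⟩
    unfold pushRight
    rw [Finset.sum_eq_zero fun i hi => h0 i (hx i (Finset.mem_range.1 hi)), add_zero]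

theorem plateau_scaled_le (hκ : 0 < κ) {a x : ℝ} (hx : x ∈ Ioo a (a + κ)) :
    x ≤ a + κ * plateau ((x - a) / κ) ∧ a + κ * plateau ((x - a) / κ) ≤ a + κ := by
  constructor
  · have := mul_le_mul_of_nonneg_left (le_plateau ((x - a) / κ)) hκ.le
    rw [mul_div_cancel₀ _ hκ.ne'] at this; linarith
  · have h1 : (x - a) / κ ≤ 1 := by rw [div_le_one hκ]; linarith [hx.2]
    have := plateau_monotone h1
    rw [plateau_of_one_le le_rfl] at this
    nlinarith

theorem le_pushRight (hκ : 0 < κ) (h : Separated j κ m) (x : ℝ) : x ≤ pushRight j κ m x := by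
  rcases pushRight_cases hκ h x with ⟨h1, _⟩ | ⟨i, _, hx, h1⟩
  · rw [h1]
  · rw [h1]; exact (plateau_scaled_le hκ hx).1

theorem pushRight_le (hκ : 0 < κ) (h : Separated j κ m) (x : ℝ) : pushRight j κ m x ≤ x + κ := by
  rcases pushRight_cases hκ h x with ⟨h1, _⟩ | ⟨i, _, hx, h1⟩
  · rw [h1]; linarith
  · rw [h1]; have := (plateau_scaled_le hκ hx).2; linarith [hx.1]

theorem pushRight_monotone (hκ : 0 < κ) (h : Separated j κ m) : Monotone (pushRight j κ m) := by
  intro x y hxy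
  rcases pushRight_cases hκ h x with ⟨h1, _⟩ | ⟨i, hi, hx, h1⟩
  · rw [h1]; exact hxy.trans (le_pushRight hκ h y)
  · rw [h1]
    by_cases hy : y < j i + κ
    · have hyi : y ∈ Ioo (j i) (j i + κ) := ⟨hx.1.trans_le hxy, hy⟩
      rcases pushRight_cases hκ h y with ⟨h2, h3⟩ | ⟨k, hk, hyk, h2⟩
      · exact absurd hyi (h3 i hi)
      · obtain rfl := h.eq hk hi (Ioo_subset_Icc_self hyk) (Ioo_subset_Icc_self hyi)
        rw [h2]
        have : (x - j k) / κ ≤ (y - j k) / κ := by gcongr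
        have := plateau_monotone this
        gcongr
    · exact ((plateau_scaled_le hκ hx).2.trans (not_lt.1 hy)).trans (le_pushRight hκ h y)

theorem sum_le_of_separated (h : Separated j κ m) {x A : ℝ} (hA : 0 ≤ A) {a : ℕ → ℝ}
    (h0 : ∀ i < m, x ∉ Icc (j i) (j i + κ) → a i = 0) (hb : ∀ i < m, |a i| ≤ A) :
    |∑ i ∈ Finset.range m, a i| ≤ A := by
  by_cases hx : ∃ i < m, x ∈ Icc (j i) (j i + κ)
  · obtain ⟨i, hi, hxi⟩ := hx
    rw [Finset.sum_eq_single i]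
    · exact hb i hi
    · intro k hk hki
      exact h0 k (Finset.mem_range.1 hk) fun hxk => hki (h.eq (Finset.mem_range.1 hk) hi hxk hxi)
    · intro hn; exact absurd (Finset.mem_range.2 hi) hn
  · push Not at hx
    rw [Finset.sum_eq_zero fun i hi => h0 i (Finset.mem_range.1 hi) (hx i (Finset.mem_range.1 hi)),
      abs_zero]
    exact hA

theorem contDiff_staircase : ContDiff ℝ 2 (staircase j κ θ m) := by
  unfold staircase
  refine ContDiff.sum fun i _ => contDiff_const.mul (Real.smoothTransition.contDiff.comp ?_)
  exact (contDiff_const.mul ((contDiff_id.sub contDiff_const).div_const _)).sub contDiff_const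

theorem hasDerivAt_staircase_arg (κ a x : ℝ) :
    HasDerivAt (fun x => 4 * ((x - a) / κ) - 1) (4 / κ) x := by
  have := ((((hasDerivAt_id x).sub_const a).div_const κ).const_mul 4).sub_const 1
  exact this.congr_deriv (by ring)

theorem deriv_staircase : deriv (staircase j κ θ m) = fun x => ∑ i ∈ Finset.range m,
    θ * (4 / κ) * deriv Real.smoothTransition (4 * ((x - j i) / κ) - 1) := by
  funext x
  refine HasDerivAt.deriv ?_
  unfold staircase
  refine HasDerivAt.fun_sum fun i _ => ?_
  have h1 : HasDerivAt Real.smoothTransition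
      (deriv Real.smoothTransition (4 * ((x - j i) / κ) - 1)) (4 * ((x - j i) / κ) - 1) :=
    ((Real.smoothTransition.contDiff (n := 1)).differentiable (by norm_num) _).hasDerivAt
  have := (HasDerivAt.comp (h := fun x => 4 * ((x - j i) / κ) - 1) x h1
    (hasDerivAt_staircase_arg κ (j i) x)).const_mul θ
  exact this.congr_deriv (by ring)

theorem deriv_deriv_staircase : deriv (deriv (staircase j κ θ m)) = fun x =>
    ∑ i ∈ Finset.range m, θ * (4 / κ) ^ 2 *
      deriv (deriv Real.smoothTransition) (4 * ((x - j i) / κ) - 1) := by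
  rw [deriv_staircase]
  funext x
  refine HasDerivAt.deriv ?_
  refine HasDerivAt.fun_sum fun i _ => ?_
  have h1 : HasDerivAt (deriv Real.smoothTransition)
      (deriv (deriv Real.smoothTransition) (4 * ((x - j i) / κ) - 1)) (4 * ((x - j i) / κ) - 1) :=
    (contDiff_deriv_smoothTransition.differentiable (by norm_num) _).hasDerivAt
  have := (HasDerivAt.comp (h := fun x => 4 * ((x - j i) / κ) - 1) x h1
    (hasDerivAt_staircase_arg κ (j i) x)).const_mul (θ * (4 / κ))
  exact this.congr_deriv (by ring)

theorem staircase_arg_notMem (hκ : 0 < κ) {a x : ℝ} (hx : x ∉ Icc (a + κ / 4) (a + κ / 2)) :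
    4 * ((x - a) / κ) - 1 ∉ Icc (0 : ℝ) 1 := by
  intro h
  have h1 : 1 / 4 ≤ (x - a) / κ := by linarith [h.1]
  have h2 : (x - a) / κ ≤ 1 / 2 := by linarith [h.2]
  rw [le_div_iff₀ hκ] at h1
  rw [div_le_iff₀ hκ] at h2
  exact hx ⟨by linarith, by linarith⟩

theorem abs_deriv_staircase_le (hκ : 0 < κ) (hθ : 0 ≤ θ) (h : Separated j κ m) {C : ℝ} (hC0 : 0 ≤ C)
    (hC : ∀ u, |deriv Real.smoothTransition u| ≤ C) (x : ℝ) :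
    |deriv (staircase j κ θ m) x| ≤ θ * (4 / κ) * C := by
  rw [deriv_staircase]
  refine sum_le_of_separated h (x := x) (by positivity) (fun i _ hx => ?_) fun i _ => ?_
  · rw [deriv_smoothTransition_of_notMem (staircase_arg_notMem hκ fun hx' => hx
      ⟨by linarith [hx'.1], by linarith [hx'.2]⟩), mul_zero]
  · rw [abs_mul, abs_of_nonneg (by positivity : 0 ≤ θ * (4 / κ))]
    exact mul_le_mul_of_nonneg_left (hC _) (by positivity)

theorem staircase_add_le (hκ : 0 < κ) (hθ : 0 ≤ θ) (h : Separated j κ m) {C : ℝ} (hC0 : 0 ≤ C)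
    (hC : ∀ u, |deriv (deriv Real.smoothTransition) u| ≤ C) (x z : ℝ) :
    staircase j κ θ m (x + z) ≤ staircase j κ θ m x + deriv (staircase j κ θ m) x * z
      + θ * (4 / κ) ^ 2 * C * z ^ 2 := by
  have hc : ContDiff ℝ (1 + 1) (staircase j κ θ m) := by
    rw [show (1 + 1 : WithTop ℕ∞) = 2 by norm_num]; exact contDiff_staircase
  have hc' := (contDiff_succ_iff_deriv.1 hc).2.2
  have := taylor_two_bound_of_le (x := x) (z := z) (ρ := |z|) (C := θ * (4 / κ) ^ 2 * C)
    (fun y => hc.differentiable (by norm_num) y) (fun y => hc'.differentiable (by norm_num) y)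
    (fun y _ => by
      rw [deriv_deriv_staircase]
      refine sum_le_of_separated h (x := y) (by positivity) (fun i _ hx => ?_) fun i _ => ?_
      · rw [deriv_deriv_smoothTransition_of_notMem (staircase_arg_notMem hκ fun hx' => hx
          ⟨by linarith [hx'.1], by linarith [hx'.2]⟩), mul_zero]
      · rw [abs_mul, abs_of_nonneg (by positivity : 0 ≤ θ * (4 / κ) ^ 2)]
        exact mul_le_mul_of_nonneg_left (hC _) (by positivity)) le_rfl
  linarith [(abs_le.1 this).2]

theorem staircase_monotone (hκ : 0 < κ) (hθ : 0 ≤ θ) : Monotone (staircase j κ θ m) := by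
  intro x y hxy
  unfold staircase
  refine Finset.sum_le_sum fun i _ => mul_le_mul_of_nonneg_left
    (Real.smoothTransition.monotone ?_) hθ
  gcongr

theorem staircase_eq_zero (hκ : 0 < κ) {x : ℝ} (hx : ∀ i < m, x ≤ j i) :
    staircase j κ θ m x = 0 := by
  unfold staircase
  refine Finset.sum_eq_zero fun i hi => ?_
  have : (x - j i) / κ ≤ 0 :=
    div_nonpos_of_nonpos_of_nonneg (by linarith [hx i (Finset.mem_range.1 hi)]) hκ.le
  rw [Real.smoothTransition.zero_of_nonpos (by linarith), mul_zero]

theorem staircase_eq (hκ : 0 < κ) {x : ℝ} (hx : ∀ i < m, j i + κ ≤ x) :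
    staircase j κ θ m x = m * θ := by
  unfold staircase
  rw [Finset.sum_congr rfl (g := fun _ => θ)]
  · simp
  · intro i hi
    have : 1 ≤ (x - j i) / κ := by
      rw [le_div_iff₀ hκ]; linarith [hx i (Finset.mem_range.1 hi)]
    rw [Real.smoothTransition.one_of_one_le (by linarith), mul_one]

theorem pushRight_le_of_deriv_staircase_ne_zero (hκ : 0 < κ) (h : Separated j κ m) {x z : ℝ}
    (hx : deriv (staircase j κ θ m) x ≠ 0) (hz : - (κ / 8) ≤ z) :
    pushRight j κ m x ≤ pushRight j κ m (x + z) := by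
  obtain ⟨i, hi, hxi⟩ : ∃ i < m, x ∈ Icc (j i + κ / 4) (j i + κ / 2) := by
    by_contra hcon
    push Not at hcon
    apply hx
    rw [deriv_staircase]
    refine Finset.sum_eq_zero fun i hi => ?_
    rw [deriv_smoothTransition_of_notMem (staircase_arg_notMem hκ
      (hcon i (Finset.mem_range.1 hi))), mul_zero]
  have key : ∀ y ∈ Icc (j i + κ / 8) (j i + κ / 2),
      pushRight j κ m y = j i + κ * (3 / 4 + (1 / 4) * (1 - ramp 1)) := by
    intro y hy
    have hyi : y ∈ Ioo (j i) (j i + κ) := ⟨by linarith [hy.1], by linarith [hy.2]⟩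
    rcases pushRight_cases hκ h y with ⟨_, h3⟩ | ⟨k, hk, hyk, h2⟩
    · exact absurd hyi (h3 i hi)
    · obtain rfl := h.eq hk hi (Ioo_subset_Icc_self hyk) (Ioo_subset_Icc_self hyi)
      rw [h2, plateau_eq_const]
      · rw [le_div_iff₀ hκ]; linarith [hy.1]
      · rw [div_le_iff₀ hκ]; linarith [hy.2]
  rw [key x ⟨by linarith [hxi.1], hxi.2⟩, ← key (j i + κ / 8) ⟨le_rfl, by linarith⟩]
  exact pushRight_monotone hκ h (by linarith [hxi.1])

end

/-- A displacement `ξ` and a barrier `B` adapted to a pair of functions: the barrier grows only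
where the displacement is locally constant, and displaced pairs still obey the bound. -/
structure IsLocalizer (f g : ℝ → ℝ) (M κ K R Z Γ b c : ℝ) (ξ B : ℝ → ℝ) : Prop where
  contDiff_shift : ContDiff ℝ 2 ξ
  contDiff_barrier : ContDiff ℝ 2 B
  le_shift : ∀ x, x ≤ ξ x
  shift_le : ∀ x, ξ x ≤ x + 1
  monotone_shift : Monotone ξ
  pos_of_ne : ∀ x, ξ x ≠ x → 0 < x
  displaced : ∀ x ∈ Icc (-R) R, ∀ v ∈ Icc (-R) R, x + v < 0 → -v ≤ ξ x → f x + g v ≤ K + 2 * κ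
  monotone_barrier : Monotone B
  barrier_nonneg : ∀ x, 0 ≤ B x
  barrier_eq_zero : ∀ x, x ≤ R - Γ → B x = 0
  barrier_eq : ∀ x, R - Z - 3 ≤ x → B x = 4 * M
  deriv_barrier_le : ∀ x, deriv B x ≤ b
  barrier_add_le : ∀ x z, B (x + z) ≤ B x + deriv B x * z + c * z ^ 2
  shift_le_of_deriv_ne_zero : ∀ x, deriv B x ≠ 0 → ∀ z, -(κ / 8) ≤ z → ξ x ≤ ξ (x + z)

theorem exists_almost_max {f : ℝ → ℝ} {M : ℝ} (hf : UpperSemicontinuous f) (hb : ∀ x, |f x| ≤ M)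
    (c : ℝ) : ∃ x, |x - c| ≤ 2 * M ∧ ∀ y ∈ Icc (x - 1) x, f y ≤ f x + (x - y) := by
  have hM : 0 ≤ M := (abs_nonneg _).trans (hb 0)
  have hu : UpperSemicontinuous fun x => f x + -|x - c| :=
    hf.add (Continuous.upperSemicontinuous (by fun_prop))
  obtain ⟨x, hx, hmax⟩ := (hu.upperSemicontinuousOn _).exists_isMaxOn (s := Icc (c - 2 * M - 1) (c + 2 * M + 1))
    ⟨c, by constructor <;> linarith⟩ isCompact_Icc
  have h1 : |x - c| ≤ 2 * M := by
    have := hmax (show c ∈ Icc (c - 2 * M - 1) (c + 2 * M + 1) by constructor <;> linarith)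
    simp only [mem_ofPred_eq, sub_self, abs_zero, neg_zero, add_zero] at this
    linarith [(abs_le.1 (hb x)).2, (abs_le.1 (hb c)).1]
  refine ⟨x, h1, fun y hy => ?_⟩
  have h2 := abs_le.1 h1
  have := hmax (show y ∈ Icc (c - 2 * M - 1) (c + 2 * M + 1) from
    ⟨by linarith [hy.1], by linarith [hy.2]⟩)
  simp only [mem_ofPred_eq] at this
  have h3 : |y - c| ≤ |x - c| + |x - y| := by
    rw [abs_sub_comm x y]
    calc |y - c| = |(x - c) + (y - x)| := by ring_nf
      _ ≤ _ := abs_add_le _ _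
  rw [abs_of_nonneg (by linarith [hy.2] : 0 ≤ x - y)] at h3
  linarith

theorem exists_localizer : ∃ C : ℝ, 1 ≤ C ∧ ∀ {f g : ℝ → ℝ} {M κ K R Z : ℝ} {m : ℕ},
    UpperSemicontinuous f → (∀ x, |f x| ≤ M) → 0 < κ → κ ≤ 1 → 0 ≤ Z → 0 < m →
    m * (4 * M + 4) + Z + 3 < R →
    (∀ x ∈ Icc (-R) R, ∀ v ∈ Icc (-R) R, 0 ≤ x + v → f x + g v ≤ K + (x + v)) →
    ∃ ξ B, IsLocalizer f g M κ K R Z (m * (4 * M + 4) + Z + 3) (C * (4 * M / m) / κ)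
      (C * (4 * M / m) / κ ^ 2) ξ B := by
  obtain ⟨C, hC1, hC⟩ := exists_smoothTransition_bound
  refine ⟨16 * C, by linarith, fun {f g M κ K R Z m} hf hb hκ hκ1 hZ hm hR hP => ?_⟩
  have hM : 0 ≤ M := (abs_nonneg _).trans (hb 0)
  have hm' : (0 : ℝ) < m := by exact_mod_cast hm
  choose X hX1 hX2 using fun i : ℕ =>
    exists_almost_max hf hb (R - Z - 3 - (4 * M + 4) * (i + 1) + (2 * M + 2))
  have hXl : ∀ i < m, R - (m * (4 * M + 4) + Z + 3) + 2 ≤ X i := by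
    intro i hi
    have h1 := (abs_le.1 (hX1 i)).1
    have h2 : (i : ℝ) + 1 ≤ m := by exact_mod_cast hi
    nlinarith
  have hXr : ∀ i, X i ≤ R - Z - 5 := by
    intro i
    have h1 := (abs_le.1 (hX1 i)).2
    have h2 : (0 : ℝ) ≤ i := i.cast_nonneg
    nlinarith
  set j : ℕ → ℝ := fun i => X i - κ with hj
  have hgap : ∀ i k : ℕ, i < k → κ < X i - X k := by
    intro i k hik
    have h1 := (abs_le.1 (hX1 i)).1
    have h2 := (abs_le.1 (hX1 k)).2
    have h3 : (i : ℝ) + 1 ≤ k := by exact_mod_cast hik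
    nlinarith
  have hsep : Separated j κ m := by
    intro i _ k _ hik
    simp only [hj, sub_sub_sub_cancel_right]
    rcases lt_or_gt_of_ne hik with h | h
    · exact (hgap i k h).trans_le (le_abs_self _)
    · rw [abs_sub_comm]; exact (hgap k i h).trans_le (le_abs_self _)
  have hθ : 0 ≤ 4 * M / m := by positivity
  have hC0 : 0 ≤ C := by linarith
  refine ⟨pushRight j κ m, staircase j κ (4 * M / m) m, contDiff_pushRight, contDiff_staircase,
    le_pushRight hκ hsep, fun x => (pushRight_le hκ hsep x).trans (by linarith),
    pushRight_monotone hκ hsep, fun x hx => ?_, fun x hx v hv hxv hvx => ?_,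
    staircase_monotone hκ hθ, fun x => ?_, fun x hx => staircase_eq_zero hκ fun i hi => ?_,
    fun x hx => ?_, fun x => ?_, fun x z => ?_,
    fun x hx z hz => pushRight_le_of_deriv_staircase_ne_zero hκ hsep hx hz⟩
  · rcases pushRight_cases hκ hsep x with ⟨h1, _⟩ | ⟨i, hi, hxi, _⟩
    · exact absurd h1 hx
    · have := hXl i hi; have := hxi.1; simp only [hj] at this; linarith
  · rcases pushRight_cases hκ hsep x with ⟨h1, _⟩ | ⟨i, hi, hxi, h1⟩
    · rw [h1] at hvx; linarith
    · rw [h1] at hvx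
      have h2 := (plateau_scaled_le hκ hxi).2
      simp only [hj, mem_Ioo, sub_add_cancel] at hxi h2
      have h3 := hX2 i x ⟨by linarith, hxi.2.le⟩
      simp only [hj] at hvx
      have h5 : 0 ≤ m * (4 * M + 4) := by positivity
      have h4 := hP (X i) ⟨by linarith [hXl i hi], by linarith [hXr i]⟩ v hv (by linarith)
      linarith [hxi.1]
  · unfold staircase
    exact Finset.sum_nonneg fun i _ => mul_nonneg hθ (Real.smoothTransition.nonneg _)
  · have := hXl i hi; simp only [hj]; linarith
  · rw [staircase_eq hκ fun i hi => ?_]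
    · field_simp
    · have := hXr i; simp only [hj]; linarith
  · refine (le_abs_self _).trans ((abs_deriv_staircase_le hκ hθ hsep hC0 (fun u => (hC u).1) x).trans ?_)
    rw [show 4 * M / m * (4 / κ) * C = 4 * (C * (4 * M / m) / κ) by ring,
      show 16 * C * (4 * M / m) / κ = 16 * (C * (4 * M / m) / κ) by ring]
    have : 0 ≤ C * (4 * M / m) / κ := by positivity
    linarith
  · have := staircase_add_le hκ hθ hsep hC0 (fun u => (hC u).2) x z
    rwa [show 4 * M / m * (4 / κ) ^ 2 * C = 16 * C * (4 * M / m) / κ ^ 2 by ring] at this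

theorem ramp_pos {u : ℝ} (hu : 0 < u) : 0 < ramp u :=
  intervalIntegral.intervalIntegral_pos_of_pos_on
    (Real.smoothTransition.continuous.intervalIntegrable _ _)
    (fun _ hx => Real.smoothTransition.pos_of_pos hx.1) hu

theorem sub_ramp_le_one (u : ℝ) : u - ramp u ≤ 1 := by
  rcases le_total u 1 with h | h
  · have := id_sub_ramp_monotone h
    simp only at this; linarith [ramp_nonneg 1]
  · rw [ramp_of_one_le h]; linarith [ramp_nonneg 1]

theorem ramp_le {u : ℝ} (hu : 0 ≤ u) : ramp u ≤ u := by
  have := id_sub_ramp_monotone hu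
  simp only [ramp_of_nonpos le_rfl] at this; linarith

/-- The rescaled ramp, a smooth approximation of the positive part at scale `κ`. -/
noncomputable def scaledRamp (κ D : ℝ) : ℝ := κ * ramp (D / κ)

theorem hasDerivAt_scaledRamp {κ : ℝ} (hκ : 0 < κ) (D : ℝ) :
    HasDerivAt (scaledRamp κ) (Real.smoothTransition (D / κ)) D := by
  have h1 : HasDerivAt (fun D : ℝ => D / κ) (1 / κ) D := (hasDerivAt_id D).div_const κ
  have := (HasDerivAt.comp (h := fun D : ℝ => D / κ) D (hasDerivAt_ramp (D / κ)) h1).const_mul κ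
  exact this.congr_deriv (by field_simp)

theorem contDiff_scaledRamp (κ : ℝ) : ContDiff ℝ 2 (scaledRamp κ) :=
  contDiff_const.mul (contDiff_ramp.comp (contDiff_id.div_const κ))

theorem scaledRamp_nonneg {κ : ℝ} (hκ : 0 < κ) (D : ℝ) : 0 ≤ scaledRamp κ D :=
  mul_nonneg hκ.le (ramp_nonneg _)

theorem scaledRamp_of_nonpos {κ D : ℝ} (hκ : 0 < κ) (hD : D ≤ 0) : scaledRamp κ D = 0 := by
  unfold scaledRamp
  rw [ramp_of_nonpos (div_nonpos_of_nonpos_of_nonneg hD hκ.le), mul_zero]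

theorem scaledRamp_le {κ D : ℝ} (hκ : 0 < κ) (hD : 0 ≤ D) : scaledRamp κ D ≤ D := by
  have := mul_le_mul_of_nonneg_left (ramp_le (div_nonneg hD hκ.le)) hκ.le
  rwa [mul_div_cancel₀ _ hκ.ne'] at this

theorem le_scaledRamp_add {κ : ℝ} (hκ : 0 < κ) (D : ℝ) : D ≤ scaledRamp κ D + κ := by
  have := mul_le_mul_of_nonneg_left (sub_ramp_le_one (D / κ)) hκ.le
  rw [mul_sub, mul_div_cancel₀ _ hκ.ne'] at this
  unfold scaledRamp; linarith

theorem scaledRamp_add_le {κ C : ℝ} (hκ : 0 < κ)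
    (hC : ∀ u, |deriv Real.smoothTransition u| ≤ C) (D z : ℝ) :
    scaledRamp κ (D + z) ≤ scaledRamp κ D + Real.smoothTransition (D / κ) * z + C / κ * z ^ 2 := by
  have e1 : deriv (scaledRamp κ) = fun D => Real.smoothTransition (D / κ) :=
    funext fun D => (hasDerivAt_scaledRamp hκ D).deriv
  have e2 : ∀ y, HasDerivAt (fun D => Real.smoothTransition (D / κ))
      (deriv Real.smoothTransition (y / κ) / κ) y := fun y => by
    have h0 : HasDerivAt Real.smoothTransition (deriv Real.smoothTransition (y / κ)) (y / κ) :=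
      ((Real.smoothTransition.contDiff (n := 1)).differentiable (by norm_num) _).hasDerivAt
    have h1 : HasDerivAt (fun D : ℝ => D / κ) (1 / κ) y := (hasDerivAt_id y).div_const κ
    exact (HasDerivAt.comp (h := fun D : ℝ => D / κ) y h0 h1).congr_deriv (by ring)
  have := taylor_two_bound_of_le (f := scaledRamp κ) (x := D) (z := z) (ρ := |z|) (C := C / κ)
    (fun y => (hasDerivAt_scaledRamp hκ y).differentiableAt)
    (fun y => by rw [e1]; exact (e2 y).differentiableAt) (fun y _ => by
      rw [e1, (e2 y).deriv, abs_div, abs_of_pos hκ]; gcongr; exact hC _) le_rfl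
  rw [e1] at this
  linarith [(abs_le.1 this).2]

theorem exists_penalty {α : Type*} [TopologicalSpace α] {s : Set α} (hs : IsCompact s)
    {Φ ρ : α → ℝ} {M Λ : ℝ} (hΦ : UpperSemicontinuousOn Φ s) (hM : ∀ p ∈ s, Φ p ≤ M)
    (hρc : ContinuousOn ρ s) (hρ : ∀ p ∈ s, 0 ≤ ρ p) (h0 : ∀ p ∈ s, ρ p = 0 → Φ p < Λ) :
    ∃ N₀ : ℝ, 0 ≤ N₀ ∧ ∀ N ≥ N₀, ∀ p ∈ s, Φ p - N * ρ p < Λ := by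
  by_cases hne : (s ∩ Φ ⁻¹' Ici Λ).Nonempty
  · have hcomp : IsCompact (s ∩ Φ ⁻¹' Ici Λ) := hΦ.isCompact_inter_preimage_Ici hs Λ
    obtain ⟨q, hq, hmin⟩ := hcomp.exists_isMinOn hne (hρc.mono inter_subset_left)
    have hq0 : 0 < ρ q := by
      refine lt_of_le_of_ne (hρ q hq.1) fun h => ?_
      exact absurd (h0 q hq.1 h.symm) (not_lt.2 hq.2)
    have hMΛ : Λ ≤ M := le_trans hq.2 (hM q hq.1)
    refine ⟨(M - Λ + 1) / ρ q, div_nonneg (by linarith) hq0.le, fun N hN p hp => ?_⟩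
    have hN0 : 0 ≤ N := le_trans (div_nonneg (by linarith) hq0.le) hN
    by_cases hpΛ : Φ p < Λ
    · nlinarith [hρ p hp]
    · have h1 : ρ q ≤ ρ p := hmin ⟨hp, not_lt.1 hpΛ⟩
      have h2 : M - Λ + 1 ≤ N * ρ q := by rwa [ge_iff_le, div_le_iff₀ hq0] at hN
      nlinarith [hM p hp]
  · refine ⟨0, le_rfl, fun N hN p hp => ?_⟩
    have : Φ p < Λ := by
      by_contra h
      exact hne ⟨p, hp, not_lt.1 h⟩
    nlinarith [hρ p hp]

/-- The spatial part of the penalisation. -/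
noncomputable def penalty (S A κ : ℝ) (ξ B ξ' B' : ℝ → ℝ) (x v : ℝ) : ℝ :=
  S * scaledRamp κ (x + v) + A * ramp (-ξ x - ξ' v) + B x + B' v

theorem penalty_comm (S A κ : ℝ) (ξ B ξ' B' : ℝ → ℝ) (x v : ℝ) :
    penalty S A κ ξ B ξ' B' x v = penalty S A κ ξ' B' ξ B v x := by
  unfold penalty
  rw [add_comm x v, show -ξ x - ξ' v = -ξ' v - ξ x by ring]; ring

section

variable {f g f₁ g₁ f₂ g₂ ξ B ξ' B' : ℝ → ℝ} {M κ K R Z Γ b c C S A x₀ v₀ r : ℝ}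

theorem IsLocalizer.barrier_sub_le (h : IsLocalizer f₁ g₁ M κ K R Z Γ b c ξ B) (x : ℝ) {z : ℝ}
    (hz : 0 ≤ z) : B (x + z) - B x ≤ b * z := by
  have := image_sub_le_mul_sub_of_deriv_le (h.contDiff_barrier.differentiable (by norm_num))
    h.deriv_barrier_le (by linarith : x ≤ x + z)
  linarith

theorem IsLocalizer.deriv_barrier_nonneg (h : IsLocalizer f₁ g₁ M κ K R Z Γ b c ξ B) (x : ℝ) :
    0 ≤ deriv B x := h.monotone_barrier.deriv_nonneg

theorem IsLocalizer.deriv_shift_nonneg (h : IsLocalizer f₁ g₁ M κ K R Z Γ b c ξ B) (x : ℝ) :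
    0 ≤ deriv ξ x := h.monotone_shift.deriv_nonneg

theorem tail_ge_of_contact (h : IsLocalizer f₁ g₁ M κ K R Z Γ b c ξ B) (hf : Measurable f)
    (hfb : ∀ y, |f y| ≤ M) (hκ : 0 < κ) (hc : 0 ≤ c) (hC0 : 0 ≤ C)
    (hC : ∀ u, |deriv Real.smoothTransition u| ≤ C) (hS0 : 0 ≤ S) (hS1 : S ≤ 1) (hA : 0 ≤ A)
    (hx : |x₀| + κ / 8 ≤ R)
    (hmax : ∀ x ∈ Icc (-R) R, f x + g v₀ - penalty S A κ ξ B ξ' B' x v₀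
      ≤ f x₀ + g v₀ - penalty S A κ ξ B ξ' B' x₀ v₀)
    (hB : deriv B x₀ ≠ 0) (hr : 0 < r) (hrκ : r ≤ κ / 8) :
    -(2 * (C / κ + c) * (κ / 8) + 4 * M / (κ / 8)) ≤ tail f x₀ r := by
  refine tail_ge_of_touching (p := S * Real.smoothTransition ((x₀ + v₀) / κ) + deriv B x₀)
    hf hfb (by positivity) hr hrκ fun z hz => ?_
  have hz' := abs_le.1 hz
  have hx' := abs_le.1 (le_sub_iff_add_le.2 hx)
  have h1 := hmax (x₀ + z) ⟨by linarith, by linarith⟩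
  have h2 := scaledRamp_add_le hκ hC (x₀ + v₀) z
  have h3 := h.barrier_add_le x₀ z
  have h4 := h.shift_le_of_deriv_ne_zero x₀ hB z hz'.1
  have h5 : A * ramp (-ξ (x₀ + z) - ξ' v₀) ≤ A * ramp (-ξ x₀ - ξ' v₀) :=
    mul_le_mul_of_nonneg_left (ramp_monotone (by linarith)) hA
  have h6 := mul_le_mul_of_nonneg_left h2 hS0
  have h7 : S * (C / κ * z ^ 2) ≤ C / κ * z ^ 2 := mul_le_of_le_one_left (by positivity) hS1
  unfold penalty at h1
  rw [show x₀ + z + v₀ = x₀ + v₀ + z by ring] at h1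
  nlinarith

theorem sum_touching (h : IsLocalizer f₁ g₁ M κ K R Z Γ b c ξ B)
    (h' : IsLocalizer f₂ g₂ M κ K R Z Γ b c ξ' B') (hA : 0 ≤ A)
    (hD : 0 ≤ x₀ + v₀) (hx : |x₀| + Z ≤ R) (hv : |v₀| + Z ≤ R)
    (hmax : ∀ x ∈ Icc (-R) R, ∀ v ∈ Icc (-R) R, f x + g v - penalty S A κ ξ B ξ' B' x v
      ≤ f x₀ + g v₀ - penalty S A κ ξ B ξ' B' x₀ v₀) {z : ℝ} (hz : |z| ≤ Z) :
    f (x₀ + z) + g (v₀ - z) ≤ f x₀ + g v₀ + (deriv B x₀ - deriv B' v₀) * z + 2 * c * z ^ 2 := by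
  have hz' := abs_le.1 hz
  have hx' := abs_le.1 (le_sub_iff_add_le.2 hx)
  have hv' := abs_le.1 (le_sub_iff_add_le.2 hv)
  have h1 := hmax (x₀ + z) ⟨by linarith, by linarith⟩ (v₀ - z) ⟨by linarith, by linarith⟩
  have h2 := h.barrier_add_le x₀ z
  have h3 := h'.barrier_add_le v₀ (-z)
  have h4 := h.le_shift (x₀ + z)
  have h5 := h'.le_shift (v₀ - z)
  have h6 : 0 ≤ A * ramp (-ξ x₀ - ξ' v₀) := mul_nonneg hA (ramp_nonneg _)
  unfold penalty at h1
  rw [ramp_of_nonpos (by linarith : -ξ (x₀ + z) - ξ' (v₀ - z) ≤ 0),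
    show x₀ + z + (v₀ - z) = x₀ + v₀ by ring] at h1
  rw [← sub_eq_add_neg, neg_sq] at h3
  linarith

theorem sum_tail_ge_of_contact (h : IsLocalizer f₁ g₁ M κ K R Z Γ b c ξ B)
    (h' : IsLocalizer f₂ g₂ M κ K R Z Γ b c ξ' B') (hf : Measurable f) (hg : Measurable g)
    (hfb : ∀ y, |f y| ≤ M) (hgb : ∀ y, |g y| ≤ M) (hc : 0 ≤ c) (hA : 0 ≤ A)
    (hD : 0 ≤ x₀ + v₀) (hx : |x₀| + Z ≤ R) (hv : |v₀| + Z ≤ R)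
    (hmax : ∀ x ∈ Icc (-R) R, ∀ v ∈ Icc (-R) R, f x + g v - penalty S A κ ξ B ξ' B' x v
      ≤ f x₀ + g v₀ - penalty S A κ ξ B ξ' B' x₀ v₀) (hr : 0 < r) (hrZ : r ≤ Z) :
    -(4 * c * Z + 8 * M / Z) ≤ tail f x₀ r + tail g v₀ r := by
  rw [← tail_add_reflect hf hg hfb hgb hr]
  have := tail_ge_of_touching (f := fun z => f (x₀ + z) + g (v₀ - z)) (M := 2 * M) (x := 0)
    (p := deriv B x₀ - deriv B' v₀) (c := 2 * c) (ρ := Z) (r := r) (by fun_prop) (fun y => by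
      have e1 := abs_le.1 (hfb (x₀ + y)); have e2 := abs_le.1 (hgb (v₀ - y))
      exact abs_le.2 ⟨by linarith, by linarith⟩) (by positivity) hr hrZ (fun z hz => by
      simp only [zero_add, add_zero, sub_zero]
      exact sum_touching h h' hA hD hx hv hmax hz)
  refine le_trans (le_of_eq ?_) this
  ring

theorem integral_gain_of_contact (h : IsLocalizer f₁ g₁ M κ K R Z Γ b c ξ B)
    (h' : IsLocalizer f₂ g₂ M κ K R Z Γ b c ξ' B') (hf : Measurable f) (hg : Measurable g)
    (hfb : ∀ y, |f y| ≤ M) (hgb : ∀ y, |g y| ≤ M) (hκ : 0 < κ) (hA : 0 ≤ A)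
    (hD : 0 ≤ x₀ + v₀) (hx : |x₀| + Z ≤ R)
    (hmax : ∀ x ∈ Icc (-R) R, ∀ v ∈ Icc (-R) R, f x + g v - penalty S A κ ξ B ξ' B' x v
      ≤ f x₀ + g v₀ - penalty S A κ ξ B ξ' B' x₀ v₀) {L : ℝ} (hL : 0 ≤ L) (hLZ : L ≤ Z)
    (hb : 0 ≤ b) :
    L * (S * scaledRamp κ (x₀ + v₀) - b * L) - 2 * M * (x₀ + v₀)
      ≤ ∫ z in Ioc 0 L, (f x₀ + g v₀ - (f (x₀ + z) + g (v₀ - z))) := by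
  set D := x₀ + v₀ with hDdef
  have hx' := abs_le.1 (le_sub_iff_add_le.2 hx)
  set φ : ℝ → ℝ := fun z => g (-x₀ - z) with hφ
  have hφm : Measurable φ := by fun_prop
  have hIntervalInt : ∀ {u : ℝ → ℝ} {M' : ℝ}, Measurable u → (∀ z, |u z| ≤ M') → ∀ s t : ℝ,
      IntervalIntegrable u volume s t := by
    intro u M' hu hub s t
    rw [intervalIntegrable_iff]
    exact Integrable.mono' (g := fun _ => M') (continuousOn_const.integrableOn_Icc.mono_set
      uIoc_subset_uIcc) hu.aestronglyMeasurable (ae_of_all _ fun z => by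
        rw [Real.norm_eq_abs]; exact hub z)
  have hφi : ∀ s t : ℝ, IntervalIntegrable φ volume s t := hIntervalInt hφm fun z => hgb _
  have hφb : ∀ s t : ℝ, s ≤ t → |∫ z in s..t, φ z| ≤ M * (t - s) := fun s t hst => by
    have := intervalIntegral.norm_integral_le_of_norm_le_const (f := φ) (a := s) (b := t) (C := M)
      fun z _ => hgb _
    rwa [Real.norm_eq_abs, abs_of_nonneg (sub_nonneg.2 hst)] at this
  rw [← intervalIntegral.integral_of_le hL]
  have hi1 : IntervalIntegrable (fun z => f x₀ + g v₀ - (f (x₀ + z) + φ z)) volume 0 L := by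
    refine hIntervalInt (M' := 4 * M) (by fun_prop) (fun z => ?_) _ _
    have e1 := abs_le.1 (hfb x₀); have e2 := abs_le.1 (hgb v₀)
    have e3 := abs_le.1 (hfb (x₀ + z)); have e4 := abs_le.1 (hgb (-x₀ - z))
    exact abs_le.2 ⟨by simp only [hφ]; linarith, by simp only [hφ]; linarith⟩
  have hi2 : IntervalIntegrable (fun z => φ (z - D)) volume 0 L :=
    hIntervalInt (M' := M) (by fun_prop) (fun z => hgb _) _ _
  have e1 : ∀ z, f x₀ + g v₀ - (f (x₀ + z) + g (v₀ - z))
      = (f x₀ + g v₀ - (f (x₀ + z) + φ z)) + (φ z - φ (z - D)) := by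
    intro z
    simp only [hφ, hDdef]
    rw [show -x₀ - (z - (x₀ + v₀)) = v₀ - z by ring]; ring
  simp_rw [e1]
  rw [intervalIntegral.integral_add hi1 ((hφi _ _).sub hi2),
    intervalIntegral.integral_sub (hφi _ _) hi2, intervalIntegral.integral_comp_sub_right]
  have h1 : L * (S * scaledRamp κ D - b * L)
      ≤ ∫ z in (0 : ℝ)..L, (f x₀ + g v₀ - (f (x₀ + z) + φ z)) := by
    have : ∫ z in (0 : ℝ)..L, (S * scaledRamp κ D - b * L)
        ≤ ∫ z in (0 : ℝ)..L, (f x₀ + g v₀ - (f (x₀ + z) + φ z)) := by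
      refine intervalIntegral.integral_mono_on hL intervalIntegrable_const hi1 fun z hz => ?_
      have h2 := hmax (x₀ + z) ⟨by linarith [hz.1], by linarith [hz.2]⟩ (-x₀ - z)
        ⟨by linarith [hz.2], by linarith [hz.1]⟩
      have h3 := h.le_shift (x₀ + z)
      have h4 := h'.le_shift (-x₀ - z)
      have h5 : 0 ≤ A * ramp (-ξ x₀ - ξ' v₀) := mul_nonneg hA (ramp_nonneg _)
      have h6 := h.barrier_sub_le x₀ hz.1
      have h7 : B' (-x₀ - z) ≤ B' v₀ := h'.monotone_barrier (by linarith [hz.1])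
      have h8 : b * z ≤ b * L := mul_le_mul_of_nonneg_left hz.2 hb
      unfold penalty at h2
      rw [ramp_of_nonpos (by linarith : -ξ (x₀ + z) - ξ' (-x₀ - z) ≤ 0),
        scaledRamp_of_nonpos hκ (by linarith : x₀ + z + (-x₀ - z) ≤ 0)] at h2
      simp only [hφ]
      linarith
    rw [intervalIntegral.integral_const, sub_zero, smul_eq_mul] at this
    exact this
  have h2 : (∫ z in (0 : ℝ)..L, φ z) - ∫ z in (0 - D)..(L - D), φ z
      = (∫ z in (L - D)..L, φ z) - ∫ z in (0 - D)..0, φ z := by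
    have a1 := intervalIntegral.integral_add_adjacent_intervals (hφi (0 - D) 0) (hφi 0 L)
    have a2 := intervalIntegral.integral_add_adjacent_intervals (hφi (0 - D) (L - D)) (hφi (L - D) L)
    linarith
  have h3 := abs_le.1 (hφb (L - D) L (by linarith))
  have h4 := abs_le.1 (hφb (0 - D) 0 (by linarith))
  have h5 : M * (L - (L - D)) = M * D := by ring
  have h6 : M * (0 - (0 - D)) = M * D := by ring
  rw [h5] at h3; rw [h6] at h4
  linarith [h3.1, h4.2]

theorem sum_tail_ge_of_contact_of_gain (h : IsLocalizer f₁ g₁ M κ K R Z Γ b c ξ B)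
    (h' : IsLocalizer f₂ g₂ M κ K R Z Γ b c ξ' B') (hf : Measurable f) (hg : Measurable g)
    (hfb : ∀ y, |f y| ≤ M) (hgb : ∀ y, |g y| ≤ M) (hM : 1 ≤ M) (hκ : 0 < κ) (hb : 0 ≤ b)
    (hc : 0 ≤ c) (hS : 1 / 4 ≤ S) (hA : 0 ≤ A)
    (hD : 2 * κ ≤ x₀ + v₀) (hx : |x₀| + Z ≤ R) (hv : |v₀| + Z ≤ R) (hZ : 32 * M < Z)
    (hmax : ∀ x ∈ Icc (-R) R, ∀ v ∈ Icc (-R) R, f x + g v - penalty S A κ ξ B ξ' B' x v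
      ≤ f x₀ + g v₀ - penalty S A κ ξ B ξ' B' x₀ v₀) (hr : 0 < r) (hrM : r ≤ 32 * M) :
    (x₀ + v₀) / (512 * M) - 2 * b - (4 * M + b * (32 * M) + 2 * c * (32 * M) ^ 2) * r
      - (4 * c * Z + 8 * M / Z) ≤ tail f x₀ r + tail g v₀ r := by
  have hD0 : 0 ≤ x₀ + v₀ := by linarith
  rw [← tail_add_reflect hf hg hfb hgb hr]
  have key := tail_ge_of_touching_of_gain (f := fun z => f (x₀ + z) + g (v₀ - z)) (M := 2 * M)
    (x := 0) (p := deriv B x₀ - deriv B' v₀) (c := 2 * c) (ρ := Z) (r := r) (L := 32 * M)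
    (by fun_prop) (fun y => by
      have e1 := abs_le.1 (hfb (x₀ + y)); have e2 := abs_le.1 (hgb (v₀ - y))
      exact abs_le.2 ⟨by linarith, by linarith⟩) (by positivity) hr hrM hZ (fun z hz => by
      simp only [zero_add, add_zero, sub_zero]
      exact sum_touching h h' hA hD0 hx hv hmax hz)
  refine le_trans ?_ key
  have hgain := integral_gain_of_contact h h' hf hg hfb hgb hκ hA hD0 hx hmax
    (by linarith : 0 ≤ 32 * M) hZ.le hb
  simp only [zero_add, add_zero, sub_zero]
  set I := ∫ z in Ioc 0 (32 * M), (f x₀ + g v₀ - (f (x₀ + z) + g (v₀ - z))) with hI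
  set D := x₀ + v₀ with hDdef
  have hp : |deriv B x₀ - deriv B' v₀| ≤ b := by
    have a1 := h.deriv_barrier_nonneg x₀; have a2 := h.deriv_barrier_le x₀
    have a3 := h'.deriv_barrier_nonneg v₀; have a4 := h'.deriv_barrier_le v₀
    exact abs_le.2 ⟨by linarith, by linarith⟩
  set q := |deriv B x₀ - deriv B' v₀| with hq
  have hq0 : 0 ≤ q := abs_nonneg _
  have hramp : D / 2 ≤ scaledRamp κ D := by have := le_scaledRamp_add hκ D; linarith
  have hSr : D / 8 ≤ S * scaledRamp κ D := by nlinarith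
  have hI2 : 2 * M * D - b * (32 * M) ^ 2 ≤ I := by nlinarith
  have hL2 : (0 : ℝ) < (32 * M) ^ 2 := by positivity
  have h9 : (2 * (2 * M) + q * (32 * M) + 2 * c * (32 * M) ^ 2) * r
      ≤ (4 * M + b * (32 * M) + 2 * c * (32 * M) ^ 2) * r := by
    rw [show 2 * (2 * M) = 4 * M by ring]; gcongr
  have h10 : 0 ≤ (4 * M + b * (32 * M) + 2 * c * (32 * M) ^ 2) * r := by positivity
  have h11 : D / (512 * M) - 2 * b - (4 * M + b * (32 * M) + 2 * c * (32 * M) ^ 2) * r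
      ≤ (I - q * (32 * M) ^ 2 - (2 * (2 * M) + q * (32 * M) + 2 * c * (32 * M) ^ 2) * r)
        / (32 * M) ^ 2 := by
    rw [le_div_iff₀ hL2]
    have e1 : D / (512 * M) * (32 * M) ^ 2 = 2 * M * D := by field_simp; ring
    have e2 : q * (32 * M) ^ 2 ≤ b * (32 * M) ^ 2 := by gcongr
    have e3 : (1 : ℝ) ≤ (32 * M) ^ 2 := by nlinarith
    nlinarith
  have e4 : 2 * (2 * c) * Z + 4 * (2 * M) / Z = 4 * c * Z + 8 * M / Z := by ring
  linarith

end

set_option maxHeartbeats 800000 in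
theorem contact_absurd {f g f₁ g₁ f₂ g₂ ξ B ξ' B' : ℝ → ℝ} {M κ K R Z Γ b c C S A x₀ v₀ : ℝ}
    (h : IsLocalizer f₁ g₁ M κ K R Z Γ b c ξ B) (h' : IsLocalizer f₂ g₂ M κ K R Z Γ b c ξ' B')
    (hf : Measurable f) (hg : Measurable g)
    (hfb : ∀ y, |f y| ≤ M) (hgb : ∀ y, |g y| ≤ M) (hM : 1 ≤ M) (hκ : 0 < κ) (hκ1 : κ ≤ 1)
    (hb : 0 ≤ b) (hc : 0 ≤ c) (hC0 : 0 ≤ C) (hC : ∀ u, |deriv Real.smoothTransition u| ≤ C)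
    (hS : 1 / 4 ≤ S) (hS1 : S ≤ 1) (hA : 0 ≤ A) (hx : |x₀| + Z ≤ R) (hv : |v₀| + Z ≤ R)
    (hZ : 32 * M < Z)
    (hsmall : (4 * c * Z + 8 * M / Z)
      + 2 * b * (2 * (C / κ + c) * (κ / 8) + 4 * M / (κ / 8)) + 2 * b < κ / (512 * M))
    (hmax : ∀ x ∈ Icc (-R) R, ∀ v ∈ Icc (-R) R, f x + g v - penalty S A κ ξ B ξ' B' x v
      ≤ f x₀ + g v₀ - penalty S A κ ξ B ξ' B' x₀ v₀)
    (hlim : ∀ᶠ r in 𝓝[>] (0 : ℝ), 3 / 4 * (κ / (256 * M))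
      ≤ 1 / (2048 * M) * scaledRamp κ (x₀ + v₀)
        - max (S * Real.smoothTransition ((x₀ + v₀) / κ)
          - A * Real.smoothTransition (-ξ x₀ - ξ' v₀) * deriv ξ x₀ + deriv B x₀) 0 * tail f x₀ r
        - max (S * Real.smoothTransition ((x₀ + v₀) / κ)
          - A * Real.smoothTransition (-ξ x₀ - ξ' v₀) * deriv ξ' v₀ + deriv B' v₀) 0 * tail g v₀ r) :
    False := by
  set V := 2 * (C / κ + c) * (κ / 8) + 4 * M / (κ / 8) with hV
  have hV0 : 0 ≤ V := by positivity
  set Y := 4 * M + b * (32 * M) + 2 * c * (32 * M) ^ 2 with hY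
  have hY0 : 0 < Y := by positivity
  set D := x₀ + v₀ with hD
  set η := κ / (256 * M) with hη
  have hη0 : 0 < η := by positivity
  have hη2 : κ / (512 * M) = η / 2 := by rw [hη]; field_simp; ring
  rw [hη2] at hsmall
  have hev : ∀ δ > 0, ∀ᶠ r in 𝓝[>] (0 : ℝ), r ≤ δ := fun δ hδ =>
    nhdsWithin_le_nhds (Iic_mem_nhds hδ)
  have hpos : ∀ᶠ r in 𝓝[>] (0 : ℝ), 0 < r := self_mem_nhdsWithin
  obtain ⟨r, hr, hr1, hr2, hlimr⟩ := (hpos.and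
    ((hev (κ / 8) (by positivity)).and ((hev (η / 8 / Y) (by positivity)).and hlim))).exists
  have hr0 : 0 < r := hr
  rw [le_div_iff₀ hY0] at hr2
  have hbF := h.deriv_barrier_nonneg x₀
  have hbG := h'.deriv_barrier_nonneg v₀
  have hbF1 := h.deriv_barrier_le x₀
  have hbG1 := h'.deriv_barrier_le v₀
  have hIF : deriv B x₀ ≠ 0 → -V ≤ tail f x₀ r := fun hne =>
    tail_ge_of_contact h hf hfb hκ hc hC0 hC (by linarith) hS1 hA (by linarith)
      (fun x hx' => hmax x hx' v₀ (by
        have := abs_le.1 (le_sub_iff_add_le.2 hv); constructor <;> linarith)) hne hr0 hr1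
  have hIG : deriv B' v₀ ≠ 0 → -V ≤ tail g v₀ r := fun hne =>
    tail_ge_of_contact h' (S := S) (A := A) (ξ' := ξ) (B' := B) (v₀ := x₀) (g := f)
      hg hgb hκ hc hC0 hC (by linarith) hS1 hA (by linarith)
      (fun v hv' => by
        have := hmax x₀ (by
          have := abs_le.1 (le_sub_iff_add_le.2 hx); constructor <;> linarith) v hv'
        rw [penalty_comm, penalty_comm (x := x₀) (v := v₀)] at this
        linarith) hne hr0 hr1
  set P := S * Real.smoothTransition (D / κ) with hP
  set IF := tail f x₀ r with hIFdef
  set IG := tail g v₀ r with hIGdef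
  have hbV : 0 ≤ b * V := mul_nonneg hb hV0
  have side : ∀ {q d I : ℝ}, q ≤ d → 0 ≤ d → d ≤ b → (d ≠ 0 → -V ≤ I) → -(b * V) ≤ max q 0 * I := by
    intro q d I hqd hd0 hdb hI
    by_cases hd : d = 0
    · rw [max_eq_right (by linarith), zero_mul]; linarith
    · have h1 := hI hd
      have h2 : 0 ≤ max q 0 := le_max_right _ _
      have h3 : max q 0 ≤ b := max_le (hqd.trans hdb) hb
      nlinarith
  rcases lt_or_ge D 0 with hDneg | hDnn
  · have hst : P = 0 := by
      rw [hP, Real.smoothTransition.zero_of_nonpos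
        (div_nonpos_of_nonpos_of_nonneg hDneg.le hκ.le), mul_zero]
    rw [hst, scaledRamp_of_nonpos hκ hDneg.le] at hlimr
    have hst0 := Real.smoothTransition.nonneg (-ξ x₀ - ξ' v₀)
    have e1 := side (q := 0 - A * Real.smoothTransition (-ξ x₀ - ξ' v₀) * deriv ξ x₀ + deriv B x₀)
      (by have := mul_nonneg (mul_nonneg hA hst0) (h.deriv_shift_nonneg x₀); linarith)
      hbF hbF1 hIF
    have e2 := side (q := 0 - A * Real.smoothTransition (-ξ x₀ - ξ' v₀) * deriv ξ' v₀ + deriv B' v₀)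
      (by have := mul_nonneg (mul_nonneg hA hst0) (h'.deriv_shift_nonneg v₀); linarith)
      hbG hbG1 hIG
    have e3 : 0 ≤ 4 * c * Z + 8 * M / Z := by
      have : 0 < Z := by linarith
      positivity
    linarith
  · have hst : Real.smoothTransition (-ξ x₀ - ξ' v₀) = 0 :=
      Real.smoothTransition.zero_of_nonpos (by linarith [h.le_shift x₀, h'.le_shift v₀])
    have hP0 : 0 ≤ P := mul_nonneg (by linarith) (Real.smoothTransition.nonneg _)
    rw [hst, mul_zero, zero_mul, zero_mul, sub_zero, max_eq_left (by linarith),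
      max_eq_left (by linarith)] at hlimr
    have e1 := side (q := deriv B x₀) le_rfl hbF hbF1 hIF
    have e2 := side (q := deriv B' v₀) le_rfl hbG hbG1 hIG
    rw [max_eq_left hbF] at e1
    rw [max_eq_left hbG] at e2
    have e3 : 3 / 4 * η ≤ 1 / (2048 * M) * scaledRamp κ D - P * (IF + IG) + 2 * (b * V) := by
      have a1 := add_mul P (deriv B x₀) IF
      have a2 := add_mul P (deriv B' v₀) IG
      have a3 := mul_add P IF IG
      linarith
    have hβ : 0 < 1 / (2048 * M) := by positivity
    have hhD := scaledRamp_le hκ hDnn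
    have hZ0 : 0 < Z := by linarith
    have hrZ : r ≤ 32 * M := by linarith
    have hE0 : 0 ≤ 4 * c * Z + 8 * M / Z := by positivity
    rcases lt_or_ge D (2 * κ) with hD2 | hD2
    · have e4 := sum_tail_ge_of_contact h h' hf hg hfb hgb hc hA hDnn hx hv hmax hr0 (by linarith)
      have hP1 : P ≤ 1 := by
        exact mul_le_one₀ hS1 (Real.smoothTransition.nonneg _) (Real.smoothTransition.le_one _)
      have e5 : -(4 * c * Z + 8 * M / Z) ≤ P * (IF + IG) := by
        have a1 := mul_le_mul_of_nonneg_left e4 hP0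
        have a2 := mul_le_of_le_one_left hE0 hP1
        rw [mul_neg] at a1
        linarith
      have e6 : 1 / (2048 * M) * scaledRamp κ D ≤ η / 4 := by
        have : 1 / (2048 * M) * scaledRamp κ D ≤ 1 / (2048 * M) * (2 * κ) := by
          gcongr; linarith
        refine this.trans (le_of_eq ?_)
        rw [hη]; field_simp; ring
      linarith
    · have e4 := sum_tail_ge_of_contact_of_gain h h' hf hg hfb hgb hM hκ hb hc hS hA hD2 hx hv hZ
        hmax hr0 hrZ
      have hPS : P = S := by
        rw [hP, Real.smoothTransition.one_of_one_le (by rw [le_div_iff₀ hκ]; linarith), mul_one]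
      rw [hPS] at e3
      rw [← hY, ← hD] at e4
      have e5 : S * (D / (512 * M)) - (2 * b + η / 8 + (4 * c * Z + 8 * M / Z)) ≤ S * (IF + IG) := by
        have a1 : S * (D / (512 * M) - 2 * b - Y * r - (4 * c * Z + 8 * M / Z)) ≤ S * (IF + IG) :=
          mul_le_mul_of_nonneg_left e4 (by linarith)
        have a2 : S * (2 * b + Y * r + (4 * c * Z + 8 * M / Z))
            ≤ 2 * b + Y * r + (4 * c * Z + 8 * M / Z) :=
          mul_le_of_le_one_left (by positivity) hS1
        linarith
      have e6 : 1 / (2048 * M) * scaledRamp κ D ≤ S * (D / (512 * M)) := by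
        have : 1 / (2048 * M) * scaledRamp κ D ≤ 1 / (2048 * M) * D := by gcongr
        refine this.trans ?_
        have e7 : S * (D / (512 * M)) - 1 / (2048 * M) * D = (4 * S - 1) * D / (2048 * M) := by
          field_simp; ring
        have : 0 ≤ (4 * S - 1) * D / (2048 * M) :=
          div_nonneg (mul_nonneg (by linarith) hDnn) (by positivity)
        linarith
      linarith

/-- The part of the penalisation depending on the two time variables. -/
noncomputable def timePenalty (M η e N t τ : ℝ) : ℝ :=
  η * t + e * ramp (t - 1024 * M) + N * (t - τ) ^ 2

/-- The full penalisation in the doubled variables. -/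
noncomputable def fullPenalty (M η e N A κ : ℝ) (ξ B ξ' B' : ℝ → ℝ) (t x τ v : ℝ) : ℝ :=
  penalty (1 - t / (2048 * M)) A κ ξ B ξ' B' x v + timePenalty M η e N t τ

section

variable {M η e N A κ : ℝ} {ξ B ξ' B' : ℝ → ℝ}

theorem contDiff_fullPenalty (hξ : ContDiff ℝ 2 ξ) (hB : ContDiff ℝ 2 B) (hξ' : ContDiff ℝ 2 ξ')
    (hB' : ContDiff ℝ 2 B') : ContDiff ℝ 2 fun p : (ℝ × ℝ) × (ℝ × ℝ) =>
      fullPenalty M η e N A κ ξ B ξ' B' p.1.1 p.1.2 p.2.1 p.2.2 := by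
  have ht : ContDiff ℝ 2 fun p : (ℝ × ℝ) × (ℝ × ℝ) => p.1.1 := contDiff_fst.comp contDiff_fst
  have hx : ContDiff ℝ 2 fun p : (ℝ × ℝ) × (ℝ × ℝ) => p.1.2 := contDiff_snd.comp contDiff_fst
  have hτ : ContDiff ℝ 2 fun p : (ℝ × ℝ) × (ℝ × ℝ) => p.2.1 := contDiff_fst.comp contDiff_snd
  have hv : ContDiff ℝ 2 fun p : (ℝ × ℝ) × (ℝ × ℝ) => p.2.2 := contDiff_snd.comp contDiff_snd
  unfold fullPenalty penalty timePenalty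
  refine ContDiff.add (ContDiff.add (ContDiff.add (ContDiff.add (ContDiff.mul ?_ ?_)
    (contDiff_const.mul ?_)) (hB.comp hx)) (hB'.comp hv)) (ContDiff.add (ContDiff.add
    (contDiff_const.mul ht) (contDiff_const.mul ?_)) (contDiff_const.mul ((ht.sub hτ).pow 2)))
  · exact contDiff_const.sub (ht.div_const _)
  · exact (contDiff_scaledRamp κ).comp (hx.add hv)
  · exact contDiff_ramp.comp ((hξ.comp hx).neg.sub (hξ'.comp hv))
  · exact contDiff_ramp.comp (ht.sub contDiff_const)

theorem hasDerivAt_penalty {S : ℝ} (hκ : 0 < κ) (hξ : ContDiff ℝ 2 ξ) (hB : ContDiff ℝ 2 B)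
    (x v : ℝ) : HasDerivAt (fun x => penalty S A κ ξ B ξ' B' x v)
      (S * Real.smoothTransition ((x + v) / κ)
        - A * Real.smoothTransition (-ξ x - ξ' v) * deriv ξ x + deriv B x) x := by
  have h1 : HasDerivAt ξ (deriv ξ x) x := (hξ.differentiable (by norm_num) x).hasDerivAt
  have h2 : HasDerivAt B (deriv B x) x := (hB.differentiable (by norm_num) x).hasDerivAt
  have h3 : HasDerivAt (fun x => scaledRamp κ (x + v)) (Real.smoothTransition ((x + v) / κ)) x := by
    have := HasDerivAt.comp (h := fun x => x + v) x (hasDerivAt_scaledRamp hκ (x + v))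
      ((hasDerivAt_id x).add_const v)
    exact this.congr_deriv (by ring)
  have h4 : HasDerivAt (fun x => ramp (-ξ x - ξ' v))
      (Real.smoothTransition (-ξ x - ξ' v) * -deriv ξ x) x :=
    HasDerivAt.comp (h := fun x => -ξ x - ξ' v) x (hasDerivAt_ramp _) (h1.neg.sub_const _)
  exact ((((h3.const_mul S).add (h4.const_mul A)).add h2).add_const (B' v)).congr_deriv (by ring)

theorem hasDerivAt_fullPenalty_time (t x τ v : ℝ) :
    HasDerivAt (fun t => fullPenalty M η e N A κ ξ B ξ' B' t x τ v)
      (-(1 / (2048 * M) * scaledRamp κ (x + v)) + (η + e * Real.smoothTransition (t - 1024 * M)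
        + N * (2 * (t - τ)))) t := by
  have h1 : HasDerivAt (fun t => ramp (t - 1024 * M)) (Real.smoothTransition (t - 1024 * M)) t :=
    (HasDerivAt.comp (h := fun t => t - 1024 * M) t (hasDerivAt_ramp _)
      ((hasDerivAt_id t).sub_const _)).congr_deriv (by ring)
  have h2 : HasDerivAt (fun t : ℝ => (t - τ) ^ 2) (2 * (t - τ)) t :=
    (((hasDerivAt_id t).sub_const τ).pow 2).congr_deriv (by simp)
  have h3 : HasDerivAt (fun t : ℝ => 1 - t / (2048 * M)) (-(1 / (2048 * M))) t :=
    ((hasDerivAt_id t).div_const _).const_sub 1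
  have h4 : HasDerivAt (fun t => penalty (1 - t / (2048 * M)) A κ ξ B ξ' B' x v)
      (-(1 / (2048 * M)) * scaledRamp κ (x + v)) t :=
    (((h3.mul_const _).add_const _).add_const _).add_const _
  have h5 : HasDerivAt (fun t => timePenalty M η e N t τ) _ t :=
    (((hasDerivAt_id t).const_mul η).add (h1.const_mul e)).add (h2.const_mul N)
  exact (h4.add h5).congr_deriv (by ring)

theorem hasDerivAt_fullPenalty_time' (t x τ v : ℝ) :
    HasDerivAt (fun τ => fullPenalty M η e N A κ ξ B ξ' B' t x τ v) (-(N * (2 * (t - τ)))) τ := by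
  have h2 : HasDerivAt (fun τ : ℝ => (t - τ) ^ 2) (-(2 * (t - τ))) τ :=
    (((hasDerivAt_id τ).const_sub t).pow 2).congr_deriv (by simp)
  exact (((h2.const_mul N).const_add _).const_add _).congr_deriv (by ring)

theorem fullPenalty_eq_swap (t x τ v : ℝ) : fullPenalty M η e N A κ ξ B ξ' B' t x τ v =
    penalty (1 - t / (2048 * M)) A κ ξ' B' ξ B v x + timePenalty M η e N t τ := by
  unfold fullPenalty; rw [penalty_comm]

end

theorem upperSemicontinuousOn_doubled {F G : ℝ → ℝ → ℝ}
    (hF : UpperSemicontinuousOn (fun p : ℝ × ℝ => F p.1 p.2) (Ici 0 ×ˢ univ))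
    (hG : UpperSemicontinuousOn (fun p : ℝ × ℝ => G p.1 p.2) (Ici 0 ×ˢ univ))
    {s : Set ((ℝ × ℝ) × (ℝ × ℝ))} (hs : ∀ p ∈ s, 0 ≤ p.1.1 ∧ 0 ≤ p.2.1)
    {k : (ℝ × ℝ) × (ℝ × ℝ) → ℝ} (hk : Continuous k) :
    UpperSemicontinuousOn (fun p => F p.1.1 p.1.2 + G p.2.1 p.2.2 - k p) s := by
  have h1 : UpperSemicontinuousOn (fun p : (ℝ × ℝ) × (ℝ × ℝ) => F p.1.1 p.1.2) s :=
    UpperSemicontinuousOn.comp (g := Prod.fst) hF continuous_fst.continuousOn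
      fun p hp => ⟨(hs p hp).1, trivial⟩
  have h2 : UpperSemicontinuousOn (fun p : (ℝ × ℝ) × (ℝ × ℝ) => G p.2.1 p.2.2) s :=
    UpperSemicontinuousOn.comp (g := Prod.snd) hG continuous_snd.continuousOn
      fun p hp => ⟨(hs p hp).2, trivial⟩
  simp_rw [sub_eq_add_neg]
  exact (h1.add h2).add (hk.neg.upperSemicontinuous.upperSemicontinuousOn _)

/-- At an interior maximum of the doubled functional both subsolution inequalities hold. -/
theorem LocSub.eventually_add_of_doubled_max {F G : ℝ → ℝ → ℝ} {P : ℝ → ℝ → ℝ → ℝ → ℝ}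
    {t₀ x₀ τ₀ v₀ a p a' p' : ℝ} (hF : LocSub F) (hG : LocSub G)
    (hP : ContDiff ℝ 2 fun q : (ℝ × ℝ) × (ℝ × ℝ) => P q.1.1 q.1.2 q.2.1 q.2.2)
    (ht₀ : 0 < t₀) (hτ₀ : 0 < τ₀)
    (hmax : ∀ᶠ q : (ℝ × ℝ) × (ℝ × ℝ) in 𝓝 ((t₀, x₀), (τ₀, v₀)),
      F q.1.1 q.1.2 + G q.2.1 q.2.2 - P q.1.1 q.1.2 q.2.1 q.2.2
        ≤ F t₀ x₀ + G τ₀ v₀ - P t₀ x₀ τ₀ v₀)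
    (ha : HasDerivAt (fun t => P t x₀ τ₀ v₀) a t₀) (hp : HasDerivAt (fun x => P t₀ x τ₀ v₀) p x₀)
    (ha' : HasDerivAt (fun τ => P t₀ x₀ τ v₀) a' τ₀)
    (hp' : HasDerivAt (fun v => P t₀ x₀ τ₀ v) p' v₀) {ε : ℝ} (hε : 0 < ε) :
    ∀ᶠ r in 𝓝[>] (0 : ℝ),
      a + a' + max p 0 * tail (F t₀) x₀ r + max p' 0 * tail (G τ₀) v₀ r ≤ 2 * ε := by
  have t1 : Tendsto (fun q : ℝ × ℝ => (q, (τ₀, v₀))) (𝓝 (t₀, x₀)) (𝓝 ((t₀, x₀), (τ₀, v₀))) :=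
    (Continuous.prodMk_left (τ₀, v₀)).tendsto _
  have t2 : Tendsto (fun q : ℝ × ℝ => ((t₀, x₀), q)) (𝓝 (τ₀, v₀)) (𝓝 ((t₀, x₀), (τ₀, v₀))) :=
    (Continuous.prodMk_right (t₀, x₀)).tendsto _
  have c1 : ContDiff ℝ 2 fun q : ℝ × ℝ => P q.1 q.2 τ₀ v₀ :=
    hP.comp (contDiff_id.prodMk (contDiff_const (c := (τ₀, v₀))))
  have c2 : ContDiff ℝ 2 fun q : ℝ × ℝ => P t₀ x₀ q.1 q.2 :=
    hP.comp ((contDiff_const (c := (t₀, x₀))).prodMk contDiff_id)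
  have k1 := hF t₀ x₀ (fun q => F t₀ x₀ - P t₀ x₀ τ₀ v₀ + P q.1 q.2 τ₀ v₀) a p ht₀
    (contDiff_const.add c1) (by ring) (by
      filter_upwards [t1.eventually hmax] with q hq
      linarith)
    (ha.const_add _) (hp.const_add _) ε hε
  have k2 := hG τ₀ v₀ (fun q => G τ₀ v₀ - P t₀ x₀ τ₀ v₀ + P t₀ x₀ q.1 q.2) a' p' hτ₀
    (contDiff_const.add c2) (by ring) (by
      filter_upwards [t2.eventually hmax] with q hq
      linarith)
    (ha'.const_add _) (hp'.const_add _) ε hε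
  filter_upwards [k1, k2] with r h1 h2
  linarith

/-- At an interior maximum of the doubled functional both subsolution inequalities hold, and their
sum no longer involves the doubling of time. -/
theorem eventually_of_doubled_max {F G : ℝ → ℝ → ℝ} {M e N A κ t₀ x₀ τ₀ v₀ : ℝ}
    {ξ B ξ' B' : ℝ → ℝ} (hF : LocSub F) (hG : LocSub G) (hM : 1 ≤ M) (hκ : 0 < κ) (he : 0 ≤ e)
    (hξ : ContDiff ℝ 2 ξ) (hB : ContDiff ℝ 2 B) (hξ' : ContDiff ℝ 2 ξ') (hB' : ContDiff ℝ 2 B')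
    (ht₀ : 0 < t₀) (hτ₀ : 0 < τ₀)
    (hmax : ∀ᶠ p : (ℝ × ℝ) × (ℝ × ℝ) in 𝓝 ((t₀, x₀), (τ₀, v₀)),
      F p.1.1 p.1.2 + G p.2.1 p.2.2
        - fullPenalty M (κ / (256 * M)) e N A κ ξ B ξ' B' p.1.1 p.1.2 p.2.1 p.2.2
      ≤ F t₀ x₀ + G τ₀ v₀
        - fullPenalty M (κ / (256 * M)) e N A κ ξ B ξ' B' t₀ x₀ τ₀ v₀) :
    ∀ᶠ r in 𝓝[>] (0 : ℝ), 3 / 4 * (κ / (256 * M))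
      ≤ 1 / (2048 * M) * scaledRamp κ (x₀ + v₀)
        - max ((1 - t₀ / (2048 * M)) * Real.smoothTransition ((x₀ + v₀) / κ)
          - A * Real.smoothTransition (-ξ x₀ - ξ' v₀) * deriv ξ x₀ + deriv B x₀) 0
            * tail (F t₀) x₀ r
        - max ((1 - t₀ / (2048 * M)) * Real.smoothTransition ((x₀ + v₀) / κ)
          - A * Real.smoothTransition (-ξ x₀ - ξ' v₀) * deriv ξ' v₀ + deriv B' v₀) 0
            * tail (G τ₀) v₀ r := by
  have hη0 : 0 < κ / (256 * M) := by positivity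
  have hp' : HasDerivAt
      (fun v => fullPenalty M (κ / (256 * M)) e N A κ ξ B ξ' B' t₀ x₀ τ₀ v)
      ((1 - t₀ / (2048 * M)) * Real.smoothTransition ((x₀ + v₀) / κ)
        - A * Real.smoothTransition (-ξ x₀ - ξ' v₀) * deriv ξ' v₀ + deriv B' v₀) v₀ := by
    simp only [fullPenalty_eq_swap]
    rw [add_comm x₀ v₀, show -ξ x₀ - ξ' v₀ = -ξ' v₀ - ξ x₀ by ring]
    exact (hasDerivAt_penalty hκ hξ' hB' v₀ x₀).add_const _
  have hp := (hasDerivAt_penalty (S := 1 - t₀ / (2048 * M)) (A := A) (ξ' := ξ') (B' := B')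
    hκ hξ hB x₀ v₀).add_const (timePenalty M (κ / (256 * M)) e N t₀ τ₀)
  have key := LocSub.eventually_add_of_doubled_max hF hG (contDiff_fullPenalty hξ hB hξ' hB') ht₀
    hτ₀ hmax (hasDerivAt_fullPenalty_time t₀ x₀ τ₀ v₀) hp
    (hasDerivAt_fullPenalty_time' t₀ x₀ τ₀ v₀) hp' (ε := κ / (256 * M) / 8) (by positivity)
  filter_upwards [key] with r h1
  have := mul_nonneg he (Real.smoothTransition.nonneg (t₀ - 1024 * M))
  linarith

theorem exists_shift_penalty {f g ξ B ξ' B' : ℝ → ℝ} {M κ K R Z Γ b c : ℝ}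
    (h : IsLocalizer f g M κ K R Z Γ b c ξ B) (h' : IsLocalizer g f M κ K R Z Γ b c ξ' B')
    (hf : UpperSemicontinuous f) (hg : UpperSemicontinuous g)
    (hfb : ∀ x, |f x| ≤ M) (hgb : ∀ x, |g x| ≤ M) (hκ : 0 < κ)
    (hP : ∀ x ∈ Icc (-R) R, ∀ v ∈ Icc (-R) R, 0 ≤ x + v → f x + g v ≤ K + (x + v)) :
    ∃ A, 0 ≤ A ∧ 2 * M ≤ A * ramp (1 / 2) ∧ ∀ x ∈ Icc (-R) R, ∀ v ∈ Icc (-R) R,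
      f x + g v - penalty 1 A κ ξ B ξ' B' x v < K + 3 * κ := by
  have hM : 0 ≤ M := (abs_nonneg _).trans (hfb 0)
  have hr : 0 < ramp (1 / 2) := ramp_pos (by norm_num)
  obtain ⟨A₀, hA₀, hA⟩ := exists_penalty (s := Icc (-R) R ×ˢ Icc (-R) R)
    (Φ := fun p : ℝ × ℝ => f p.1 + g p.2 + -(scaledRamp κ (p.1 + p.2) + B p.1 + B' p.2))
    (ρ := fun p => ramp (-ξ p.1 - ξ' p.2)) (M := 2 * M) (Λ := K + 3 * κ)
    (isCompact_Icc.prod isCompact_Icc) (by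
      have k1 : UpperSemicontinuous fun p : ℝ × ℝ => f p.1 := hf.comp continuous_fst
      have k2 : UpperSemicontinuous fun p : ℝ × ℝ => g p.2 := hg.comp continuous_snd
      have k3 : Continuous fun p : ℝ × ℝ => -(scaledRamp κ (p.1 + p.2) + B p.1 + B' p.2) := by
        have := (contDiff_scaledRamp κ).continuous
        have := h.contDiff_barrier.continuous
        have := h'.contDiff_barrier.continuous
        fun_prop
      exact ((k1.add k2).add k3.upperSemicontinuous).upperSemicontinuousOn _)
    (fun p _ => by
      have := scaledRamp_nonneg hκ (p.1 + p.2)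
      linarith [h.barrier_nonneg p.1, h'.barrier_nonneg p.2, (abs_le.1 (hfb p.1)).2,
        (abs_le.1 (hgb p.2)).2])
    (by
      have := contDiff_ramp.continuous
      have := h.contDiff_shift.continuous
      have := h'.contDiff_shift.continuous
      fun_prop)
    (fun p _ => ramp_nonneg _)
    (fun p hp h0 => by
      have hu : -ξ p.1 - ξ' p.2 ≤ 0 := by
        by_contra hcon
        exact (ramp_pos (not_le.1 hcon)).ne' h0
      have h1 := scaledRamp_nonneg hκ (p.1 + p.2)
      have h2 := h.barrier_nonneg p.1
      have h3 := h'.barrier_nonneg p.2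
      rcases le_or_gt 0 (p.1 + p.2) with hD | hD
      · have h4 := hP p.1 hp.1 p.2 hp.2 hD
        have h5 := le_scaledRamp_add hκ (p.1 + p.2)
        linarith
      · have h4 : f p.1 + g p.2 ≤ K + 2 * κ := by
          by_cases hx : ξ p.1 = p.1
          · rw [add_comm]
            exact h'.displaced p.2 hp.2 p.1 hp.1 (by linarith) (by linarith)
          · have hx0 := h.pos_of_ne _ hx
            have hv : ξ' p.2 = p.2 := by
              by_contra hv
              linarith [h'.pos_of_ne _ hv]
            exact h.displaced p.1 hp.1 p.2 hp.2 hD (by linarith)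
        linarith)
  refine ⟨max A₀ (2 * M / ramp (1 / 2)), le_max_of_le_left hA₀, ?_, fun x hx v hv => ?_⟩
  · rw [← div_le_iff₀ hr]; exact le_max_right _ _
  · have := hA _ (le_max_left A₀ (2 * M / ramp (1 / 2))) (x, v) ⟨hx, hv⟩
    simp only at this
    unfold penalty
    linarith

theorem penalty_nonneg {ξ B ξ' B' : ℝ → ℝ} {A κ S x v : ℝ} (hκ : 0 < κ) (hA : 0 ≤ A) (hS : 0 ≤ S)
    (hB : 0 ≤ B x) (hB' : 0 ≤ B' v) : 0 ≤ penalty S A κ ξ B ξ' B' x v := by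
  unfold penalty
  have := mul_nonneg hS (scaledRamp_nonneg hκ (x + v))
  have := mul_nonneg hA (ramp_nonneg (-ξ x - ξ' v))
  linarith

theorem exists_time_penalty {F G : ℝ → ℝ → ℝ} {ξ B ξ' B' : ℝ → ℝ} {M κ Λ R η e A : ℝ}
    (hF : UpperSemicontinuousOn (fun p : ℝ × ℝ => F p.1 p.2) (Ici 0 ×ˢ univ))
    (hG : UpperSemicontinuousOn (fun p : ℝ × ℝ => G p.1 p.2) (Ici 0 ×ˢ univ))
    (hFb : ∀ t x, 0 ≤ t → |F t x| ≤ M) (hGb : ∀ t x, 0 ≤ t → |G t x| ≤ M) (hM : 1 ≤ M)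
    (hκ : 0 < κ) (hη : 0 ≤ η) (he : 0 ≤ e) (hA : 0 ≤ A)
    (hξ : ContDiff ℝ 2 ξ) (hB : ContDiff ℝ 2 B) (hξ' : ContDiff ℝ 2 ξ') (hB' : ContDiff ℝ 2 B')
    (hB0 : ∀ x, 0 ≤ B x) (hB0' : ∀ x, 0 ≤ B' x)
    (h0 : ∀ x ∈ Icc (-R) R, ∀ v ∈ Icc (-R) R,
      F 0 x + G 0 v - penalty 1 A κ ξ B ξ' B' x v < Λ) :
    ∃ N, 2 * M ≤ N ∧ ∀ t ∈ Icc 0 (1536 * M), ∀ x ∈ Icc (-R) R, ∀ τ ∈ Icc 0 (1536 * M + 1),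
      ∀ v ∈ Icc (-R) R, (t = 0 ∨ τ = 0) →
      F t x + G τ v - fullPenalty M η e N A κ ξ B ξ' B' t x τ v < Λ := by
  set s : Set ((ℝ × ℝ) × (ℝ × ℝ)) := ((Icc 0 (1536 * M) ×ˢ Icc (-R) R) ×ˢ
    (Icc 0 (1536 * M + 1) ×ˢ Icc (-R) R)) ∩ {p | p.1.1 = 0 ∨ p.2.1 = 0} with hs
  have hcomp : IsCompact s := by
    refine ((isCompact_Icc.prod isCompact_Icc).prod (isCompact_Icc.prod isCompact_Icc)).inter_right
      ?_
    exact (isClosed_eq (by fun_prop) continuous_const).union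
      (isClosed_eq (by fun_prop) continuous_const)
  obtain ⟨N₀, hN₀, hN⟩ := exists_penalty (s := s)
    (Φ := fun p => F p.1.1 p.1.2 + G p.2.1 p.2.2
      - fullPenalty M η e 0 A κ ξ B ξ' B' p.1.1 p.1.2 p.2.1 p.2.2)
    (ρ := fun p => (p.1.1 - p.2.1) ^ 2) (M := 2 * M) (Λ := Λ) hcomp
    (upperSemicontinuousOn_doubled hF hG (fun p hp => ⟨hp.1.1.1.1, hp.1.2.1.1⟩)
      (contDiff_fullPenalty hξ hB hξ' hB').continuous)
    (fun p hp => by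
      have h1 := (abs_le.1 (hFb p.1.1 p.1.2 hp.1.1.1.1)).2
      have h2 := (abs_le.1 (hGb p.2.1 p.2.2 hp.1.2.1.1)).2
      have hS : 0 ≤ 1 - p.1.1 / (2048 * M) := by
        rw [sub_nonneg, div_le_one (by positivity)]; linarith [hp.1.1.1.2]
      have h3 := penalty_nonneg (ξ := ξ) (ξ' := ξ') hκ hA hS (hB0 p.1.2) (hB0' p.2.2)
      have h4 := mul_nonneg hη hp.1.1.1.1
      have h5 := mul_nonneg he (ramp_nonneg (p.1.1 - 1024 * M))
      simp only [fullPenalty, timePenalty]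
      linarith)
    (by fun_prop) (fun p _ => sq_nonneg _)
    (fun p hp hρ => by
      have ht : p.1.1 = p.2.1 := by
        have := pow_eq_zero_iff (two_ne_zero) |>.1 hρ
        linarith
      have h1 : p.1.1 = 0 := by rcases hp.2 with h | h <;> linarith
      have h2 : p.2.1 = 0 := by linarith
      have := h0 p.1.2 hp.1.1.2 p.2.2 hp.1.2.2
      simp only [fullPenalty, timePenalty, h1, h2]
      rw [ramp_of_nonpos (by linarith : (0 : ℝ) - 1024 * M ≤ 0)]
      simpa using this)
  refine ⟨max N₀ (2 * M), le_max_right _ _, fun t ht x hx τ hτ v hv h => ?_⟩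
  have := hN _ (le_max_left N₀ (2 * M)) ((t, x), (τ, v)) ⟨⟨⟨ht, hx⟩, ⟨hτ, hv⟩⟩, h⟩
  simp only [fullPenalty, timePenalty] at this ⊢
  linarith

/-- Improvement of the slope over a fixed time, given adapted localizers: a one-sided bound with
slope one at the initial time becomes a bound with slope decreasing in time. -/
theorem le_of_isLocalizer {F G : ℝ → ℝ → ℝ} {ξ B ξ' B' : ℝ → ℝ} {M κ K R Z Γ b c C : ℝ}
    (hF : UpperSemicontinuousOn (fun p : ℝ × ℝ => F p.1 p.2) (Ici 0 ×ˢ univ))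
    (hG : UpperSemicontinuousOn (fun p : ℝ × ℝ => G p.1 p.2) (Ici 0 ×ˢ univ))
    (hFb : ∀ t x, 0 ≤ t → |F t x| ≤ M) (hGb : ∀ t x, 0 ≤ t → |G t x| ≤ M)
    (hFs : LocSub F) (hGs : LocSub G) (hM : 1 ≤ M) (hκ : 0 < κ) (hκ1 : κ ≤ 1) (hK : 0 ≤ K)
    (h : IsLocalizer (F 0) (G 0) M κ K R Z Γ b c ξ B)
    (h' : IsLocalizer (G 0) (F 0) M κ K R Z Γ b c ξ' B')
    (hP : ∀ x ∈ Icc (-R) R, ∀ v ∈ Icc (-R) R, 0 ≤ x + v → F 0 x + G 0 v ≤ K + (x + v))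
    (hb : 0 ≤ b) (hc : 0 ≤ c) (hΓ : 0 ≤ Γ) (hC0 : 0 ≤ C)
    (hC : ∀ u, |deriv Real.smoothTransition u| ≤ C) (hZ : 32 * M < Z)
    (hsmall : (4 * c * Z + 8 * M / Z)
      + 2 * b * (2 * (C / κ + c) * (κ / 8) + 4 * M / (κ / 8)) + 2 * b < κ / (512 * M)) :
    ∀ t ∈ Icc 0 (1024 * M), ∀ x ∈ Icc (-(R - Γ)) (R - Γ), ∀ v ∈ Icc (-(R - Γ)) (R - Γ),
      0 ≤ x + v → F t x + G t v ≤ K + 7 * κ + (1 - t / (2048 * M)) * (x + v) := by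
  intro t₁ ht₁ x₁ hx₁ v₁ hv₁ hxv
  by_contra! hcon
  have hη0 : 0 < κ / (256 * M) := by positivity
  have hr : 0 < ramp (512 * M) := ramp_pos (by positivity)
  have he : 0 ≤ 8 * M / ramp (512 * M) := by positivity
  have heM : 8 * M / ramp (512 * M) * ramp (512 * M) = 8 * M := div_mul_cancel₀ _ hr.ne'
  generalize hηdef : κ / (256 * M) = η at hη0
  have hη1 : η * (1024 * M) = 4 * κ := by rw [← hηdef]; field_simp; norm_num
  generalize 8 * M / ramp (512 * M) = e at he heM
  obtain ⟨A, hA, hA1, hA2⟩ := exists_shift_penalty h h' (hF.slice le_rfl) (hG.slice le_rfl)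
    (fun x => hFb 0 x le_rfl) (fun x => hGb 0 x le_rfl) hκ hP
  obtain ⟨N, hN, hN1⟩ := exists_time_penalty (η := η) (e := e) hF hG hFb hGb hM hκ hη0.le he hA
    h.contDiff_shift h.contDiff_barrier h'.contDiff_shift h'.contDiff_barrier h.barrier_nonneg
    h'.barrier_nonneg hA2
  have m1 : (((t₁, x₁), (t₁, v₁)) : (ℝ × ℝ) × (ℝ × ℝ)) ∈ (Icc 0 (1536 * M) ×ˢ Icc (-R) R) ×ˢ
      (Icc 0 (1536 * M + 1) ×ˢ Icc (-R) R) := by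
    refine ⟨⟨⟨ht₁.1, ?_⟩, ⟨?_, ?_⟩⟩, ⟨⟨ht₁.1, ?_⟩, ⟨?_, ?_⟩⟩⟩ <;> simp only <;>
      linarith [ht₁.2, hx₁.1, hx₁.2, hv₁.1, hv₁.2]
  obtain ⟨⟨⟨t₀, x₀⟩, ⟨τ₀, v₀⟩⟩, hm, hmax⟩ := UpperSemicontinuousOn.exists_isMaxOn ⟨_, m1⟩
    ((isCompact_Icc.prod isCompact_Icc).prod (isCompact_Icc.prod isCompact_Icc))
    (upperSemicontinuousOn_doubled hF hG (fun p hp => ⟨hp.1.1.1, hp.2.1.1⟩)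
      (contDiff_fullPenalty (M := M) (η := η) (e := e) (N := N) (A := A) (κ := κ)
        h.contDiff_shift h.contDiff_barrier h'.contDiff_shift h'.contDiff_barrier).continuous)
  obtain ⟨⟨ht, hx⟩, ⟨hτ, hv⟩⟩ := hm
  simp only at ht hx hτ hv
  have hmax' : ∀ t ∈ Icc 0 (1536 * M), ∀ x ∈ Icc (-R) R, ∀ τ ∈ Icc 0 (1536 * M + 1),
      ∀ v ∈ Icc (-R) R, F t x + G τ v - fullPenalty M η e N A κ ξ B ξ' B' t x τ v
        ≤ F t₀ x₀ + G τ₀ v₀ - fullPenalty M η e N A κ ξ B ξ' B' t₀ x₀ τ₀ v₀ :=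
    fun t ht x hx τ hτ v hv => hmax (show ((t, x), (τ, v)) ∈ _ from ⟨⟨ht, hx⟩, ⟨hτ, hv⟩⟩)
  have hS0 : ∀ t ∈ Icc 0 (1536 * M), 1 / 4 ≤ 1 - t / (2048 * M) ∧ 1 - t / (2048 * M) ≤ 1 := by
    intro t ht
    have h1 : t / (2048 * M) ≤ 3 / 4 := by rw [div_le_iff₀ (by positivity)]; linarith [ht.2]
    have h2 : 0 ≤ t / (2048 * M) := div_nonneg ht.1 (by positivity)
    constructor <;> linarith
  have hval : K + 3 * κ
      < F t₀ x₀ + G τ₀ v₀ - fullPenalty M η e N A κ ξ B ξ' B' t₀ x₀ τ₀ v₀ := by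
    refine lt_of_lt_of_le ?_ (hmax' t₁ m1.1.1 x₁ m1.1.2 t₁ m1.2.1 v₁ m1.2.2)
    have e1 : ramp (t₁ - 1024 * M) = 0 := ramp_of_nonpos (by linarith [ht₁.2])
    have e2 : ramp (-ξ x₁ - ξ' v₁) = 0 :=
      ramp_of_nonpos (by linarith [h.le_shift x₁, h'.le_shift v₁])
    have e3 := mul_le_mul_of_nonneg_left (scaledRamp_le hκ hxv)
      (by linarith [hS0 t₁ m1.1.1] : 0 ≤ 1 - t₁ / (2048 * M))
    have e4 := mul_le_mul_of_nonneg_left ht₁.2 hη0.le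
    simp only [fullPenalty, penalty, timePenalty, e1, e2, h.barrier_eq_zero x₁ hx₁.2,
      h'.barrier_eq_zero v₁ hv₁.2]
    linarith
  have ht0 : 0 < t₀ := lt_of_le_of_ne ht.1 fun hz =>
    (hN1 t₀ ht x₀ hx τ₀ hτ v₀ hv (Or.inl hz.symm)).not_gt hval
  have hτ0 : 0 < τ₀ := lt_of_le_of_ne hτ.1 fun hz =>
    (hN1 t₀ ht x₀ hx τ₀ hτ v₀ hv (Or.inr hz.symm)).not_gt hval
  have q1 := mul_nonneg (by linarith [hS0 t₀ ht] : 0 ≤ 1 - t₀ / (2048 * M))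
    (scaledRamp_nonneg hκ (x₀ + v₀))
  have q2 := mul_nonneg hA (ramp_nonneg (-ξ x₀ - ξ' v₀))
  have q3 := h.barrier_nonneg x₀
  have q4 := h'.barrier_nonneg v₀
  have q5 := mul_nonneg hη0.le ht.1
  have q6 := mul_nonneg he (ramp_nonneg (t₀ - 1024 * M))
  have q7 : 0 ≤ N * (t₀ - τ₀) ^ 2 := mul_nonneg (by linarith) (sq_nonneg _)
  have hpen : (1 - t₀ / (2048 * M)) * scaledRamp κ (x₀ + v₀) + A * ramp (-ξ x₀ - ξ' v₀) + B x₀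
      + B' v₀ + (η * t₀ + e * ramp (t₀ - 1024 * M) + N * (t₀ - τ₀) ^ 2) < 2 * M := by
    have h1 := (abs_le.1 (hFb t₀ x₀ ht.1)).2
    have h2 := (abs_le.1 (hGb τ₀ v₀ hτ.1)).2
    simp only [fullPenalty, penalty, timePenalty] at hval
    linarith
  have ht1 : t₀ < 1536 * M := by
    refine lt_of_le_of_ne ht.2 fun hz => ?_
    rw [hz, show 1536 * M - 1024 * M = 512 * M by ring] at q6 hpen
    rw [hz] at q1 q5 q7
    linarith
  have hτ1 : τ₀ < 1536 * M + 1 := by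
    by_contra! hz
    have h1 : 1 ≤ (t₀ - τ₀) ^ 2 := by nlinarith
    nlinarith
  have hx1 : x₀ < R - Z - 3 := by
    by_contra! hz
    linarith [h.barrier_eq x₀ hz]
  have hv1 : v₀ < R - Z - 3 := by
    by_contra! hz
    linarith [h'.barrier_eq v₀ hz]
  have hu : -ξ x₀ - ξ' v₀ < 1 / 2 := by
    by_contra! hz
    have := mul_le_mul_of_nonneg_left (ramp_monotone hz) hA
    linarith
  have hsx := h.shift_le x₀
  have hsv := h'.shift_le v₀
  have hxR : |x₀| + Z ≤ R := le_sub_iff_add_le.1 (abs_le.2 ⟨by linarith, by linarith⟩)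
  have hvR : |v₀| + Z ≤ R := le_sub_iff_add_le.1 (abs_le.2 ⟨by linarith, by linarith⟩)
  have hev := eventually_of_doubled_max (F := F) (G := G) (M := M) (e := e) (N := N) (A := A)
    hFs hGs hM hκ he h.contDiff_shift h.contDiff_barrier h'.contDiff_shift h'.contDiff_barrier
    ht0 hτ0 (by
      rw [hηdef]
      filter_upwards [prod_mem_nhds (prod_mem_nhds (Icc_mem_nhds ht0 ht1)
        (Icc_mem_nhds (by linarith : -R < x₀) (by linarith : x₀ < R)))
        (prod_mem_nhds (Icc_mem_nhds hτ0 hτ1)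
          (Icc_mem_nhds (by linarith : -R < v₀) (by linarith : v₀ < R)))] with p hp
      exact hmax' _ hp.1.1 _ hp.1.2 _ hp.2.1 _ hp.2.2)
  refine contact_absurd h h' (hF.slice ht.1).measurable (hG.slice hτ.1).measurable
    (fun y => hFb _ y ht.1) (fun y => hGb _ y hτ.1) hM hκ hκ1 hb hc hC0 hC (hS0 t₀ ht).1
    (hS0 t₀ ht).2 hA hxR hvR hZ hsmall (fun x hx' v hv' => ?_) hev
  have := hmax' t₀ ht x hx' τ₀ hτ v hv'
  simp only [fullPenalty] at this
  linarith

theorem localization_error_lt {M κ Z β C δ : ℝ} (hM : 1 ≤ M) (hκ : 0 < κ) (hκ1 : κ ≤ 1)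
    (hC : 0 ≤ C) (hZ : Z = 32768 * M ^ 2 / κ)
    (hδ : δ = 1 / (4096 * M * (131072 * M ^ 2 + 2 * (C + 34 * M))))
    (hβ0 : 0 ≤ β) (hβ : β ≤ δ * κ ^ 4) :
    (4 * (β / κ ^ 2) * Z + 8 * M / Z)
      + 2 * (β / κ) * (2 * (C / κ + β / κ ^ 2) * (κ / 8) + 4 * M / (κ / 8)) + 2 * (β / κ)
      < κ / (512 * M) := by
  have hδ0 : 0 < δ := by rw [hδ]; positivity
  have hδ1 : δ ≤ 1 := by
    rw [hδ, div_le_one (by positivity)]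
    nlinarith
  have hδe : δ * (131072 * M ^ 2 + 2 * (C + 34 * M)) = 1 / (4096 * M) := by
    rw [hδ]; field_simp
  have hβ1 : β ≤ 1 := hβ.trans (mul_le_one₀ hδ1 (by positivity) (pow_le_one₀ hκ.le hκ1))
  have e1 : 4 * (β / κ ^ 2) * Z = 131072 * M ^ 2 * (β / κ ^ 3) := by
    rw [hZ]; field_simp; ring
  have e2 : 8 * M / Z = κ / (4096 * M) := by rw [hZ]; field_simp; norm_num
  have e3 : 2 * (β / κ) * (2 * (C / κ + β / κ ^ 2) * (κ / 8) + 4 * M / (κ / 8)) + 2 * (β / κ)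
      = 2 * (β / κ ^ 2) * (C / 4 * κ + β / 4 + 32 * M + κ) := by field_simp; ring
  have b1 : β / κ ^ 3 ≤ δ * κ := by
    rw [div_le_iff₀ (by positivity)]; linarith [show δ * κ * κ ^ 3 = δ * κ ^ 4 by ring]
  have b2 : β / κ ^ 2 ≤ δ * κ := by
    refine le_trans ?_ b1
    exact div_le_div_of_nonneg_left hβ0 (by positivity)
      (pow_le_pow_of_le_one hκ.le hκ1 (by norm_num))
  have b3 : C / 4 * κ + β / 4 + 32 * M + κ ≤ C + 34 * M := by nlinarith
  have b4 : 0 ≤ β / κ ^ 2 := by positivity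
  have e4 : κ / (4096 * M) = κ * (1 / (4096 * M)) := by ring
  have e5 : κ / (512 * M) = 8 * (κ * (1 / (4096 * M))) := by field_simp; norm_num
  have p : 0 < κ * (1 / (4096 * M)) := by positivity
  rw [add_assoc, e3, e1, e2, e4, e5]
  have f1 : 131072 * M ^ 2 * (β / κ ^ 3) ≤ 131072 * M ^ 2 * (δ * κ) := by gcongr
  have f2 : 2 * (β / κ ^ 2) * (C / 4 * κ + β / 4 + 32 * M + κ) ≤ 2 * (δ * κ) * (C + 34 * M) := by
    gcongr
  have f3 : 131072 * M ^ 2 * (δ * κ) + 2 * (δ * κ) * (C + 34 * M) = κ * (1 / (4096 * M)) := by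
    rw [← hδe]; ring
  linarith

theorem exists_slope_improvement {M : ℝ} (hM : 1 ≤ M) : ∃ L : ℝ, 0 ≤ L ∧
    ∀ {F G : ℝ → ℝ → ℝ},
      UpperSemicontinuousOn (fun p : ℝ × ℝ => F p.1 p.2) (Ici 0 ×ˢ univ) →
      UpperSemicontinuousOn (fun p : ℝ × ℝ => G p.1 p.2) (Ici 0 ×ˢ univ) →
      (∀ t x, 0 ≤ t → |F t x| ≤ M) → (∀ t x, 0 ≤ t → |G t x| ≤ M) → LocSub F → LocSub G →
      ∀ {κ K R : ℝ}, 0 < κ → κ ≤ 1 → 0 ≤ K →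
      (∀ x ∈ Icc (-R) R, ∀ v ∈ Icc (-R) R, 0 ≤ x + v → F 0 x + G 0 v ≤ K + (x + v)) →
      ∀ t ∈ Icc 0 (1024 * M), ∀ x ∈ Icc (-(R - L / κ ^ 4)) (R - L / κ ^ 4),
        ∀ v ∈ Icc (-(R - L / κ ^ 4)) (R - L / κ ^ 4),
        0 ≤ x + v → F t x + G t v ≤ K + 7 * κ + (1 - t / (2048 * M)) * (x + v) := by
  obtain ⟨C, hC1, hloc⟩ := exists_localizer
  obtain ⟨C', hC'1, hC'⟩ := exists_smoothTransition_bound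
  set δ := 1 / (4096 * M * (131072 * M ^ 2 + 2 * (C' + 34 * M))) with hδ
  have hδ0 : 0 < δ := by positivity
  refine ⟨(4 * M * C / δ + 1) * (4 * M + 4) + 32768 * M ^ 2 + 4, by positivity, ?_⟩
  intro F G hF hG hFb hGb hFs hGs κ K R hκ hκ1 hK hP t ht x hx v hv hxv
  set L := (4 * M * C / δ + 1) * (4 * M + 4) + 32768 * M ^ 2 + 4 with hL
  set m := ⌈4 * M * C / (δ * κ ^ 4)⌉₊ with hm
  set Z := 32768 * M ^ 2 / κ with hZ
  have hκ4 : κ ^ 4 ≤ κ := by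
    simpa using pow_le_pow_of_le_one hκ.le hκ1 (show 1 ≤ 4 by norm_num)
  have hκ41 : κ ^ 4 ≤ 1 := pow_le_one₀ hκ.le hκ1
  have hm0 : 0 < m := Nat.ceil_pos.2 (by positivity)
  have hm0' : (0 : ℝ) < m := by exact_mod_cast hm0
  have hm1 : 4 * M * C / (δ * κ ^ 4) ≤ m := Nat.le_ceil _
  have hm2 : (m : ℝ) ≤ (4 * M * C / δ + 1) / κ ^ 4 := by
    have h1 : (m : ℝ) < 4 * M * C / (δ * κ ^ 4) + 1 := Nat.ceil_lt_add_one (by positivity)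
    have h2 : 1 ≤ 1 / κ ^ 4 := by rw [le_div_iff₀ (by positivity)]; linarith
    rw [add_div, div_div]; linarith
  have hΓL : m * (4 * M + 4) + Z + 3 + 1 ≤ L / κ ^ 4 := by
    have h1 : (m : ℝ) * (4 * M + 4) ≤ (4 * M * C / δ + 1) / κ ^ 4 * (4 * M + 4) := by gcongr
    have h2 : Z ≤ 32768 * M ^ 2 / κ ^ 4 :=
      div_le_div_of_nonneg_left (by positivity) (by positivity) hκ4
    have h3 : 4 ≤ 4 / κ ^ 4 := by rw [le_div_iff₀ (by positivity)]; linarith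
    have h4 : L / κ ^ 4 = (4 * M * C / δ + 1) / κ ^ 4 * (4 * M + 4) + 32768 * M ^ 2 / κ ^ 4
        + 4 / κ ^ 4 := by rw [hL]; ring
    linarith
  have hΓ : 0 ≤ m * (4 * M + 4) + Z + 3 := by positivity
  have hR : m * (4 * M + 4) + Z + 3 < R := by linarith [hx.1, hx.2]
  have hβ : C * (4 * M / m) ≤ δ * κ ^ 4 := by
    rw [div_le_iff₀ (by positivity)] at hm1
    rw [mul_div_assoc', div_le_iff₀ hm0']; linarith
  have hβ0 : 0 ≤ C * (4 * M / m) := by positivity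
  obtain ⟨ξ, B, h⟩ := hloc (hF.slice le_rfl) (fun x => hFb 0 x le_rfl) hκ hκ1
    (by positivity : 0 ≤ Z) hm0 hR hP
  obtain ⟨ξ', B', h'⟩ := hloc (hG.slice le_rfl) (fun x => hGb 0 x le_rfl) hκ hκ1
    (by positivity : 0 ≤ Z) hm0 hR (K := K) (g := F 0) (fun x hx v hv h => by
      rw [add_comm x v] at h ⊢
      linarith [hP v hv x hx h])
  have hZM : 32 * M < Z := by
    rw [hZ, lt_div_iff₀ hκ]; nlinarith
  have := le_of_isLocalizer hF hG hFb hGb hFs hGs hM hκ hκ1 hK h h' hP (by positivity)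
    (by positivity) hΓ (by linarith) (fun u => (hC' u).1) hZM
    (localization_error_lt hM hκ hκ1 (by linarith) hZ hδ hβ0 hβ)
  exact this t ht x ⟨by linarith [hx.1], by linarith [hx.2]⟩ v
    ⟨by linarith [hv.1], by linarith [hv.2]⟩ hxv

/-- On the interval of radius `ρ` around `c`, pairs at time `t` satisfy a one-sided Lipschitz
bound with slope `s` up to the error `K`. -/
def SlopeBound (F G : ℝ → ℝ → ℝ) (c t ρ K s : ℝ) : Prop :=
  ∀ x v, |x - c| ≤ ρ → |v + c| ≤ ρ → 0 ≤ x + v → F t x + G t v ≤ K + s * (x + v)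

theorem exists_slope_improvement_scaled {M : ℝ} (hM : 1 ≤ M) {F G : ℝ → ℝ → ℝ}
    (hF : UpperSemicontinuousOn (fun p : ℝ × ℝ => F p.1 p.2) (Ici 0 ×ˢ univ))
    (hG : UpperSemicontinuousOn (fun p : ℝ × ℝ => G p.1 p.2) (Ici 0 ×ˢ univ))
    (hFb : ∀ t x, 0 ≤ t → |F t x| ≤ M) (hGb : ∀ t x, 0 ≤ t → |G t x| ≤ M)
    (hFs : LocSub F) (hGs : LocSub G) : ∃ L : ℝ, 0 ≤ L ∧
    ∀ {c t₁ ρ κ K s : ℝ}, 0 ≤ t₁ → 0 < s → 0 < κ → κ ≤ 1 → 0 ≤ K →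
      SlopeBound F G c t₁ ρ K s → ∀ t ∈ Icc t₁ (t₁ + 1024 * M / s ^ 2),
        SlopeBound F G c t (ρ - L / κ ^ 4 / s) (K + 7 * κ)
          ((1 - (t - t₁) * s ^ 2 / (2048 * M)) * s) := by
  obtain ⟨L, hL, hstep⟩ := exists_slope_improvement hM
  refine ⟨L, hL, fun {c t₁ ρ κ K s} ht₁ hs hκ hκ1 hK hP t ht x v hx hv hxv => ?_⟩
  have usc : ∀ {H : ℝ → ℝ → ℝ} (d : ℝ),
      UpperSemicontinuousOn (fun p : ℝ × ℝ => H p.1 p.2) (Ici 0 ×ˢ univ) →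
      UpperSemicontinuousOn (fun p : ℝ × ℝ => H (t₁ + p.1 / s ^ 2) (p.2 / s + d))
        (Ici 0 ×ˢ univ) := fun {H} d hH =>
    UpperSemicontinuousOn.comp (g := fun p : ℝ × ℝ => (t₁ + p.1 / s ^ 2, p.2 / s + d)) hH
      (by fun_prop) fun p hp => ⟨add_nonneg ht₁ (div_nonneg hp.1 (by positivity)), trivial⟩
  have abs_le' : ∀ {y r : ℝ}, y ∈ Icc (-(s * r)) (s * r) → |y / s| ≤ r := fun {y r} hy => by
    rw [abs_div, abs_of_pos hs, div_le_iff₀ hs, mul_comm]; exact abs_le.2 hy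
  have key := hstep (usc c hF) (usc (-c) hG)
    (fun t x h => hFb _ _ (add_nonneg ht₁ (div_nonneg h (by positivity))))
    (fun t x h => hGb _ _ (add_nonneg ht₁ (div_nonneg h (by positivity))))
    (hFs.comp_affine ht₁ hs c) (hGs.comp_affine ht₁ hs (-c)) hκ hκ1 hK (R := s * ρ)
    (fun y hy w hw hyw => by
      have := hP (y / s + c) (w / s + -c) (by simpa using abs_le' hy) (by simpa using abs_le' hw)
        (by rw [show y / s + c + (w / s + -c) = (y + w) / s by ring]; positivity)
      simp only [zero_div, add_zero]
      rwa [show s * (y / s + c + (w / s + -c)) = y + w by field_simp; ring] at this)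
  have mem : ∀ {y : ℝ}, |y| ≤ ρ - L / κ ^ 4 / s →
      s * y ∈ Icc (-(s * ρ - L / κ ^ 4)) (s * ρ - L / κ ^ 4) := fun {y} hy => by
    have e : s * ρ - L / κ ^ 4 = s * (ρ - L / κ ^ 4 / s) := by field_simp
    have := abs_le.1 hy
    rw [e]; constructor <;> nlinarith
  have htm : s ^ 2 * (t - t₁) ∈ Icc 0 (1024 * M) := by
    refine ⟨mul_nonneg (by positivity) (by linarith [ht.1]), ?_⟩
    have := ht.2
    rw [← sub_le_iff_le_add', le_div_iff₀ (by positivity)] at this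
    linarith
  have := key _ htm (s * (x - c)) (mem hx) (s * (v + c)) (mem hv)
    (by rw [← mul_add]; exact mul_nonneg hs.le (by linarith))
  rw [show t₁ + s ^ 2 * (t - t₁) / s ^ 2 = t by field_simp; ring,
    show s * (x - c) / s + c = x by field_simp; ring,
    show s * (v + c) / s + -c = v by field_simp; ring] at this
  refine this.trans (le_of_eq ?_)
  ring

/-- Iterating the slope improvement: an arbitrarily steep initial bound yields a bound
on the diagonal whose errors do not depend on the initial slope. -/
theorem add_neg_le_of_slopeBound {M L c s₀ κ₀ : ℝ} {F G : ℝ → ℝ → ℝ} (hM : 1 ≤ M)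
    (hL : 0 ≤ L) (hs₀ : 0 < s₀) (hκ₀ : 0 < κ₀) (hκ1 : κ₀ ≤ 1)
    (hstep : ∀ {t₁ ρ κ K s : ℝ}, 0 ≤ t₁ → 0 < s → 0 < κ → κ ≤ 1 → 0 ≤ K →
      SlopeBound F G c t₁ ρ K s → ∀ t ∈ Icc t₁ (t₁ + 1024 * M / s ^ 2),
        SlopeBound F G c t (ρ - L / κ ^ 4 / s) (K + 7 * κ)
          ((1 - (t - t₁) * s ^ 2 / (2048 * M)) * s)) (k : ℕ) :
    ∀ {t₁ ρ K : ℝ}, 0 ≤ t₁ → 0 ≤ K → SlopeBound F G c t₁ ρ K (2 ^ k * s₀) →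
      ∀ t ∈ Icc t₁ (t₁ + 1024 * M / s₀ ^ 2), ∀ x,
        |x - c| ≤ ρ - 3 * (1 - (2 / 3) ^ (k + 1)) * (L / κ₀ ^ 4 / s₀) →
        F t x + G t (-x) ≤ K + 112 * κ₀ * (1 - (15 / 16) ^ (k + 1)) := by
  have hΛ : 0 ≤ L / κ₀ ^ 4 / s₀ := by positivity
  have diag : ∀ {t ρ K s : ℝ} {x : ℝ}, SlopeBound F G c t ρ K s → |x - c| ≤ ρ →
      F t x + G t (-x) ≤ K := fun {t ρ K s x} h hx => by
    have := h x (-x) hx (by rwa [← abs_neg, neg_add, neg_neg, ← sub_eq_add_neg]) (by simp)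
    simpa using this
  induction k with
  | zero =>
    intro t₁ ρ K ht₁ hK hP t ht x hx
    rw [pow_zero, one_mul] at hP
    have := diag (hstep ht₁ hs₀ hκ₀ hκ1 hK hP t ht) (x := x) (by linarith)
    linarith
  | succ k ih =>
    intro t₁ ρ K ht₁ hK hP t ht x hx
    have hq : (0 : ℝ) < (15 / 16) ^ (k + 1) := by positivity
    have hq1 : ((15 : ℝ) / 16) ^ (k + 1) ≤ 1 := pow_le_one₀ (by norm_num) (by norm_num)
    set κ := κ₀ * (15 / 16) ^ (k + 1) with hκ
    set s := 2 ^ (k + 1) * s₀ with hs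
    have hκ0 : 0 < κ := by positivity
    have hκle : κ ≤ 1 := mul_le_one₀ hκ1 hq.le hq1
    have hs0 : 0 < s := by positivity
    have hε : K + 7 * κ + 112 * κ₀ * (1 - (15 / 16) ^ (k + 1))
        = K + 112 * κ₀ * (1 - (15 / 16) ^ (k + 1 + 1)) := by
      rw [hκ, pow_succ _ (k + 1)]; ring
    have hloss : L / κ ^ 4 / s ≤ (2 / 3) ^ (k + 1) * (L / κ₀ ^ 4 / s₀) := by
      have e : L / κ ^ 4 / s = ((16 / 15) ^ 4 / 2) ^ (k + 1) * (L / κ₀ ^ 4 / s₀) := by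
        have e1 : (((16 : ℝ) / 15) ^ 4 / 2) ^ (k + 1)
            = 1 / (((15 / 16) ^ (k + 1)) ^ 4 * 2 ^ (k + 1)) := by
          rw [← pow_mul, mul_comm (k + 1) 4, pow_mul, ← mul_pow, one_div, ← inv_pow]
          norm_num
        rw [e1, hκ, hs]
        field_simp
      rw [e]
      exact mul_le_mul_of_nonneg_right (pow_le_pow_left₀ (by norm_num) (by norm_num) _) hΛ
    have hloss' : ρ - 3 * (1 - (2 / 3) ^ (k + 1 + 1)) * (L / κ₀ ^ 4 / s₀)
        ≤ (ρ - L / κ ^ 4 / s) - 3 * (1 - (2 / 3) ^ (k + 1)) * (L / κ₀ ^ 4 / s₀) := by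
      rw [pow_succ _ (k + 1)]; linarith
    have hsum : 0 ≤ 3 * (1 - ((2 : ℝ) / 3) ^ (k + 1)) * (L / κ₀ ^ 4 / s₀) := by
      have : ((2 : ℝ) / 3) ^ (k + 1) ≤ 1 := pow_le_one₀ (by norm_num) (by norm_num)
      exact mul_nonneg (by linarith) hΛ
    have h112 : 0 ≤ 112 * κ₀ * (1 - (15 / 16) ^ (k + 1)) :=
      mul_nonneg (by positivity) (by linarith)
    have hdur : 0 ≤ 1024 * M / s ^ 2 := by positivity
    rcases le_total t (t₁ + 1024 * M / s ^ 2) with h | h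
    · have := diag (hstep ht₁ hs0 hκ0 hκle hK hP t ⟨ht.1, h⟩) (x := x) (by linarith)
      linarith
    · have h1 := hstep ht₁ hs0 hκ0 hκle hK hP (t₁ + 1024 * M / s ^ 2) ⟨by linarith, le_rfl⟩
      have e : (1 - (t₁ + 1024 * M / s ^ 2 - t₁) * s ^ 2 / (2048 * M)) * s = 2 ^ k * s₀ := by
        rw [add_sub_cancel_left, div_mul_cancel₀ _ (by positivity), hs, pow_succ]
        field_simp
        norm_num
      rw [e] at h1
      have := ih (by linarith) (by positivity) h1 t ⟨h, by linarith [ht.2]⟩ x (by linarith)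
      linarith

theorem exists_slopeBound {f g : ℝ → ℝ} {M c ρ σ : ℝ} (hf : UpperSemicontinuous f)
    (hg : UpperSemicontinuous g) (hfb : ∀ x, |f x| ≤ M) (hgb : ∀ x, |g x| ≤ M)
    (hfg : ∀ x, f x + g (-x) ≤ 0) (hσ : 0 < σ) :
    ∃ s₁, ∀ s ≥ s₁, ∀ x v, |x - c| ≤ ρ → |v + c| ≤ ρ → 0 ≤ x + v → f x + g v ≤ σ + s * (x + v) := by
  obtain ⟨N₀, -, hN⟩ := exists_penalty
    (s := (Icc (c - ρ) (c + ρ) ×ˢ Icc (-c - ρ) (-c + ρ)) ∩ {p : ℝ × ℝ | 0 ≤ p.1 + p.2})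
    (Φ := fun p : ℝ × ℝ => f p.1 + g p.2) (ρ := fun p => p.1 + p.2) (M := 2 * M) (Λ := σ)
    ((isCompact_Icc.prod isCompact_Icc).inter_right (isClosed_le continuous_const (by fun_prop)))
    (((hf.comp continuous_fst).add (hg.comp continuous_snd)).upperSemicontinuousOn _)
    (fun p _ => by linarith [(abs_le.1 (hfb p.1)).2, (abs_le.1 (hgb p.2)).2])
    (by fun_prop) (fun p hp => hp.2)
    (fun p _ h0 => by
      have := hfg p.1
      rw [show -p.1 = p.2 by linarith] at this
      linarith)
  refine ⟨N₀, fun s hs x v hx hv hxv => ?_⟩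
  have h1 := abs_le.1 hx
  have h2 := abs_le.1 hv
  have := hN s hs (x, v) ⟨⟨⟨by linarith, by linarith⟩, ⟨by linarith, by linarith⟩⟩, hxv⟩
  simp only at this
  linarith

/-- Comparison for two bounded subsolutions in reflected form. -/
theorem add_neg_nonpos_of_locSub {M : ℝ} (hM : 1 ≤ M) {F G : ℝ → ℝ → ℝ}
    (hF : UpperSemicontinuousOn (fun p : ℝ × ℝ => F p.1 p.2) (Ici 0 ×ˢ univ))
    (hG : UpperSemicontinuousOn (fun p : ℝ × ℝ => G p.1 p.2) (Ici 0 ×ˢ univ))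
    (hFb : ∀ t x, 0 ≤ t → |F t x| ≤ M) (hGb : ∀ t x, 0 ≤ t → |G t x| ≤ M)
    (hFs : LocSub F) (hGs : LocSub G) (h0 : ∀ x, F 0 x + G 0 (-x) ≤ 0) {t : ℝ} (ht : 0 ≤ t)
    (x : ℝ) : F t x + G t (-x) ≤ 0 := by
  obtain ⟨L, hL, hstep⟩ := exists_slope_improvement_scaled hM hF hG hFb hGb hFs hGs
  refine le_of_forall_pos_le_add fun ε hε => ?_
  set κ₀ := min 1 (ε / 224) with hκ₀
  have hκ0 : 0 < κ₀ := by positivity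
  have hκε : κ₀ ≤ ε / 224 := min_le_right _ _
  set s₀ := 1 / (t + 1) with hs₀
  have hs0 : 0 < s₀ := by positivity
  have hΛ : 0 ≤ L / κ₀ ^ 4 / s₀ := by positivity
  obtain ⟨s₁, hs₁⟩ := exists_slopeBound (c := x) (ρ := 3 * (L / κ₀ ^ 4 / s₀)) (hF.slice le_rfl)
    (hG.slice le_rfl) (fun x => hFb 0 x le_rfl) (fun x => hGb 0 x le_rfl) h0 (half_pos hε)
  obtain ⟨k, hk⟩ := pow_unbounded_of_one_lt (s₁ / s₀) (one_lt_two (α := ℝ))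
  have hP : SlopeBound F G x 0 (3 * (L / κ₀ ^ 4 / s₀)) (ε / 2) (2 ^ k * s₀) :=
    hs₁ _ ((div_lt_iff₀ hs0).1 hk).le
  have htm : t ∈ Icc 0 (0 + 1024 * M / s₀ ^ 2) := by
    refine ⟨ht, ?_⟩
    rw [hs₀, one_div, inv_pow, div_inv_eq_mul]
    nlinarith
  have hp : (0 : ℝ) ≤ (2 / 3) ^ (k + 1) := by positivity
  have hq : (0 : ℝ) ≤ (15 / 16) ^ (k + 1) := by positivity
  have := add_neg_le_of_slopeBound hM hL hs0 hκ0 (min_le_left _ _) hstep k le_rfl (half_pos hε).le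
    hP t htm x (by
      rw [sub_self, abs_zero]
      nlinarith [mul_nonneg hp hΛ])
  nlinarith [mul_nonneg hκ0.le hq]

/-- Comparison principle: a bounded viscosity subsolution `F₁` and a bounded
viscosity supersolution `F₂` of `∂ₜF + (∂ₓF)₊ H̃[F] = 0` on `(0,∞) × ℝ` with
`F₁(0,·) ≤ F₂(0,·)` satisfy `F₁ ≤ F₂` on `[0,∞) × ℝ`. -/
theorem comparison_viscosity_dyson
    (F₁ F₂ : ℝ → ℝ → ℝ) (M : ℝ)
    (hb₁ : ∀ t x, 0 ≤ t → |F₁ t x| ≤ M)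
    (hb₂ : ∀ t x, 0 ≤ t → |F₂ t x| ≤ M)
    (hsub : IsSubsolution HTilde F₁)
    (hsup : IsSupersolution HTilde F₂)
    (hinit : ∀ x, F₁ 0 x ≤ F₂ 0 x) :
    ∀ t x, 0 ≤ t → F₁ t x ≤ F₂ t x := by
  have h1 : ∀ t x, 0 ≤ t → |F₁ t x| ≤ max M 1 := fun t x h => (hb₁ t x h).trans (le_max_left _ _)
  have h2 : ∀ t x, 0 ≤ t → |-F₂ t (-x)| ≤ max M 1 := fun t x h => by
    rw [abs_neg]; exact (hb₂ t (-x) h).trans (le_max_left _ _)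
  intro t x ht
  have := add_neg_nonpos_of_locSub (le_max_right M 1) hsub.1 hsup.reflect.1 h1 h2 (hsub.locSub h1)
    (hsup.reflect.locSub h2) (fun x => by simpa using hinit x) ht x
  simpa using this
end

section
/- Let N ≥ 1 and let λ, μ : [0,∞) → ℝᴺ be differentiable functions whose components satisfy λ¹(t) < λ²(t) < ⋯ < λᴺ(t) and μ¹(t) < μ²(t) < ⋯ < μᴺ(t) for every t ≥ 0, and which solve, for every i and every t ≥ 0, d/dt λⁱ(t) = (1/N) ∑_{j≠i} 1/(λⁱ(t) − λʲ(t)) and d/dt μⁱ(t) = (1/N) ∑_{j≠i} 1/(μⁱ(t) − μʲ(t)). If λⁱ(0) ≤ μⁱ(0) for every i, then λⁱ(t) ≤ μⁱ(t) for every i and every t ≥ 0. -/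
open Filter Set

/-- At the right endpoint of an interval on which `g` is maximal there, the derivative of `g` is
nonnegative. -/
theorem hasDerivAt_nonneg_of_isMaxOn_Icc {g : ℝ → ℝ} {g' a b : ℝ} (hab : a < b)
    (hg : HasDerivAt g g' b) (hmax : ∀ s ∈ Icc a b, g s ≤ g b) : 0 ≤ g' := by
  have hslope : Tendsto (slope g b) (nhdsWithin b (Iio b)) (nhds g') :=
    (hasDerivWithinAt_iff_tendsto_slope' self_notMem_Iio).1 hg.hasDerivWithinAt
  refine ge_of_tendsto hslope ?_
  filter_upwards [Ico_mem_nhdsLT hab] with s hs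
  rw [slope_def_field]
  exact div_nonneg_of_nonpos (by linarith [hmax s (Ico_subset_Icc_self hs)]) (by linarith [hs.2])

/-- Maximum principle for a finite family of functions: if a component has nonpositive derivative
whenever it is the largest one, then nonpositivity of the family is preserved. -/
theorem nonpos_of_deriv_nonpos_at_max {ι : Type*} [Finite ι] {f f' : ℝ → ι → ℝ}
    (hf : ∀ i t, 0 ≤ t → HasDerivWithinAt (fun s => f s i) (f' t i) (Ici 0) t)
    (hf' : ∀ t, 0 ≤ t → ∀ i, (∀ j, f t j ≤ f t i) → f' t i ≤ 0)
    (h0 : ∀ i, f 0 i ≤ 0) {T : ℝ} (hT : 0 ≤ T) (i : ι) : f T i ≤ 0 := by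
  have : Nonempty ι := ⟨i⟩
  have key : ∀ ε > 0, f T i - ε * T ≤ 0 := by
    intro ε hε
    have hex : ∀ k, ∃ t ∈ Icc 0 T, ∀ s ∈ Icc 0 T, f s k - ε * s ≤ f t k - ε * t := by
      intro k
      refine isCompact_Icc.exists_isMaxOn (nonempty_Icc.2 hT) (f := fun s => f s k - ε * s) ?_
      refine ContinuousOn.sub (fun t ht => ?_) (by fun_prop)
      exact (hf k t ht.1).continuousWithinAt.mono Icc_subset_Ici_self
    choose τ hτ hmax using hex
    obtain ⟨k, hk⟩ := Finite.exists_max fun k => f (τ k) k - ε * τ k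
    have hall : ∀ j, ∀ s ∈ Icc 0 T, f s j - ε * s ≤ f (τ k) k - ε * τ k :=
      fun j s hs => (hmax j s hs).trans (hk j)
    rcases (hτ k).1.eq_or_lt with hzero | hpos
    · have hle := hall i T ⟨hT, le_rfl⟩
      rw [← hzero] at hle
      linarith [h0 k]
    · have hder : HasDerivAt (fun s => f s k - ε * s) (f' (τ k) k - ε * 1) (τ k) :=
        ((hf k _ hpos.le).hasDerivAt (Ici_mem_nhds hpos)).sub ((hasDerivAt_id _).const_mul ε)
      have hnonneg := hasDerivAt_nonneg_of_isMaxOn_Icc hpos hder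
        fun s hs => hall k s ⟨hs.1, hs.2.trans (hτ k).2⟩
      have hnonpos := hf' (τ k) hpos.le k fun j => by linarith [hall j (τ k) (hτ k)]
      linarith
  have hlim : Tendsto (fun ε : ℝ => f T i - ε * T) (nhdsWithin 0 (Ioi 0)) (nhds (f T i)) := by
    have hcont : Continuous fun ε : ℝ => f T i - ε * T := by fun_prop
    simpa using (hcont.tendsto 0).mono_left nhdsWithin_le_nhds
  exact le_of_tendsto hlim (eventually_mem_nhdsWithin.mono key)

/-- The Dyson drift at the index maximizing `x - y` is not larger for `x` than for `y`. -/
theorem sum_one_div_sub_le_of_max {ι : Type*} [LinearOrder ι] [Fintype ι] {x y : ι → ℝ}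
    (hx : StrictMono x) (hy : StrictMono y) {i : ι} (hi : ∀ j, x j - y j ≤ x i - y i) :
    ∑ j ∈ Finset.univ.erase i, 1 / (x i - x j) ≤ ∑ j ∈ Finset.univ.erase i, 1 / (y i - y j) := by
  refine Finset.sum_le_sum fun j hj => ?_
  have hgap : y i - y j ≤ x i - x j := by linarith [hi j]
  rcases (Finset.ne_of_mem_erase hj).lt_or_gt with hji | hij
  · exact one_div_le_one_div_of_le (sub_pos.2 (hy hji)) hgap
  · exact one_div_le_one_div_of_neg_of_le (sub_neg.2 (hx hij)) hgap

/-- Comparison principle (spectral dominance) for the deterministic Dyson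
particle system: two ordered solutions of
`dλⁱ/dt = (1/N) ∑_{j ≠ i} 1/(λⁱ - λʲ)` on `[0,∞)` with ordered initial data
`λⁱ(0) ≤ μⁱ(0)` remain ordered for all times. -/
theorem dyson_particles_comparison
    (N : ℕ) (hN : 1 ≤ N)
    (lam mu : ℝ → Fin N → ℝ)
    (hlam_ord : ∀ t, 0 ≤ t → StrictMono (lam t))
    (hmu_ord : ∀ t, 0 ≤ t → StrictMono (mu t))
    (hlam : ∀ (i : Fin N) (t : ℝ), 0 ≤ t →
      HasDerivWithinAt (fun s => lam s i)
        ((1 / (N : ℝ)) * ∑ j ∈ Finset.univ.erase i, 1 / (lam t i - lam t j))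
        (Set.Ici 0) t)
    (hmu : ∀ (i : Fin N) (t : ℝ), 0 ≤ t →
      HasDerivWithinAt (fun s => mu s i)
        ((1 / (N : ℝ)) * ∑ j ∈ Finset.univ.erase i, 1 / (mu t i - mu t j))
        (Set.Ici 0) t)
    (hinit : ∀ i, lam 0 i ≤ mu 0 i) :
    ∀ t, 0 ≤ t → ∀ i, lam t i ≤ mu t i := by
  intro t ht i
  exact sub_nonpos.1 <| nonpos_of_deriv_nonpos_at_max (f := fun t i => lam t i - mu t i)
    (fun i t ht => (hlam i t ht).sub (hmu i t ht))
    (fun t ht i hi => sub_nonpos.2 <| mul_le_mul_of_nonneg_left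
      (sum_one_div_sub_le_of_max (hlam_ord t ht) (hmu_ord t ht) hi) (by positivity))
    (fun i => sub_nonpos.2 (hinit i)) ht i
end

section
/- Let N ≥ 1 and let λ, μ : [0,∞) → ℝᴺ be differentiable functions whose components satisfy λ¹(t) < ⋯ < λᴺ(t) and μ¹(t) < ⋯ < μᴺ(t) for every t ≥ 0, and which solve, for every i and every t ≥ 0, d/dt λⁱ(t) = ∑_{j≠i} 1/(λⁱ(t) − λʲ(t)) and d/dt μⁱ(t) = ∑_{j≠i} 1/(μⁱ(t) − μʲ(t)). Then for every p ∈ [1,∞] and every t ≥ 0, ‖λ(t) − μ(t)‖_p ≤ ‖λ(0) − μ(0)‖_p, where ‖·‖_p denotes the ℓᵖ norm on ℝᴺ. -/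
open Filter Set

/-- Symmetrisation: a monotone transform of `a - b` pairs nonpositively with the difference of the
Dyson drifts at two ordered configurations `a` and `b`. -/
theorem sum_mul_dysonDrift_sub_nonpos {ι : Type*} [Fintype ι] [LinearOrder ι] {a b : ι → ℝ}
    (ha : StrictMono a) (hb : StrictMono b) {g : ℝ → ℝ} (hg : Monotone g) :
    ∑ i, g (a i - b i) * (∑ j ∈ Finset.univ.erase i, 1 / (a i - a j) -
      ∑ j ∈ Finset.univ.erase i, 1 / (b i - b j)) ≤ 0 := by
  let k : ι → ι → ℝ := fun i j => 1 / (a i - a j) - 1 / (b i - b j)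
  have hk : ∀ i, ∑ j ∈ Finset.univ.erase i, 1 / (a i - a j) -
      ∑ j ∈ Finset.univ.erase i, 1 / (b i - b j) = ∑ j, k i j := by
    intro i
    rw [← Finset.sum_sub_distrib]
    exact Finset.sum_erase _ (by simp)
  have hanti : ∀ i j, k j i = -k i j := by
    intro i j
    simp only [k]
    rw [← neg_sub (a i), ← neg_sub (b i), one_div_neg_eq_neg_one_div, one_div_neg_eq_neg_one_div]
    ring
  simp only [hk, Finset.mul_sum]
  have hswap : ∑ i, ∑ j, g (a i - b i) * k i j = ∑ i, ∑ j, -(g (a j - b j) * k i j) := by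
    rw [Finset.sum_comm]
    refine Finset.sum_congr rfl fun i _ => Finset.sum_congr rfl fun j _ => ?_
    rw [hanti, mul_neg]
  have hpair : ∀ i j, (g (a i - b i) - g (a j - b j)) * k i j ≤ 0 := by
    intro i j
    rcases eq_or_ne i j with rfl | hij
    · simp
    have hpos : 0 < (a i - a j) * (b i - b j) := by
      rcases lt_or_gt_of_ne hij with h | h
      · exact mul_pos_of_neg_of_neg (sub_neg.2 (ha h)) (sub_neg.2 (hb h))
      · exact mul_pos (sub_pos.2 (ha h)) (sub_pos.2 (hb h))
    have hka : k i j = -((a i - b i) - (a j - b j)) / ((a i - a j) * (b i - b j)) := by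
      simp only [k]
      rw [div_sub_div _ _ (left_ne_zero_of_mul hpos.ne') (right_ne_zero_of_mul hpos.ne')]
      ring
    rw [hka, mul_div_assoc']
    refine div_nonpos_of_nonpos_of_nonneg ?_ hpos.le
    rcases le_total (a i - b i) (a j - b j) with h | h
    · nlinarith [hg h]
    · nlinarith [hg h]
  have htwo : ∑ i, ∑ j, g (a i - b i) * k i j + ∑ i, ∑ j, g (a i - b i) * k i j ≤ 0 := by
    nth_rewrite 2 [hswap]
    simp only [← Finset.sum_add_distrib]
    refine Finset.sum_nonpos fun i _ => Finset.sum_nonpos fun j _ => ?_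
    linarith [hpair i j]
  linarith

/-- Along two ordered Dyson flows, `∑ φ(λⁱ - μⁱ)` is nonincreasing for every differentiable
convex `φ`. -/
theorem antitoneOn_sum_convex_dysonFlow_sub {ι : Type*} [Fintype ι] [LinearOrder ι]
    {lam mu : ℝ → ι → ℝ}
    (hlam_ord : ∀ t, 0 ≤ t → StrictMono (lam t))
    (hmu_ord : ∀ t, 0 ≤ t → StrictMono (mu t))
    (hlam : ∀ (i : ι) (t : ℝ), 0 ≤ t →
      HasDerivWithinAt (fun s => lam s i)
        (∑ j ∈ Finset.univ.erase i, 1 / (lam t i - lam t j)) (Set.Ici 0) t)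
    (hmu : ∀ (i : ι) (t : ℝ), 0 ≤ t →
      HasDerivWithinAt (fun s => mu s i)
        (∑ j ∈ Finset.univ.erase i, 1 / (mu t i - mu t j)) (Set.Ici 0) t)
    {φ : ℝ → ℝ} (hφ : ConvexOn ℝ univ φ) (hφd : Differentiable ℝ φ) :
    AntitoneOn (fun t => ∑ i, φ (lam t i - mu t i)) (Set.Ici 0) := by
  have hderiv : ∀ t, 0 ≤ t → HasDerivWithinAt (fun s => ∑ i, φ (lam s i - mu s i))
      (∑ i, deriv φ (lam t i - mu t i) *
        (∑ j ∈ Finset.univ.erase i, 1 / (lam t i - lam t j) -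
          ∑ j ∈ Finset.univ.erase i, 1 / (mu t i - mu t j))) (Set.Ici 0) t := fun t ht =>
    HasDerivWithinAt.fun_sum fun i _ =>
      (hφd _).hasDerivAt.comp_hasDerivWithinAt t ((hlam i t ht).fun_sub (hmu i t ht))
  have hmono : Monotone (deriv φ) :=
    monotoneOn_univ.1 (hφ.monotoneOn_deriv fun x _ => hφd x)
  refine antitoneOn_of_hasDerivWithinAt_nonpos (convex_Ici 0)
    (fun t ht => (hderiv t ht).continuousWithinAt)
    (fun t ht => (hderiv t (interior_subset ht)).mono interior_subset) fun t ht => ?_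
  have ht0 : 0 ≤ t := interior_subset ht
  exact sum_mul_dysonDrift_sub_nonpos (hlam_ord t ht0) (hmu_ord t ht0) hmono

theorem convexOn_abs_rpow {p : ℝ} (hp : 1 ≤ p) : ConvexOn ℝ univ fun x : ℝ => |x| ^ p := by
  refine ⟨convex_univ, fun x _ y _ a b ha hb hab => ?_⟩
  calc |a • x + b • y| ^ p ≤ (a • |x| + b • |y|) ^ p := by
        refine Real.rpow_le_rpow (abs_nonneg _) ?_ (by linarith)
        simpa [abs_mul, abs_of_nonneg ha, abs_of_nonneg hb] using abs_add_le (a * x) (b * y)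
    _ ≤ a • |x| ^ p + b • |y| ^ p :=
        (convexOn_rpow hp).2 (abs_nonneg x) (abs_nonneg y) ha hb hab

/-- If all power sums with exponent `p > 1` are dominated, so is the sum of absolute values. -/
theorem sum_abs_le_of_forall_sum_abs_rpow_le {ι : Type*} [Fintype ι] {x y : ι → ℝ}
    (h : ∀ p : ℝ, 1 < p → ∑ i, |x i| ^ p ≤ ∑ i, |y i| ^ p) : ∑ i, |x i| ≤ ∑ i, |y i| := by
  have hlim : ∀ z : ι → ℝ,
      Tendsto (fun p : ℝ => ∑ i, |z i| ^ p) (nhdsWithin 1 (Set.Ioi 1)) (nhds (∑ i, |z i|)) := by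
    intro z
    refine tendsto_finsetSum _ fun i _ => ?_
    have hc := (Real.continuousAt_const_rpow' (a := |z i|) one_ne_zero).tendsto
    rw [Real.rpow_one] at hc
    exact hc.mono_left nhdsWithin_le_nhds
  exact le_of_tendsto_of_tendsto (hlim x) (hlim y) (eventually_mem_nhdsWithin.mono h)

/-- If all power sums with exponent `p > 1` are dominated, so is the supremum norm. -/
theorem iSup_abs_le_of_forall_sum_abs_rpow_le {ι : Type*} [Fintype ι] [Nonempty ι] {x y : ι → ℝ}
    (h : ∀ p : ℝ, 1 < p → ∑ i, |x i| ^ p ≤ ∑ i, |y i| ^ p) : ⨆ i, |x i| ≤ ⨆ i, |y i| := by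
  refine ciSup_le fun i => ?_
  set M := ⨆ j, |y j|
  have hM : ∀ j, |y j| ≤ M := le_ciSup (Set.finite_range fun j => |y j|).bddAbove
  have hM0 : 0 ≤ M := (abs_nonneg _).trans (hM i)
  have hbound : ∀ p : ℝ, 1 < p → |x i| ≤ (Fintype.card ι : ℝ) ^ p⁻¹ * M := by
    intro p hp
    have hp0 : 0 < p := by linarith
    have hpow : |x i| ^ p ≤ Fintype.card ι * M ^ p :=
      calc |x i| ^ p ≤ ∑ j, |x j| ^ p :=
            Finset.single_le_sum (f := fun j => |x j| ^ p) (fun j _ => by positivity)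
              (Finset.mem_univ i)
        _ ≤ ∑ j, |y j| ^ p := h p hp
        _ ≤ ∑ _j : ι, M ^ p := Finset.sum_le_sum fun j _ =>
            Real.rpow_le_rpow (abs_nonneg _) (hM j) hp0.le
        _ = Fintype.card ι * M ^ p := by simp
    have hroot := Real.rpow_le_rpow (by positivity) hpow (inv_nonneg.2 hp0.le)
    rwa [Real.rpow_rpow_inv (abs_nonneg _) hp0.ne', Real.mul_rpow (by positivity) (by positivity),
      Real.rpow_rpow_inv hM0 hp0.ne'] at hroot
  have hcard : (Fintype.card ι : ℝ) ≠ 0 := Nat.cast_ne_zero.2 Fintype.card_ne_zero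
  have hlim : Tendsto (fun p : ℝ => (Fintype.card ι : ℝ) ^ p⁻¹ * M) atTop (nhds M) := by
    have hc := ((Real.continuousAt_const_rpow (b := 0) hcard).tendsto.comp
      tendsto_inv_atTop_zero).mul_const M
    simpa using hc
  exact ge_of_tendsto hlim ((eventually_gt_atTop 1).mono hbound)

/-- The deterministic Dyson flow `λ̇ⁱ = ∑_{j≠i} 1/(λⁱ - λʲ)` is a
contraction in every `ℓᵖ` norm, `p ∈ [1,∞]`: for two ordered solutions,
`‖λ(t) - μ(t)‖_p ≤ ‖λ(0) - μ(0)‖_p` for all `t ≥ 0` (the `p = ∞` case being the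
supremum norm). -/
theorem dyson_flow_lp_contraction
    (N : ℕ) (hN : 1 ≤ N)
    (lam mu : ℝ → Fin N → ℝ)
    (hlam_ord : ∀ t, 0 ≤ t → StrictMono (lam t))
    (hmu_ord : ∀ t, 0 ≤ t → StrictMono (mu t))
    (hlam : ∀ (i : Fin N) (t : ℝ), 0 ≤ t →
      HasDerivWithinAt (fun s => lam s i)
        (∑ j ∈ Finset.univ.erase i, 1 / (lam t i - lam t j)) (Set.Ici 0) t)
    (hmu : ∀ (i : Fin N) (t : ℝ), 0 ≤ t →
      HasDerivWithinAt (fun s => mu s i)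
        (∑ j ∈ Finset.univ.erase i, 1 / (mu t i - mu t j)) (Set.Ici 0) t) :
    ∀ t, 0 ≤ t →
      (∀ p : ℝ, 1 ≤ p →
        (∑ i, |lam t i - mu t i| ^ p) ^ (1 / p) ≤
          (∑ i, |lam 0 i - mu 0 i| ^ p) ^ (1 / p)) ∧
      (⨆ i, |lam t i - mu t i|) ≤ ⨆ i, |lam 0 i - mu 0 i| := by
  intro t ht
  have hpow : ∀ p : ℝ, 1 < p → ∑ i, |lam t i - mu t i| ^ p ≤ ∑ i, |lam 0 i - mu 0 i| ^ p :=
    fun p hp => antitoneOn_sum_convex_dysonFlow_sub hlam_ord hmu_ord hlam hmu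
      (convexOn_abs_rpow hp.le) (fun x => (hasDerivAt_abs_rpow x hp).differentiableAt)
      Set.self_mem_Ici ht ht
  have : Nonempty (Fin N) := ⟨⟨0, hN⟩⟩
  refine ⟨fun p hp => ?_, iSup_abs_le_of_forall_sum_abs_rpow_le hpow⟩
  refine Real.rpow_le_rpow (by positivity) ?_ (by positivity)
  rcases hp.eq_or_lt with rfl | hp
  · simpa only [Real.rpow_one] using sum_abs_le_of_forall_sum_abs_rpow_le hpow
  · exact hpow p hp
end
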